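/- Let R be a commutative Noetherian local domain containing a field of characteristic p > 0. Assume R is a surjective image of a Gorenstein local ring. Let R^+ denote the absolute integral closure of R, i.e. the integral closure of R in a fixed algebraic closure K̄ of its fraction field K. Then every system of parameters x_1, …, x_d of R (where d = dim R) is a regular sequence on R^+. -/

import Mathlib

open CategoryTheory IsLocalRing

set_option synthInstance.maxHeartbeats 1000000
set_option maxHeartbeats 2000000

universe u

/-- A commutative local ring `A` is a *Gorenstein local ring* if it is Noetherian, local,
and has finite injective dimension as a module over itself; finiteness of the injective
dimension is expressed (equivalently, by dimension shifting) by the vanishing of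
`Ext^i(N, A)` for all `A`-modules `N` and all `i` larger than some fixed bound `n`. -/
def IsGorensteinLocalRing (A : Type u) [CommRing A] : Prop :=
  IsNoetherianRing A ∧ IsLocalRing A ∧
    ∃ n : ℕ, ∀ i : ℕ, n < i → ∀ N : ModuleCat.{u} A,
      Subsingleton (((Ext A (ModuleCat.{u} A) i).obj (Opposite.op N)).obj (ModuleCat.of A A))

/-- `R` is a surjective (ring-homomorphic) image of a Gorenstein local ring. -/
def IsImageOfGorensteinLocalRing (R : Type u) [CommRing R] : Prop :=
  ∃ (A : Type u) (_ : CommRing A), IsGorensteinLocalRing A ∧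
    ∃ f : A →+* R, Function.Surjective f

namespace PlusClosure

section Cocycle

variable {Λ : Type u} [CommRing Λ] (K : CochainComplex (ModuleCat.{u} Λ) ℕ)

/-- A cocycle, as an element of the object of cycles. -/
noncomputable def cocycleMk (i : ℕ) : LinearMap.ker (K.d i (i + 1)).hom →ₗ[Λ] K.cycles i :=
  (K.liftCycles (ModuleCat.ofHom (LinearMap.ker (K.d i (i + 1)).hom).subtype) (i + 1)
    (by simp) (by ext x; exact x.2)).hom

theorem iCycles_cocycleMk (i : ℕ) (z : LinearMap.ker (K.d i (i + 1)).hom) :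
    (K.iCycles i).hom (cocycleMk K i z) = z := by
  have := K.liftCycles_i (ModuleCat.ofHom (LinearMap.ker (K.d i (i + 1)).hom).subtype) (i + 1)
    (by simp) (by ext x; exact x.2)
  exact congrArg (fun g => g.hom z) this

theorem iCycles_injective (i : ℕ) : Function.Injective (K.iCycles i).hom :=
  (ModuleCat.mono_iff_injective (K.iCycles i)).1 inferInstance

/-- The class in cohomology of a cocycle. -/
noncomputable def cocycleClass (i : ℕ) :
    LinearMap.ker (K.d i (i + 1)).hom →ₗ[Λ] K.homology i :=
  (K.homologyπ i).hom ∘ₗ cocycleMk K i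

theorem cocycleClass_surjective (i : ℕ) : Function.Surjective (cocycleClass K i) := by
  intro c
  obtain ⟨z, rfl⟩ := (ModuleCat.epi_iff_surjective (K.homologyπ i)).1 inferInstance c
  have hz : (K.d i (i + 1)).hom ((K.iCycles i).hom z) = 0 := by
    rw [← ModuleCat.comp_apply, K.iCycles_d]; rfl
  refine ⟨⟨(K.iCycles i).hom z, hz⟩, ?_⟩
  simp only [cocycleClass, LinearMap.comp_apply]
  congr 1
  exact iCycles_injective K i (iCycles_cocycleMk K i _)

theorem cocycleClass_eq_zero_iff (i : ℕ) (z : LinearMap.ker (K.d i (i + 1)).hom) :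
    cocycleClass K i z = 0 ↔ ∃ w, (K.d ((ComplexShape.up ℕ).prev i) i).hom w = z := by
  have hex : (ShortComplex.mk (K.toCycles ((ComplexShape.up ℕ).prev i) i) (K.homologyπ i)
      (by simp)).Exact :=
    ShortComplex.exact_of_g_is_cokernel _ (K.homologyIsCokernel _ i rfl)
  rw [ShortComplex.moduleCat_exact_iff] at hex
  simp only [cocycleClass, LinearMap.comp_apply]
  have key (w) : (K.iCycles i).hom ((K.toCycles ((ComplexShape.up ℕ).prev i) i).hom w) =
      (K.d ((ComplexShape.up ℕ).prev i) i).hom w := by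
    rw [← ModuleCat.comp_apply, K.toCycles_i]
  constructor
  · intro h
    obtain ⟨w, hw⟩ := hex _ h
    refine ⟨w, ?_⟩
    rw [← key, ← iCycles_cocycleMk K i z]
    exact congrArg (K.iCycles i).hom hw
  · rintro ⟨w, hw⟩
    have : cocycleMk K i z = (K.toCycles ((ComplexShape.up ℕ).prev i) i).hom w := by
      apply iCycles_injective
      rw [iCycles_cocycleMk, ← hw, key]
    rw [this, ← ModuleCat.comp_apply, K.toCycles_comp_homologyπ]
    rfl

theorem cocycleClass_succ_eq_zero_iff (i : ℕ) (z : LinearMap.ker (K.d (i + 1) (i + 2)).hom) :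
    cocycleClass K (i + 1) z = 0 ↔ ∃ w, (K.d i (i + 1)).hom w = z := by
  rw [cocycleClass_eq_zero_iff, CochainComplex.prev_nat_succ]

theorem cocycleClass_zero_eq_zero_iff (z : LinearMap.ker (K.d 0 1).hom) :
    cocycleClass K 0 z = 0 ↔ z = 0 := by
  rw [cocycleClass_eq_zero_iff, CochainComplex.prev_nat_zero, K.shape 0 0 (by simp)]
  constructor
  · rintro ⟨w, hw⟩
    exact Subtype.ext hw.symm
  · rintro rfl
    exact ⟨0, by simp⟩

variable {K} {L : CochainComplex (ModuleCat.{u} Λ) ℕ} (f : K ⟶ L)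

theorem map_mem_cocycle (i : ℕ) (z : LinearMap.ker (K.d i (i + 1)).hom) :
    (f.f i).hom z.1 ∈ LinearMap.ker (L.d i (i + 1)).hom := by
  rw [LinearMap.mem_ker, ← ModuleCat.comp_apply, f.comm, ModuleCat.comp_apply]
  have : (K.d i (i + 1)).hom z.1 = 0 := z.2
  rw [this, map_zero]

theorem homologyMap_cocycleClass (i : ℕ) (z : LinearMap.ker (K.d i (i + 1)).hom) :
    (HomologicalComplex.homologyMap f i).hom (cocycleClass K i z) =
      cocycleClass L i ⟨(f.f i).hom z.1, map_mem_cocycle f i z⟩ := by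
  simp only [cocycleClass, LinearMap.comp_apply]
  rw [← ModuleCat.comp_apply, HomologicalComplex.homologyπ_naturality, ModuleCat.comp_apply]
  congr 1
  apply iCycles_injective
  rw [iCycles_cocycleMk, ← ModuleCat.comp_apply, HomologicalComplex.cyclesMap_i,
    ModuleCat.comp_apply, iCycles_cocycleMk]

end Cocycle

section Cech

variable {Λ : Type u} [CommRing Λ] {ι : Type} (y : ι → Λ)

/-- The submonoid of powers of `y a`. -/
abbrev pw (a : ι) : Submonoid Λ := Submonoid.powers (y a)

/-- The product of the localizations of a module at the powers of the elements `y a`. -/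
abbrev LocProd (M : Type u) [AddCommGroup M] [Module Λ M] : Type u :=
  ∀ a : ι, LocalizedModule (pw y a) M

/-- Functoriality of `LocProd`. -/
noncomputable def LocProd.map {M N : Type u} [AddCommGroup M] [Module Λ M] [AddCommGroup N]
    [Module Λ N] (f : M →ₗ[Λ] N) : LocProd y M →ₗ[Λ] LocProd y N :=
  LinearMap.pi fun a => (IsLocalizedModule.map (pw y a) (LocalizedModule.mkLinearMap (pw y a) M)
    (LocalizedModule.mkLinearMap (pw y a) N) f) ∘ₗ LinearMap.proj a

/-- The diagonal localization map. -/
noncomputable def LocProd.diag (M : Type u) [AddCommGroup M] [Module Λ M] :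
    M →ₗ[Λ] LocProd y M :=
  LinearMap.pi fun a => LocalizedModule.mkLinearMap (pw y a) M

section

variable {M N : Type u} [AddCommGroup M] [Module Λ M] [AddCommGroup N] [Module Λ N]

theorem LocProd.diag_apply (m : M) (a : ι) : LocProd.diag y M m a = LocalizedModule.mk m 1 := rfl

theorem LocProd.map_apply (f : M →ₗ[Λ] N) (x : LocProd y M) (a : ι) :
    LocProd.map y f x a = IsLocalizedModule.map (pw y a)
      (LocalizedModule.mkLinearMap (pw y a) M) (LocalizedModule.mkLinearMap (pw y a) N) f (x a) :=
  rfl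

theorem map_mk (S : Submonoid Λ) (f : M →ₗ[Λ] N) (m : M) (s : S) :
    IsLocalizedModule.map S (LocalizedModule.mkLinearMap S M) (LocalizedModule.mkLinearMap S N) f
      (LocalizedModule.mk m s) = LocalizedModule.mk (f m) s := by
  rw [IsLocalizedModule.mk_eq_mk', IsLocalizedModule.map_mk', ← IsLocalizedModule.mk_eq_mk']

theorem LocProd.map_diag (f : M →ₗ[Λ] N) (m : M) :
    LocProd.map y f (LocProd.diag y M m) = LocProd.diag y N (f m) := by
  ext a
  rw [LocProd.map_apply, LocProd.diag_apply, map_mk, LocProd.diag_apply]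

theorem LocProd.map_id : LocProd.map y (LinearMap.id : M →ₗ[Λ] M) = LinearMap.id := by
  refine LinearMap.ext fun x => funext fun a => ?_
  rw [LocProd.map_apply, IsLocalizedModule.map_id]
  rfl

theorem LocProd.map_comp {P : Type u} [AddCommGroup P] [Module Λ P] (f : M →ₗ[Λ] N)
    (g : N →ₗ[Λ] P) : LocProd.map y (g ∘ₗ f) = LocProd.map y g ∘ₗ LocProd.map y f := by
  refine LinearMap.ext fun x => funext fun a => ?_
  rw [LinearMap.comp_apply, LocProd.map_apply, LocProd.map_apply, LocProd.map_apply,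
    IsLocalizedModule.map_comp' (pw y a) _ (LocalizedModule.mkLinearMap (pw y a) N)]
  rfl

theorem LocProd.map_add (f g : M →ₗ[Λ] N) :
    LocProd.map y (f + g) = LocProd.map y f + LocProd.map y g := by
  refine LinearMap.ext fun x => funext fun a => ?_
  rw [LocProd.map_apply, _root_.map_add]
  rfl

theorem LocProd.map_smul (r : Λ) (f : M →ₗ[Λ] N) :
    LocProd.map y (r • f) = r • LocProd.map y f := by
  refine LinearMap.ext fun x => funext fun a => ?_
  rw [LocProd.map_apply, _root_.map_smul]
  rfl

end

/-- `LocProd` as a functor. -/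
noncomputable def locProdFunctor : ModuleCat.{u} Λ ⥤ ModuleCat.{u} Λ where
  obj M := ModuleCat.of Λ (LocProd y M)
  map f := ModuleCat.ofHom (LocProd.map y f.hom)
  map_id _ := ModuleCat.hom_ext (LocProd.map_id y)
  map_comp f g := ModuleCat.hom_ext (LocProd.map_comp y f.hom g.hom)

instance : (locProdFunctor y).Additive where
  map_add {_ _ f g} := ModuleCat.hom_ext (LocProd.map_add y f.hom g.hom)

instance : (locProdFunctor y).Linear Λ where
  map_smul f r := ModuleCat.hom_ext (LocProd.map_smul y r f.hom)

/-- The diagonal localization map, as a natural transformation. -/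
noncomputable def diagNat : 𝟭 (ModuleCat.{u} Λ) ⟶ locProdFunctor y where
  app M := ModuleCat.ofHom (LocProd.diag y M)
  naturality M N f := by
    ext x
    exact (LocProd.map_diag y f.hom x).symm

/-- The terms of the (non-alternating) Čech complex, as functors. -/
noncomputable def cechFunctor : ℕ → (ModuleCat.{u} Λ ⥤ ModuleCat.{u} Λ)
  | 0 => 𝟭 _
  | i + 1 => cechFunctor i ⋙ locProdFunctor y

/-- The diagonal map out of a term of the Čech complex. -/
noncomputable def cechDiag (i : ℕ) : cechFunctor y i ⟶ cechFunctor y (i + 1) :=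
  Functor.whiskerLeft (cechFunctor y i) (diagNat y)

/-- Localization of a map between consecutive terms of the Čech complex. -/
noncomputable def cechShift (i : ℕ) (d : cechFunctor y i ⟶ cechFunctor y (i + 1)) :
    cechFunctor y (i + 1) ⟶ cechFunctor y (i + 2) :=
  Functor.whiskerRight d (locProdFunctor y)

/-- The differentials of the Čech complex. -/
noncomputable def cechD : ∀ i : ℕ, cechFunctor y i ⟶ cechFunctor y (i + 1)
  | 0 => cechDiag y 0
  | i + 1 => cechDiag y (i + 1) - cechShift y i (cechD i)

theorem cechShift_comp (i : ℕ) (d : cechFunctor y i ⟶ cechFunctor y (i + 1))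
    (e : cechFunctor y (i + 1) ⟶ cechFunctor y (i + 2)) (h : d ≫ e = 0) :
    cechShift y i d ≫ cechShift y (i + 1) e = 0 := by
  ext M : 2
  refine ((locProdFunctor y).map_comp (d.app M) (e.app M)).symm.trans ?_
  rw [← NatTrans.comp_app, h]
  exact (locProdFunctor y).map_zero _ _

theorem cechD_comp : ∀ i : ℕ, cechD y i ≫ cechD y (i + 1) = 0
  | 0 => by
    rw [cechD, cechD, Preadditive.comp_sub, sub_eq_zero, cechD]
    ext M : 2
    exact (diagNat y).naturality ((diagNat y).app M)
  | i + 1 => by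
    have ih := cechD_comp i
    have h1 : cechD y (i + 1) ≫ cechDiag y (i + 2) =
        cechDiag y (i + 1) ≫ cechShift y (i + 1) (cechD y (i + 1)) := by
      ext M : 2
      exact (diagNat y).naturality ((cechD y (i + 1)).app M)
    rw [cechD.eq_2 y (i + 1), Preadditive.comp_sub, h1, sub_eq_zero]
    conv_rhs => rw [cechD.eq_2 y i, Preadditive.sub_comp]
    rw [← cechD.eq_2 y i, cechShift_comp y i _ _ ih, sub_zero]

instance cechFunctor_additive : ∀ i, (cechFunctor y i).Additive
  | 0 => inferInstanceAs (𝟭 (ModuleCat.{u} Λ)).Additive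
  | i + 1 => by
    have := cechFunctor_additive i
    exact inferInstanceAs (cechFunctor y i ⋙ locProdFunctor y).Additive

instance cechFunctor_linear : ∀ i, (cechFunctor y i).Linear Λ
  | 0 => inferInstanceAs ((𝟭 (ModuleCat.{u} Λ)).Linear Λ)
  | i + 1 => by
    have := cechFunctor_linear i
    exact inferInstanceAs ((cechFunctor y i ⋙ locProdFunctor y).Linear Λ)

theorem cochainComplex_of_d (X : ℕ → ModuleCat.{u} Λ) (d : ∀ n, X n ⟶ X (n + 1))
    (sq : ∀ n, d n ≫ d (n + 1) = 0) (i : ℕ) :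
    (CochainComplex.of X d sq).d i (i + 1) = d i := CochainComplex.of_d X d i

/-- The Čech complex of a module. -/
noncomputable def cechComplex : ModuleCat.{u} Λ ⥤ CochainComplex (ModuleCat.{u} Λ) ℕ where
  obj M := CochainComplex.of (fun i => (cechFunctor y i).obj M) (fun i => (cechD y i).app M)
    (fun i => by rw [← NatTrans.comp_app, cechD_comp]; rfl)
  map f := CochainComplex.ofHom (fun i => (cechFunctor y i).map f)
    (fun i => by
      rw [cochainComplex_of_d, cochainComplex_of_d]
      exact (cechD y i).naturality f)
  map_id M := by
    ext i : 1
    exact (cechFunctor y i).map_id M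
  map_comp f g := by
    ext i : 1
    exact (cechFunctor y i).map_comp f g

theorem cechComplex_d (M : ModuleCat.{u} Λ) (i : ℕ) :
    ((cechComplex y).obj M).d i (i + 1) = (cechD y i).app M := 
  cochainComplex_of_d _ _ (fun i => by rw [← NatTrans.comp_app, cechD_comp]; rfl) i

/-- Čech cohomology. -/
noncomputable def cechH (i : ℕ) : ModuleCat.{u} Λ ⥤ ModuleCat.{u} Λ :=
  cechComplex y ⋙ HomologicalComplex.homologyFunctor _ _ i

instance : (cechComplex y).Additive where
  map_add {M N f g} := by
    ext i : 1
    exact (cechFunctor y i).map_add (f := f) (g := g)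

instance (i : ℕ) : (cechH y i).Additive :=
  inferInstanceAs (cechComplex y ⋙ HomologicalComplex.homologyFunctor _ _ i).Additive

/-- The class in Čech cohomology of a cocycle. -/
noncomputable def cechClass (M : ModuleCat.{u} Λ) (i : ℕ) :
    LinearMap.ker ((cechD y i).app M).hom →ₗ[Λ] (cechH y i).obj M :=
  cocycleClass ((cechComplex y).obj M) i ∘ₗ
    Submodule.inclusion (by rw [cechComplex_d]; exact le_rfl)

theorem cechClass_surjective (M : ModuleCat.{u} Λ) (i : ℕ) :
    Function.Surjective (cechClass y M i) := by
  intro c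
  obtain ⟨z, rfl⟩ := cocycleClass_surjective ((cechComplex y).obj M) i c
  exact ⟨⟨z.1, (LinearMap.congr_fun (congrArg ModuleCat.Hom.hom (cechComplex_d y M i))
    z.1).symm.trans z.2⟩, rfl⟩

theorem cechClass_succ_eq_zero_iff (M : ModuleCat.{u} Λ) (i : ℕ)
    (z : LinearMap.ker ((cechD y (i + 1)).app M).hom) :
    cechClass y M (i + 1) z = 0 ↔ ∃ w, ((cechD y i).app M).hom w = z := by
  refine (cocycleClass_succ_eq_zero_iff ((cechComplex y).obj M) i _).trans ?_
  rw [cechComplex_d]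
  rfl

theorem cechClass_zero_eq_zero_iff (M : ModuleCat.{u} Λ)
    (z : LinearMap.ker ((cechD y 0).app M).hom) :
    cechClass y M 0 z = 0 ↔ z = 0 := by
  refine (cocycleClass_zero_eq_zero_iff ((cechComplex y).obj M) _).trans ?_
  exact ⟨fun h => Subtype.ext (congrArg Subtype.val h),
    fun h => Subtype.ext (congrArg Subtype.val h)⟩

theorem map_mem_ker {M N : ModuleCat.{u} Λ} (f : M ⟶ N) (i : ℕ)
    (z : LinearMap.ker ((cechD y i).app M).hom) :
    ((cechFunctor y i).map f).hom z.1 ∈ LinearMap.ker ((cechD y i).app N).hom := by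
  rw [LinearMap.mem_ker, ← ModuleCat.comp_apply, (cechD y i).naturality, ModuleCat.comp_apply]
  have : ((cechD y i).app M).hom z.1 = 0 := z.2
  rw [this, map_zero]

theorem cechH_map_cechClass {M N : ModuleCat.{u} Λ} (f : M ⟶ N) (i : ℕ)
    (z : LinearMap.ker ((cechD y i).app M).hom) :
    ((cechH y i).map f).hom (cechClass y M i z) =
      cechClass y N i ⟨((cechFunctor y i).map f).hom z.1, map_mem_ker y f i z⟩ :=
  homologyMap_cocycleClass ((cechComplex y).map f) i
    (Submodule.inclusion (by rw [cechComplex_d]; exact le_rfl) z)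

end Cech

section LongExact

variable {Λ : Type u} [CommRing Λ] {ι : Type} (y : ι → Λ)

theorem LocProd.map_exact {M N P : Type u} [AddCommGroup M] [Module Λ M] [AddCommGroup N]
    [Module Λ N] [AddCommGroup P] [Module Λ P] (f : M →ₗ[Λ] N) (g : N →ₗ[Λ] P)
    (h : Function.Exact f g) : Function.Exact (LocProd.map y f) (LocProd.map y g) := by
  have key := fun a => IsLocalizedModule.map_exact (pw y a)
    (LocalizedModule.mkLinearMap (pw y a) M) (LocalizedModule.mkLinearMap (pw y a) N)
    (LocalizedModule.mkLinearMap (pw y a) P) f g h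
  intro x
  constructor
  · intro hx
    choose w hw using fun a => (key a (x a)).1 (congrFun hx a)
    exact ⟨w, funext hw⟩
  · rintro ⟨w, rfl⟩
    exact funext fun a => (key a _).2 ⟨w a, rfl⟩

theorem LocProd.map_injective {M N : Type u} [AddCommGroup M] [Module Λ M] [AddCommGroup N]
    [Module Λ N] (f : M →ₗ[Λ] N) (h : Function.Injective f) :
    Function.Injective (LocProd.map y f) := fun _ _ hx =>
  funext fun a => IsLocalizedModule.map_injective (pw y a) _ _ f h (congrFun hx a)

theorem LocProd.map_surjective {M N : Type u} [AddCommGroup M] [Module Λ M] [AddCommGroup N]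
    [Module Λ N] (f : M →ₗ[Λ] N) (h : Function.Surjective f) :
    Function.Surjective (LocProd.map y f) := by
  intro x
  choose w hw using fun a => IsLocalizedModule.map_surjective (pw y a)
    (LocalizedModule.mkLinearMap (pw y a) M) (LocalizedModule.mkLinearMap (pw y a) N) f h (x a)
  exact ⟨w, funext hw⟩

theorem cechFunctor_map_exact {M N P : ModuleCat.{u} Λ} (f : M ⟶ N) (g : N ⟶ P)
    (h : Function.Exact f.hom g.hom) : ∀ i : ℕ,
    Function.Exact ((cechFunctor y i).map f).hom ((cechFunctor y i).map g).hom
  | 0 => h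
  | i + 1 => LocProd.map_exact y _ _ (cechFunctor_map_exact f g h i)

theorem cechFunctor_map_injective {M N : ModuleCat.{u} Λ} (f : M ⟶ N)
    (h : Function.Injective f.hom) : ∀ i : ℕ, Function.Injective ((cechFunctor y i).map f).hom
  | 0 => h
  | i + 1 => LocProd.map_injective y _ (cechFunctor_map_injective f h i)

theorem cechFunctor_map_surjective {M N : ModuleCat.{u} Λ} (f : M ⟶ N)
    (h : Function.Surjective f.hom) : ∀ i : ℕ, Function.Surjective ((cechFunctor y i).map f).hom
  | 0 => h
  | i + 1 => LocProd.map_surjective y _ (cechFunctor_map_surjective f h i)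

variable {S : ShortComplex (ModuleCat.{u} Λ)} (hS : S.ShortExact)

include hS in
theorem cechComplex_shortExact : (S.map (cechComplex y)).ShortExact := by
  refine HomologicalComplex.shortExact_of_degreewise_shortExact _ fun i => ?_
  exact ModuleCat.shortComplex_shortExact _
    (cechFunctor_map_exact y S.f S.g
      ((ShortComplex.ShortExact.moduleCat_exact_iff_function_exact _).1 hS.exact) i)
    (cechFunctor_map_injective y S.f hS.moduleCat_injective_f i)
    (cechFunctor_map_surjective y S.g hS.moduleCat_surjective_g i)

/-- The connecting homomorphism in Čech cohomology. -/
noncomputable def cechδ (i : ℕ) : (cechH y i).obj S.X₃ ⟶ (cechH y (i + 1)).obj S.X₁ :=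
  (cechComplex_shortExact y hS).δ i (i + 1) rfl

theorem cechδ_eq_zero_iff (i : ℕ) (x : (cechH y i).obj S.X₃) :
    (cechδ y hS i).hom x = 0 ↔ ∃ w, ((cechH y i).map S.g).hom w = x :=
  (ShortComplex.ShortExact.moduleCat_exact_iff_function_exact _).1
    ((cechComplex_shortExact y hS).homology_exact₃ i (i + 1) rfl) x

theorem cechH_map_f_eq_zero_iff (i : ℕ) (x : (cechH y (i + 1)).obj S.X₁) :
    ((cechH y (i + 1)).map S.f).hom x = 0 ↔ ∃ w, (cechδ y hS i).hom w = x :=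
  (ShortComplex.ShortExact.moduleCat_exact_iff_function_exact _).1
    ((cechComplex_shortExact y hS).homology_exact₁ i (i + 1) rfl) x

include hS in
theorem cechH_map_g_eq_zero_iff (i : ℕ) (x : (cechH y i).obj S.X₂) :
    ((cechH y i).map S.g).hom x = 0 ↔ ∃ w, ((cechH y i).map S.f).hom w = x :=
  (ShortComplex.ShortExact.moduleCat_exact_iff_function_exact _).1
    ((cechComplex_shortExact y hS).homology_exact₂ i) x

theorem cechδ_naturality {S' : ShortComplex (ModuleCat.{u} Λ)} (hS' : S'.ShortExact)
    (φ : S ⟶ S') (i : ℕ) (x : (cechH y i).obj S.X₃) :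
    ((cechH y (i + 1)).map φ.τ₁).hom ((cechδ y hS i).hom x) =
      (cechδ y hS' i).hom (((cechH y i).map φ.τ₃).hom x) :=
  LinearMap.congr_fun (congrArg ModuleCat.Hom.hom (HomologicalComplex.HomologySequence.δ_naturality
    ((cechComplex y).mapShortComplex.map φ) (cechComplex_shortExact y hS)
    (cechComplex_shortExact y hS') i (i + 1) rfl)) x

theorem cechH_zero_map_injective {M N : ModuleCat.{u} Λ} (f : M ⟶ N)
    (h : Function.Injective f.hom) : Function.Injective ((cechH y 0).map f).hom := by
  rw [injective_iff_map_eq_zero]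
  intro x hx
  obtain ⟨z, rfl⟩ := cechClass_surjective y M 0 x
  rw [cechH_map_cechClass, cechClass_zero_eq_zero_iff] at hx
  rw [cechClass_zero_eq_zero_iff]
  refine Subtype.ext (h ?_)
  exact (congrArg Subtype.val hx).trans (map_zero f.hom).symm

theorem cechH_map_smul {M N : ModuleCat.{u} Λ} (r : Λ) (f : M ⟶ N) (i : ℕ)
    (x : (cechH y i).obj M) :
    ((cechH y i).map (r • f)).hom x = r • ((cechH y i).map f).hom x := by
  obtain ⟨z, rfl⟩ := cechClass_surjective y M i x
  rw [cechH_map_cechClass, cechH_map_cechClass, ← map_smul]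
  congr 1
  apply Subtype.ext
  change ((cechFunctor y i).map (r • f)).hom z.1 = r • ((cechFunctor y i).map f).hom z.1
  rw [Functor.map_smul]
  rfl

end LongExact

section Torsion

variable {Λ : Type u} [CommRing Λ] {ι : Type} (y : ι → Λ)

theorem exists_pow_smul_eq_zero (M : ModuleCat.{u} Λ) (i : ℕ) (x : (cechH y i).obj M) (a : ι) :
    ∃ N : ℕ, y a ^ N • x = 0 := by
  obtain ⟨z, rfl⟩ := cechClass_surjective y M i x
  obtain ⟨z, hz⟩ := z
  cases i with
  | zero =>
    change M at z
    have h : (LocalizedModule.mk z 1 : LocalizedModule (pw y a) M) = 0 := congrFun hz a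
    rw [← LocalizedModule.zero_mk 1, LocalizedModule.mk_eq] at h
    obtain ⟨⟨_, N, rfl⟩, h⟩ := h
    refine ⟨N, ?_⟩
    rw [← map_smul, cechClass_zero_eq_zero_iff]
    apply Subtype.ext
    rw [one_smul, smul_zero, smul_zero] at h
    exact h
  | succ i =>
    have h : LocalizedModule.mk z 1 - IsLocalizedModule.map (pw y a)
        (LocalizedModule.mkLinearMap (pw y a) ((cechFunctor y i).obj M))
        (LocalizedModule.mkLinearMap (pw y a) ((cechFunctor y (i + 1)).obj M))
        ((cechD y i).app M).hom ((z : LocProd y ((cechFunctor y i).obj M)) a) = 0 :=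
      congrFun hz a
    rw [sub_eq_zero] at h
    obtain ⟨u, ⟨_, n, rfl⟩, hu⟩ : ∃ u s, (z : LocProd y ((cechFunctor y i).obj M)) a =
        LocalizedModule.mk u s := by
      induction (z : LocProd y ((cechFunctor y i).obj M)) a using LocalizedModule.induction_on with
      | h m s => exact ⟨m, s, rfl⟩
    rw [hu, map_mk, LocalizedModule.mk_eq] at h
    obtain ⟨⟨_, k, rfl⟩, h⟩ := h
    refine ⟨k + n, ?_⟩
    rw [← map_smul, cechClass_succ_eq_zero_iff]
    refine ⟨y a ^ k • u, ?_⟩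
    rw [map_smul]
    have h' : y a ^ k • y a ^ n • z = y a ^ k • ((cechD y i).app M).hom u := by
      rw [one_smul] at h
      exact h
    rw [← h', smul_smul, ← pow_add]
    rfl

theorem exists_pow_smul_eq_zero_of_mem_radical {r : Λ}
    (hr : r ∈ (Ideal.span (Set.range y)).radical) (M : ModuleCat.{u} Λ) (i : ℕ)
    (x : (cechH y i).obj M) : ∃ N : ℕ, r ^ N • x = 0 := by
  have h : Ideal.span (Set.range y) ≤ (Ideal.torsionOf Λ _ x).radical := by
    rw [Ideal.span_le]
    rintro _ ⟨a, rfl⟩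
    obtain ⟨N, hN⟩ := exists_pow_smul_eq_zero y M i x a
    exact ⟨N, hN⟩
  have := Ideal.radical_mono h hr
  rw [Ideal.radical_idem] at this
  obtain ⟨N, hN⟩ := this
  exact ⟨N, hN⟩

theorem eq_zero_of_forall_smul {r : Λ}
    (hr : r ∈ (Ideal.span (Set.range y)).radical) (M : ModuleCat.{u} Λ) (i : ℕ)
    (hinj : ∀ x : (cechH y i).obj M, r • x = 0 → x = 0)
    (x : (cechH y i).obj M) : x = 0 := by
  obtain ⟨N, hN⟩ := exists_pow_smul_eq_zero_of_mem_radical y hr M i x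
  induction N with
  | zero => simpa using hN
  | succ N ih => exact ih (hinj _ (by rwa [smul_smul, ← pow_succ']))

theorem cechFunctor_subsingleton (M : ModuleCat.{u} Λ)
    (h : ∀ a, ∀ x : M, ∃ N : ℕ, y a ^ N • x = 0) :
    ∀ i : ℕ, Subsingleton ((cechFunctor y (i + 1)).obj M)
  | 0 => by
    refine subsingleton_of_forall_eq 0 fun x => funext fun a => ?_
    change (x : LocProd y M) a = 0
    induction (x : LocProd y M) a using LocalizedModule.induction_on with
    | h m s =>
      obtain ⟨N, hN⟩ := h a m
      rw [← LocalizedModule.zero_mk 1, LocalizedModule.mk_eq]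
      refine ⟨⟨_, N, rfl⟩, ?_⟩
      rw [one_smul, smul_zero, smul_zero]
      exact hN
  | i + 1 => by
    have ih := cechFunctor_subsingleton M h i
    refine subsingleton_of_forall_eq 0 fun x => funext fun a => ?_
    change (x : LocProd y ((cechFunctor y (i + 1)).obj M)) a = 0
    induction (x : LocProd y ((cechFunctor y (i + 1)).obj M)) a using
      LocalizedModule.induction_on with
    | h m s => rw [Subsingleton.elim m 0, LocalizedModule.zero_mk]

theorem cechH_succ_eq_zero (M : ModuleCat.{u} Λ)
    (h : ∀ a, ∀ x : M, ∃ N : ℕ, y a ^ N • x = 0) (i : ℕ) (x : (cechH y (i + 1)).obj M) :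
    x = 0 := by
  have := cechFunctor_subsingleton y M h i
  obtain ⟨z, rfl⟩ := cechClass_surjective y M (i + 1) x
  have : z = 0 := Subtype.ext (Subsingleton.elim _ _)
  rw [this, map_zero]

end Torsion

section Vanishing

variable {Λ : Type u} [CommRing Λ] {ι : Type} (y : ι → Λ)

theorem cechH_map_smul_id (M : ModuleCat.{u} Λ) (r : Λ) (i : ℕ) (x : (cechH y i).obj M) :
    ((cechH y i).map (r • 𝟙 M)).hom x = r • x := by
  rw [cechH_map_smul, CategoryTheory.Functor.map_id]
  rfl

theorem exists_connecting_quotSMulTop {M : ModuleCat.{u} Λ} {r : Λ} (hr : IsSMulRegular M r)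
    (i : ℕ) :
    ∃ δ : (cechH y i).obj (ModuleCat.of Λ (QuotSMulTop r M)) →ₗ[Λ] (cechH y (i + 1)).obj M,
      (∀ x, δ x = 0 → ∃ w : (cechH y i).obj M,
        ((cechH y i).map (ModuleCat.ofHom (Submodule.mkQ _) :
          M ⟶ ModuleCat.of Λ (QuotSMulTop r M))).hom w = x) ∧
      ∀ x, r • x = 0 → ∃ w, δ w = x := by
  refine ⟨(cechδ y hr.smulShortComplex_shortExact i).hom, fun x hx => ?_, fun x hx => ?_⟩
  · exact (cechδ_eq_zero_iff y hr.smulShortComplex_shortExact i x).1 hx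
  · rw [← cechH_map_smul_id] at hx
    exact (cechH_map_f_eq_zero_iff y hr.smulShortComplex_shortExact i x).1 hx

theorem cechH_smul_injective {M : ModuleCat.{u} Λ} {r : Λ} (hr : IsSMulRegular M r) (i : ℕ)
    (h : ∀ j, j + 1 = i → ∀ x : (cechH y j).obj (ModuleCat.of Λ (QuotSMulTop r M)), x = 0)
    (x : (cechH y i).obj M) (hx : r • x = 0) : x = 0 := by
  cases i with
  | zero =>
    have := cechH_zero_map_injective y (r • 𝟙 M) hr
    refine this ?_
    rw [map_zero, cechH_map_smul_id]
    exact hx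
  | succ i =>
    obtain ⟨δ, -, hδ⟩ := exists_connecting_quotSMulTop y hr i
    obtain ⟨w, rfl⟩ := hδ x hx
    rw [h i rfl w, map_zero]

theorem cechH_eq_zero_of_isWeaklyRegular (rs : List Λ)
    (hrs : ∀ r ∈ rs, r ∈ (Ideal.span (Set.range y)).radical) :
    ∀ (M : ModuleCat.{u} Λ), RingTheory.Sequence.IsWeaklyRegular M rs →
    ∀ i, i < rs.length → ∀ x : (cechH y i).obj M, x = 0 := by
  induction rs with
  | nil => intro M _ i hi; simp at hi
  | cons r rs ih =>
    intro M hM i hi x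
    rw [RingTheory.Sequence.isWeaklyRegular_cons_iff] at hM
    refine eq_zero_of_forall_smul y (hrs r (by simp)) M i
      (cechH_smul_injective y hM.1 i fun j hj => ?_) x
    refine ih (fun s hs => hrs s (by simp [hs])) (ModuleCat.of Λ (QuotSMulTop r M)) hM.2 j ?_
    simp only [List.length_cons] at hi
    lia

theorem cechH_eq_zero_of_length_lt (zs : List Λ)
    (hzs : ∀ r ∈ zs, r ∈ (Ideal.span (Set.range y)).radical) :
    ∀ (M : ModuleCat.{u} Λ), (∀ a, y a ∈ (Module.annihilator Λ M ⊔ Ideal.ofList zs).radical) →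
    ∀ i, zs.length < i → ∀ x : (cechH y i).obj M, x = 0 := by
  induction zs with
  | nil =>
    intro M hM i hi x
    obtain ⟨i, rfl⟩ : ∃ j, i = j + 1 := ⟨i - 1, by simp at hi; lia⟩
    refine cechH_succ_eq_zero y M (fun a m => ?_) i x
    obtain ⟨N, hN⟩ := hM a
    rw [Ideal.ofList_nil, sup_bot_eq, Module.mem_annihilator] at hN
    exact ⟨N, hN m⟩
  | cons z zs ih =>
    intro M hM i hi x
    obtain ⟨i, rfl⟩ : ∃ j, i = j + 1 := ⟨i - 1, by simp at hi; lia⟩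
    have hi' : zs.length < i := by simpa using hi
    have hzs' : ∀ r ∈ zs, r ∈ (Ideal.span (Set.range y)).radical :=
      fun s hs => hzs s (by simp [hs])
    let φ : M →ₗ[Λ] M := LinearMap.lsmul Λ M z
    have hφ (m : M) : φ m = z • m := rfl
    let S₁ : ShortComplex (ModuleCat.{u} Λ) := ShortComplex.mk
      (ModuleCat.ofHom (LinearMap.ker φ).subtype) (ModuleCat.ofHom φ.rangeRestrict)
      (ModuleCat.hom_ext (LinearMap.ext fun m => Subtype.ext m.2))
    have hS₁ : S₁.ShortExact := ModuleCat.shortComplex_shortExact _ (by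
        intro m
        constructor
        · intro hm
          exact ⟨⟨m, congrArg Subtype.val hm⟩, rfl⟩
        · rintro ⟨m, rfl⟩
          exact Subtype.ext m.2)
      (Submodule.subtype_injective _) φ.surjective_rangeRestrict
    let S₂ : ShortComplex (ModuleCat.{u} Λ) := ShortComplex.mk
      (ModuleCat.ofHom (LinearMap.range φ).subtype) (ModuleCat.ofHom (LinearMap.range φ).mkQ)
      (ModuleCat.hom_ext (LinearMap.ext fun m => (Submodule.Quotient.mk_eq_zero _).2 m.2))
    have hS₂ : S₂.ShortExact := ModuleCat.shortComplex_shortExact _ (by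
        intro m
        constructor
        · intro hm
          exact ⟨⟨m, (Submodule.Quotient.mk_eq_zero _).1 hm⟩, rfl⟩
        · rintro ⟨m, rfl⟩
          exact (Submodule.Quotient.mk_eq_zero _).2 m.2)
      (Submodule.subtype_injective _) (Submodule.mkQ_surjective _)
    have hle (N : Type u) [AddCommGroup N] [Module Λ N]
        (h1 : Module.annihilator Λ M ≤ Module.annihilator Λ N)
        (h2 : z ∈ Module.annihilator Λ N) (a : ι) :
        y a ∈ (Module.annihilator Λ N ⊔ Ideal.ofList zs).radical := by
      refine Ideal.radical_mono ?_ (hM a)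
      rw [Ideal.ofList_cons]
      refine sup_le (h1.trans le_sup_left) (sup_le ?_ le_sup_right)
      rw [Ideal.span_singleton_le_iff_mem]
      exact Ideal.mem_sup_left h2
    have hker : ∀ x : (cechH y (i + 1)).obj S₁.X₁, x = 0 := by
      refine ih hzs' (ModuleCat.of Λ (LinearMap.ker φ)) (hle _ ?_ ?_) (i + 1) (by lia)
      · exact LinearMap.annihilator_le_of_injective _ (Submodule.subtype_injective _)
      · rw [Module.mem_annihilator]
        exact fun m => Subtype.ext m.2
    have hcoker : ∀ x : (cechH y i).obj S₂.X₃, x = 0 := by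
      refine ih hzs' (ModuleCat.of Λ (M ⧸ LinearMap.range φ)) (hle _ ?_ ?_) i hi'
      · exact LinearMap.annihilator_le_of_surjective _ (Submodule.mkQ_surjective _)
      · rw [Module.mem_annihilator]
        intro m
        obtain ⟨m, rfl⟩ := Submodule.mkQ_surjective _ m
        rw [← map_smul]
        exact (Submodule.Quotient.mk_eq_zero _).2 ⟨m, rfl⟩
    refine eq_zero_of_forall_smul y (hzs z (by simp)) M (i + 1) (fun x hx => ?_) x
    have hcomp : z • 𝟙 M = S₁.g ≫ S₂.f := rfl
    rw [← cechH_map_smul_id, hcomp, Functor.map_comp, ModuleCat.comp_apply] at hx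
    obtain ⟨w, hw⟩ := (cechH_map_f_eq_zero_iff y hS₂ i _).1 hx
    rw [hcoker w, map_zero] at hw
    obtain ⟨v, hv⟩ := (cechH_map_g_eq_zero_iff y hS₁ (i + 1) x).1 hw.symm
    rw [← hv, hker v, map_zero]

end Vanishing

/-- A module all of whose submodules are finitely generated up to multiplication by elements of a
multiplicative set. -/
def LocNoeth {A : Type u} [CommRing A] (S : Submonoid A) (X : Type u) [AddCommGroup X]
    [Module A X] : Prop :=
  ∀ W : Submodule A X, ∃ W' ≤ W, W'.FG ∧ ∀ w ∈ W, ∃ c ∈ S, c • w ∈ W'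

namespace LocNoeth

variable {A : Type u} [CommRing A] {S : Submonoid A} {X Y Z : Type u} [AddCommGroup X]
  [Module A X] [AddCommGroup Y] [Module A Y] [AddCommGroup Z] [Module A Z]

theorem of_surjective (f : X →ₗ[A] Y) (hf : Function.Surjective f) (h : LocNoeth S X) :
    LocNoeth S Y := by
  intro W
  obtain ⟨W', hle, hfg, hc⟩ := h (W.comap f)
  refine ⟨W'.map f, Submodule.map_le_iff_le_comap.2 hle, hfg.map f, fun w hw => ?_⟩
  obtain ⟨x, rfl⟩ := hf w
  obtain ⟨c, hcS, hcx⟩ := hc x hw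
  exact ⟨c, hcS, c • x, hcx, map_smul f c x⟩

theorem of_injective (f : X →ₗ[A] Y) (hf : Function.Injective f) (h : LocNoeth S Y) :
    LocNoeth S X := by
  intro W
  obtain ⟨W', hle, hfg, hc⟩ := h (W.map f)
  have hW' : (W'.comap f).map f = W' := by
    rw [Submodule.map_comap_eq, inf_eq_right]
    exact hle.trans (LinearMap.map_le_range)
  refine ⟨W'.comap f, fun x hx => ?_, Submodule.fg_of_fg_map_injective f hf (hW'.symm ▸ hfg),
    fun w hw => ?_⟩
  · obtain ⟨w, hw, hwx⟩ := hle hx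
    rwa [← hf hwx]
  · obtain ⟨c, hcS, hcx⟩ := hc (f w) ⟨w, hw, rfl⟩
    exact ⟨c, hcS, by rwa [Submodule.mem_comap, map_smul]⟩

theorem of_ker (f : X →ₗ[A] Y) (h₁ : LocNoeth S (LinearMap.ker f)) (h₂ : LocNoeth S Y) :
    LocNoeth S X := by
  intro W
  obtain ⟨U, hU, hUfg, hUc⟩ := h₁ (W.comap (LinearMap.ker f).subtype)
  obtain ⟨V, hV, hVfg, hVc⟩ := h₂ (W.map f)
  obtain ⟨V', hV', hV'fg, hVV'⟩ : ∃ V' ≤ W, V'.FG ∧ V'.map f = V := by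
    obtain ⟨s, rfl⟩ := hVfg
    have hs : ∀ v : s, ∃ w ∈ W, f w = v := fun v => hV (Submodule.subset_span v.2)
    choose g hgW hg using hs
    refine ⟨Submodule.span A (Set.range g), Submodule.span_le.2 ?_,
      Submodule.fg_span (Set.finite_range g), ?_⟩
    · rintro _ ⟨v, rfl⟩
      exact hgW v
    · rw [Submodule.map_span, ← Set.range_comp]
      congr 1
      ext v
      constructor
      · rintro ⟨v, rfl⟩
        rw [Function.comp_apply, hg]
        exact v.2
      · intro hv
        exact ⟨⟨v, hv⟩, hg _⟩
  refine ⟨V' ⊔ U.map (LinearMap.ker f).subtype, sup_le hV' (Submodule.map_le_iff_le_comap.2 hU),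
    hV'fg.sup (hUfg.map _), fun w hw => ?_⟩
  obtain ⟨c, hcS, hc⟩ := hVc (f w) ⟨w, hw, rfl⟩
  rw [← hVV'] at hc
  obtain ⟨v, hv, hvw⟩ := hc
  have hk : c • w - v ∈ LinearMap.ker f := by
    rw [LinearMap.mem_ker, map_sub, map_smul, hvw, sub_self]
  obtain ⟨c', hc'S, hc'⟩ := hUc ⟨_, hk⟩ (by
    exact W.sub_mem (W.smul_mem c hw) (hV' hv))
  refine ⟨c' * c, S.mul_mem hc'S hcS, ?_⟩
  have : (c' * c) • w = c' • v + c' • (c • w - v) := by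
    rw [mul_smul, ← smul_add, add_sub_cancel]
  rw [this]
  exact Submodule.add_mem_sup (V'.smul_mem _ hv) ⟨_, hc', rfl⟩

theorem of_subsingleton [Subsingleton X] : LocNoeth S X := fun W =>
  ⟨⊥, bot_le, Submodule.fg_bot, fun w _ => ⟨1, S.one_mem, by
    rw [Subsingleton.elim w 0, smul_zero]; exact zero_mem _⟩⟩

theorem pi (h : LocNoeth S X) (n : ℕ) : LocNoeth S (Fin n → X) := by
  induction n with
  | zero => exact of_subsingleton
  | succ n ih =>
    let f : (Fin (n + 1) → X) →ₗ[A] (Fin n → X) := LinearMap.funLeft A X Fin.succ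
    refine of_ker f (of_injective ((LinearMap.proj 0 : (Fin (n + 1) → X) →ₗ[A] X) ∘ₗ
      (LinearMap.ker f).subtype) ?_ h) ih
    rw [injective_iff_map_eq_zero]
    rintro ⟨x, hx⟩ h0
    ext i
    refine Fin.cases h0 (fun j => congrFun hx j) i

theorem localizedModule [IsNoetherianRing A] : LocNoeth S (LocalizedModule S A) := by
  intro W
  refine ⟨(W.comap (LocalizedModule.mkLinearMap S A)).map (LocalizedModule.mkLinearMap S A),
    Submodule.map_le_iff_le_comap.2 le_rfl, (IsNoetherian.noetherian _).map _, fun w hw => ?_⟩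
  induction w using LocalizedModule.induction_on with
  | h m s =>
    have : (s : A) • LocalizedModule.mk m s = LocalizedModule.mkLinearMap S A m := by
      rw [LocalizedModule.smul'_mk]
      exact LocalizedModule.mk_cancel s m
    refine ⟨s, s.2, ?_⟩
    rw [this]
    refine ⟨m, ?_, rfl⟩
    rw [SetLike.mem_coe, Submodule.mem_comap, ← this]
    exact W.smul_mem _ hw

theorem of_pow_smul_eq_zero [IsNoetherianRing A] (J : Ideal A)
    (h : ∀ W : Submodule A X, (∀ x ∈ W, ∀ r ∈ J, r • x = 0) → LocNoeth S W) (t : ℕ) :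
    ∀ W : Submodule A X, (∀ x ∈ W, ∀ r ∈ J ^ t, r • x = 0) → LocNoeth S W := by
  induction t with
  | zero =>
    intro W hW
    have : Subsingleton W := ⟨fun a b => by
      have h0 (a : W) : a = 0 := by
        have := hW a a.2 1 (by simp)
        rw [one_smul] at this
        exact Subtype.ext this
      rw [h0 a, h0 b]⟩
    exact of_subsingleton
  | succ t ih =>
    intro W hW
    obtain ⟨n, q, hq⟩ := Submodule.fg_iff_exists_fin_generating_family.1
      (IsNoetherian.noetherian J)
    let V : Submodule A X := 
      { carrier := {x | ∀ r ∈ J ^ t, r • x = 0}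
        add_mem' := fun {a b} ha hb r hr => by rw [smul_add, ha r hr, hb r hr, add_zero]
        zero_mem' := fun r _ => smul_zero r
        smul_mem' := fun c x hx r hr => by rw [smul_comm, hx r hr, smul_zero] }
    have hqJ (i : Fin n) : q i ∈ J := by rw [← hq]; exact Submodule.subset_span ⟨i, rfl⟩
    let f : W →ₗ[A] (Fin n → V) := LinearMap.pi fun i =>
      LinearMap.codRestrict V (q i • W.subtype) (fun x r hr => by
        rw [LinearMap.smul_apply, ← mul_smul]
        exact hW x x.2 _ (by rw [pow_succ]; exact Ideal.mul_mem_mul hr (hqJ i)))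
    refine of_ker f ?_ (pi (ih V fun x hx => hx) n)
    refine of_injective ((W.subtype ∘ₗ (LinearMap.ker f).subtype).rangeRestrict) ?_
      (h (LinearMap.range (W.subtype ∘ₗ (LinearMap.ker f).subtype)) ?_)
    · rw [LinearMap.injective_rangeRestrict_iff]
      exact (Submodule.subtype_injective _).comp (Submodule.subtype_injective _)
    · rintro _ ⟨⟨x, hx⟩, rfl⟩ r hr
      rw [← hq] at hr
      have hx' (i : Fin n) : q i • (x : X) = 0 := congrArg Subtype.val (congrFun hx i)
      change r • (x : X) = 0
      induction hr using Submodule.span_induction with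
      | mem r hr =>
        obtain ⟨i, rfl⟩ := hr
        exact hx' i
      | zero => exact zero_smul _ _
      | add a b _ _ ha hb => rw [add_smul, ha, hb, add_zero]
      | smul c a _ ha => rw [smul_assoc, ha, smul_zero]

end LocNoeth

section Top

variable {Λ : Type u} [CommRing Λ] {ι : Type} (y : ι → Λ)

theorem locNoeth_of_isWeaklyRegular (S : Submonoid Λ) (rs : List Λ)
    (hrs : ∀ r ∈ rs, r ∈ (Ideal.span (Set.range y)).radical) :
    ∀ (M : ModuleCat.{u} Λ), LocNoeth S M → RingTheory.Sequence.IsWeaklyRegular M rs →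
    ∀ W : Submodule Λ ((cechH y rs.length).obj M), (∀ x ∈ W, ∀ r ∈ rs, r • x = 0) →
    LocNoeth S W := by
  induction rs with
  | nil =>
    intro M hM _ W _
    have h1 : LocNoeth S (LinearMap.ker ((cechD y 0).app M).hom) :=
      LocNoeth.of_injective (Y := M) (Submodule.subtype _) (Submodule.subtype_injective _) hM
    have h2 : LocNoeth S ((cechH y 0).obj M) :=
      LocNoeth.of_surjective (cechClass y M 0) (cechClass_surjective y M 0) h1
    exact LocNoeth.of_injective W.subtype (Submodule.subtype_injective _) h2
  | cons r rs ih =>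
    intro M hMS hM W hW
    have hM' := hM
    rw [RingTheory.Sequence.isWeaklyRegular_cons_iff] at hM
    obtain ⟨δ, hδ, hδ'⟩ := exists_connecting_quotSMulTop y hM.1 rs.length
    replace hδ : Function.Injective δ := by
      rw [injective_iff_map_eq_zero]
      intro x hx
      obtain ⟨w, rfl⟩ := hδ x hx
      rw [cechH_eq_zero_of_isWeaklyRegular y (r :: rs) hrs M hM' rs.length (by simp) w, map_zero]
    have hfg := ih (fun s hs => hrs s (by simp [hs])) (ModuleCat.of Λ (QuotSMulTop r M))
      (LocNoeth.of_surjective (Submodule.mkQ _) (Submodule.mkQ_surjective _) hMS) hM.2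
      (W.comap δ) (by
        intro x hx s hs
        apply hδ
        rw [map_smul, map_zero]
        exact hW _ hx s (by simp [hs]))
    refine LocNoeth.of_surjective (δ.restrict (p := W.comap δ) (q := W) fun x hx => hx) ?_ hfg
    rintro ⟨x, hx⟩
    obtain ⟨w, rfl⟩ := hδ' x (hW x hx r (by simp))
    exact ⟨⟨w, hx⟩, rfl⟩

theorem exists_cechH_ne_zero (rs : List Λ)
    (hrs : ∀ r ∈ rs, r ∈ (Ideal.span (Set.range y)).radical) :
    ∀ (M : ModuleCat.{u} Λ), RingTheory.Sequence.IsRegular M rs →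
    (∀ a, y a ∈ (Module.annihilator Λ M ⊔ Ideal.ofList rs).radical) →
    ∃ x : (cechH y rs.length).obj M, x ≠ 0 := by
  induction rs with
  | nil =>
    intro M hM hy
    have : Nontrivial M := hM.nontrivial
    obtain ⟨m, hm⟩ := exists_ne (0 : M)
    have hd : ((cechD y 0).app M).hom m = 0 := by
      refine funext fun a => ?_
      obtain ⟨N, hN⟩ := hy a
      rw [Ideal.ofList_nil, sup_bot_eq, Module.mem_annihilator] at hN
      change LocalizedModule.mk m 1 = 0
      rw [← LocalizedModule.zero_mk 1, LocalizedModule.mk_eq]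
      refine ⟨⟨y a ^ N, N, rfl⟩, ?_⟩
      simp only [one_smul, smul_zero]
      exact hN m
    refine ⟨cechClass y M 0 ⟨m, hd⟩, fun h0 => hm ?_⟩
    exact congrArg Subtype.val ((cechClass_zero_eq_zero_iff y M _).1 h0)
  | cons r rs ih =>
    intro M hM hy
    rw [RingTheory.Sequence.isRegular_cons_iff] at hM
    obtain ⟨x, hx⟩ := ih (fun s hs => hrs s (by simp [hs])) (ModuleCat.of Λ (QuotSMulTop r M)) hM.2
      (fun a => by
        refine Ideal.radical_mono ?_ (hy a)
        rw [Ideal.ofList_cons]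
        refine sup_le (le_sup_of_le_left ?_) (sup_le ?_ le_sup_right)
        · exact LinearMap.annihilator_le_of_surjective _ (Submodule.mkQ_surjective _)
        · rw [Ideal.span_singleton_le_iff_mem]
          refine Ideal.mem_sup_left ?_
          rw [Module.mem_annihilator]
          intro m
          obtain ⟨m, rfl⟩ := Submodule.mkQ_surjective _ m
          rw [← map_smul]
          exact (Submodule.Quotient.mk_eq_zero _).2
            (Submodule.smul_mem_pointwise_smul m r ⊤ trivial))
    have hM' : RingTheory.Sequence.IsWeaklyRegular M (r :: rs) := by
      rw [RingTheory.Sequence.isWeaklyRegular_cons_iff]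
      exact ⟨hM.1, hM.2.toIsWeaklyRegular⟩
    obtain ⟨δ, hδ, -⟩ := exists_connecting_quotSMulTop y hM.1 rs.length
    refine ⟨δ x, fun h0 => hx ?_⟩
    obtain ⟨w, rfl⟩ := hδ x h0
    rw [cechH_eq_zero_of_isWeaklyRegular y (r :: rs) hrs M hM' rs.length (by simp) w, map_zero]

end Top

open Abelian

section Ext

variable {A : Type u} [CommRing A]

/-- The short complex attached to an exact pair of linear maps. -/
noncomputable abbrev shortCx {X Y Z : Type u} [AddCommGroup X] [Module A X] [AddCommGroup Y]
    [Module A Y] [AddCommGroup Z] [Module A Z] (f : X →ₗ[A] Y) (g : Y →ₗ[A] Z)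
    (h : Function.Exact f g) : ShortComplex (ModuleCat.{u} A) :=
  ShortComplex.mk (ModuleCat.ofHom f) (ModuleCat.ofHom g)
    (ModuleCat.hom_ext (LinearMap.ext fun x => (h (f x)).2 ⟨x, rfl⟩))

theorem shortCx_shortExact {X Y Z : Type u} [AddCommGroup X] [Module A X] [AddCommGroup Y]
    [Module A Y] [AddCommGroup Z] [Module A Z] (f : X →ₗ[A] Y) (g : Y →ₗ[A] Z)
    (h : Function.Exact f g) (hf : Function.Injective f) (hg : Function.Surjective g) :
    (shortCx f g h).ShortExact :=
  ModuleCat.shortComplex_shortExact _ h hf hg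

/-- Vanishing of an `Ext` module. -/
abbrev ExtVan (N X : ModuleCat.{u} A) (i : ℕ) : Prop := ∀ e : Ext N X i, e = 0

theorem ExtVan.of_iso {N N' X : ModuleCat.{u} A} {i : ℕ} (φ : N ≅ N') (h : ExtVan N X i) :
    ExtVan N' X i := by
  intro e
  have h0 := h ((Ext.mk₀ φ.hom).comp e (zero_add i))
  have := congrArg (fun t => (Ext.mk₀ φ.inv).comp t (zero_add i)) h0
  simpa using this

section Sequence

variable {S : ShortComplex (ModuleCat.{u} A)} (hS : S.ShortExact) {X : ModuleCat.{u} A} {i : ℕ}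
include hS

theorem ExtVan.middle (h₁ : ExtVan S.X₁ X i) (h₃ : ExtVan S.X₃ X i) : ExtVan S.X₂ X i := by
  intro e
  obtain ⟨x, rfl⟩ := Ext.contravariant_sequence_exact₂ hS X e (h₁ _)
  rw [h₃ x, Ext.comp_zero]

theorem ExtVan.left (h₂ : ExtVan S.X₂ X i) (h₃ : ExtVan S.X₃ X (i + 1)) : ExtVan S.X₁ X i := by
  intro e
  obtain ⟨x, rfl⟩ := Ext.contravariant_sequence_exact₁ hS X e (add_comm 1 i) (h₃ _)
  rw [h₂ x, Ext.comp_zero]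

theorem ExtVan.right (h₁ : ExtVan S.X₁ X i) (h₂ : ExtVan S.X₂ X (i + 1)) :
    ExtVan S.X₃ X (i + 1) := by
  intro e
  obtain ⟨x, rfl⟩ := Ext.contravariant_sequence_exact₃ hS X e (h₂ _) (add_comm 1 i)
  rw [h₁ x, Ext.comp_zero]

theorem ExtVan.covLeft (h₂ : ExtVan X S.X₂ (i + 1)) (h₃ : ExtVan X S.X₃ i) :
    ExtVan X S.X₁ (i + 1) := by
  intro e
  obtain ⟨x, rfl⟩ := Ext.covariant_sequence_exact₁ X hS e (h₂ _) rfl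
  rw [h₃ x, Ext.zero_comp]

theorem ExtVan.covRight (h₂ : ExtVan X S.X₂ i) (h₁ : ExtVan X S.X₁ (i + 1)) :
    ExtVan X S.X₃ i := by
  intro e
  obtain ⟨x, rfl⟩ := Ext.covariant_sequence_exact₃ X hS e rfl (h₁ _)
  rw [h₂ x, Ext.zero_comp]

end Sequence

theorem mkQ_exact {M : Type u} [AddCommGroup M] [Module A M] (N : Submodule A M) :
    Function.Exact N.subtype N.mkQ := by
  intro x
  rw [Submodule.mkQ_apply, Submodule.Quotient.mk_eq_zero]
  exact ⟨fun h => ⟨⟨x, h⟩, rfl⟩, fun ⟨y, hy⟩ => hy ▸ y.2⟩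

theorem exists_extend {X : ModuleCat.{u} A} (I : Ideal A)
    (h : ExtVan (ModuleCat.of A (A ⧸ I)) X 1) (g : I →ₗ[A] X) :
    ∃ g' : A →ₗ[A] X, ∀ (x : A) (hx : x ∈ I), g' x = g ⟨x, hx⟩ := by
  have hS := shortCx_shortExact I.subtype I.mkQ (mkQ_exact I) (Submodule.subtype_injective _)
    (Submodule.mkQ_surjective _)
  let g₀ : (ModuleCat.of A I) ⟶ X := ModuleCat.ofHom g
  obtain ⟨x, hx⟩ := Ext.contravariant_sequence_exact₁ hS X (Ext.mk₀ g₀) (add_comm 1 0) (h _)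
  obtain ⟨φ, rfl⟩ := (Ext.mk₀_bijective _ _).2 x
  rw [Ext.mk₀_comp_mk₀] at hx
  have h2 := (Ext.mk₀_bijective _ _).1 hx
  refine ⟨φ.hom, fun x hx => ?_⟩
  exact LinearMap.congr_fun (congrArg ModuleCat.Hom.hom h2) ⟨x, hx⟩

theorem hasInjectiveDimensionLT_of_finite (n : ℕ) : ∀ (X : ModuleCat.{u} A),
    (∀ (I : Ideal A) (i : ℕ), n < i → ExtVan (ModuleCat.of A (A ⧸ I)) X i) →
    HasInjectiveDimensionLT X (n + 1) := by
  induction n with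
  | zero =>
    intro X h
    have : Module.Baer A X := fun I g => exists_extend I (h I 1 one_pos) g
    have := this.injective
    rw [Module.injective_iff_injective_object] at this
    infer_instance
  | succ n ih =>
    intro X h
    obtain ⟨J, inj, f, monof⟩ := (inferInstance : EnoughInjectives (ModuleCat.{u} A)).1 X
    let T := ShortComplex.mk f (Limits.cokernel.π f) (Limits.cokernel.condition f)
    have hT : T.ShortExact := { exact := ShortComplex.exact_cokernel f }
    refine (hT.hasInjectiveDimensionLT_X₃_iff n inj).1 (ih _ fun I i hi => ?_)
    refine ExtVan.covRight hT (fun e => ?_) (h I (i + 1) (by lia))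
    exact e.eq_zero_of_hasInjectiveDimensionLT 1 (by lia)

end Ext

theorem subsingleton_of_smul_surjective {Λ : Type u} [CommRing Λ] [IsLocalRing Λ] {M : Type u}
    [AddCommGroup M] [Module Λ M] [Module.Finite Λ M] (a : Λ) (ha : a ∈ maximalIdeal Λ)
    (h : ∀ m : M, ∃ m', a • m' = m) (m : M) : m = 0 := by
  have : (⊤ : Submodule Λ M) = ⊥ := by
    refine Submodule.eq_bot_of_le_smul_of_le_jacobson_bot (maximalIdeal Λ) ⊤
      Module.Finite.fg_top ?_ (IsLocalRing.maximalIdeal_le_jacobson _)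
    intro m _
    obtain ⟨m', rfl⟩ := h m
    exact Submodule.smul_mem_smul ha trivial
  have hm : m ∈ (⊤ : Submodule Λ M) := trivial
  rw [this] at hm
  exact hm

section Local

variable {Λ : Type u} [CommRing Λ] [IsNoetherianRing Λ] [IsLocalRing Λ]

theorem extVan_quotient_prime {X : ModuleCat.{u} Λ} [Module.Finite Λ X] (i : ℕ)
    (h : ∀ (N : ModuleCat.{u} Λ) [Module.Finite Λ N], ExtVan N X (i + 1)) (Q : Ideal Λ) [Q.IsPrime]
    (hQ : Q ≠ maximalIdeal Λ) : ExtVan (ModuleCat.of Λ (Λ ⧸ Q)) X i := by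
  obtain ⟨a, ha, haQ⟩ : ∃ a ∈ maximalIdeal Λ, a ∉ Q := by
    by_contra! hc
    exact hQ (le_antisymm (IsLocalRing.le_maximalIdeal (Ideal.IsPrime.ne_top inferInstance)) hc)
  let f : (Λ ⧸ Q) →ₗ[Λ] (Λ ⧸ Q) := LinearMap.lsmul Λ _ a
  have hf : Function.Injective f := by
    rw [injective_iff_map_eq_zero]
    intro x hx
    obtain ⟨x, rfl⟩ := Ideal.Quotient.mk_surjective x
    have : Ideal.Quotient.mk Q (a * x) = 0 := hx
    rw [Ideal.Quotient.eq_zero_iff_mem] at this ⊢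
    exact (Ideal.IsPrime.mem_or_mem inferInstance this).resolve_left haQ
  have hex : Function.Exact f (LinearMap.range f).mkQ := by
    intro x
    rw [Submodule.mkQ_apply, Submodule.Quotient.mk_eq_zero]
    rfl
  have hS := shortCx_shortExact f (LinearMap.range f).mkQ hex hf (Submodule.mkQ_surjective _)
  refine subsingleton_of_smul_surjective (M := Ext (ModuleCat.of Λ (Λ ⧸ Q)) X i) a ha ?_
  intro e
  obtain ⟨x, hx⟩ := Ext.contravariant_sequence_exact₁ hS X e (add_comm 1 i) (h _ _)
  refine ⟨x, ?_⟩
  rw [← hx]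
  have : ModuleCat.ofHom f = a • 𝟙 (ModuleCat.of Λ (Λ ⧸ Q)) := rfl
  change _ = (Ext.mk₀ (ModuleCat.ofHom f)).comp x _
  rw [this, Ext.mk₀_smul, Ext.smul_comp, Ext.mk₀_id_comp]

theorem extVan_of_residue {X : ModuleCat.{u} Λ} [Module.Finite Λ X] (i : ℕ)
    (h : ∀ (N : ModuleCat.{u} Λ) [Module.Finite Λ N], ExtVan N X (i + 1))
    (hk : ExtVan (ModuleCat.of Λ (Λ ⧸ maximalIdeal Λ)) X i)
    (N : ModuleCat.{u} Λ) [hN : Module.Finite Λ N] : ExtVan N X i := by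
  refine IsNoetherianRing.induction_on_isQuotientEquivQuotientPrime Λ hN
    (motive := fun N _ _ _ => ExtVan (ModuleCat.of Λ N) X i) ?_ ?_ ?_
  · intro N _ _ _ _ e
    have : Limits.IsZero (ModuleCat.of Λ N) := ModuleCat.isZero_of_subsingleton _
    rw [← Ext.mk₀_id_comp e, this.eq_of_src (𝟙 _) 0, Ext.mk₀_zero, Ext.zero_comp]
  · intro N _ _ _ p e
    refine ExtVan.of_iso e.symm.toModuleIso ?_
    by_cases hp : p.1 = maximalIdeal Λ
    · rw [hp]
      exact hk
    · exact extVan_quotient_prime i h p.1 hp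
  · intro N₁ _ _ _ N₂ _ _ _ N₃ _ _ _ f g hf hg hfg h1 h3
    exact ExtVan.middle (shortCx_shortExact f g hfg hf hg) h1 h3

end Local

theorem hasInjectiveDimensionLT_of_ext {A : Type u} [CommRing A] (X : ModuleCat.{u} A) (n : ℕ)
    (h : ∀ N : ModuleCat.{u} A,
      Subsingleton (((Ext A (ModuleCat.{u} A) (n + 1)).obj (Opposite.op N)).obj X)) :
    HasInjectiveDimensionLT X (n + 1) := by
  refine hasInjectiveDimensionLT_of_enoughProjectives X (n + 1) fun N => ⟨fun a b => ?_⟩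
  suffices hz : ∀ e : Abelian.Ext N X (n + 1), e = 0 by rw [hz a, hz b]
  intro e
  let P : ProjectiveResolution N := Classical.choice HasProjectiveResolution.out
  obtain ⟨f, hf, rfl⟩ := P.extMk_surjective e (n + 2) rfl
  rw [P.extMk_eq_zero_iff f (n + 2) rfl hf n rfl]
  have h0 : Limits.IsZero ((P.complex.linearYonedaObj A X).homology (n + 1)) :=
    (@ModuleCat.isZero_of_subsingleton _ _ _ (h N)).of_iso (P.isoExt (n + 1) X).symm
  rw [← HomologicalComplex.exactAt_iff_isZero_homology,
    HomologicalComplex.exactAt_iff' _ n (n + 1) (n + 2) (by simp) (by simp),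
    ShortComplex.moduleCat_exact_iff] at h0
  obtain ⟨g, hg⟩ := h0 f hf
  exact ⟨g, hg⟩

open Abelian RingTheory.Sequence
open scoped Pointwise

theorem maximalIdeal_smul_top_lt {Λ : Type u} [CommRing Λ] [IsLocalRing Λ] (M : Type u)
    [AddCommGroup M] [Module Λ M] [Module.Finite Λ M]
    [Nontrivial M] (I : Ideal Λ) (hI : I ≤ maximalIdeal Λ) : I • (⊤ : Submodule Λ M) < ⊤ := by
  rw [lt_top_iff_ne_top]
  intro h
  have : (⊤ : Submodule Λ M) = ⊥ :=
    Submodule.eq_bot_of_le_smul_of_le_jacobson_bot I ⊤ Module.Finite.fg_top h.ge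
      (hI.trans (IsLocalRing.maximalIdeal_le_jacobson _))
  exact top_ne_bot this

theorem support_quotient {Λ : Type u} [CommRing Λ] (I : Ideal Λ) :
    Module.support Λ (Λ ⧸ I) = PrimeSpectrum.zeroLocus I := by
  rw [Module.support_eq_zeroLocus, Ideal.annihilator_quotient]

theorem subsingleton_of_extVan_zero {Λ : Type u} [CommRing Λ] (M : ModuleCat.{u} Λ) :
    ExtVan M M 0 → Subsingleton M := by
  intro h
  have := h (Ext.mk₀ (𝟙 M))
  have h2 : (𝟙 M : M ⟶ M) = 0 := (Ext.mk₀_bijective _ _).1 (this.trans (Ext.mk₀_zero _ _).symm)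
  refine ⟨fun a b => ?_⟩
  have h3 (a : M) : a = 0 := LinearMap.congr_fun (congrArg ModuleCat.Hom.hom h2) a
  rw [h3 a, h3 b]

section Local

variable {Λ : Type u} [CommRing Λ] [IsNoetherianRing Λ] [IsLocalRing Λ]

theorem extVan_residue_of_isRegular {X : ModuleCat.{u} Λ} (rs : List Λ) : ∀ (M : ModuleCat.{u} Λ)
    [Module.Finite Λ M] (c : ℕ), IsRegular M rs → (∀ i, c < i → ExtVan M X i) →
    (∃ r ∈ maximalIdeal Λ, IsRegular M (rs ++ [r])) ∨
    ∀ i, c + rs.length < i → (∀ (N : ModuleCat.{u} Λ) [Module.Finite Λ N], ExtVan N X (i + 1)) →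
      ExtVan (ModuleCat.of Λ (Λ ⧸ maximalIdeal Λ)) X i := by
  induction rs with
  | nil =>
    intro M _ c hM hX
    have : Nontrivial M := hM.nontrivial
    by_cases h0 : ExtVan (ModuleCat.of Λ (Λ ⧸ maximalIdeal Λ)) M 0
    · left
      obtain ⟨rs, hlen, hrs, hreg⟩ := ModuleCat.exists_isRegular_of_exists_subsingleton_ext
        (maximalIdeal Λ) 1 M (maximalIdeal_smul_top_lt M _ le_rfl)
        (ModuleCat.of Λ (Λ ⧸ maximalIdeal Λ)) (support_quotient _) (fun i hi => by
          obtain rfl : i = 0 := by lia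
          exact ⟨fun a b => (h0 a).trans (h0 b).symm⟩)
      obtain ⟨r, rfl⟩ := List.length_eq_one_iff.1 hlen
      exact ⟨r, hrs r (by simp), hreg⟩
    · right
      intro i hi hN
      rw [not_forall] at h0
      obtain ⟨e, he⟩ := h0
      obtain ⟨φ, rfl⟩ := (Ext.mk₀_bijective _ _).2 e
      have hφ : φ.hom ≠ 0 := fun h => he (by
        rw [show φ = 0 from ModuleCat.hom_ext h, Ext.mk₀_zero])
      have hsimple : IsSimpleModule Λ (Λ ⧸ maximalIdeal Λ) :=
        isSimpleModule_iff_isCoatom.2 (IsLocalRing.maximalIdeal.isMaximal Λ).out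
      have hinj : Function.Injective φ.hom :=
        (LinearMap.injective_or_eq_zero φ.hom).resolve_right hφ
      have hex : Function.Exact φ.hom (LinearMap.range φ.hom).mkQ := by
        intro x
        rw [Submodule.mkQ_apply, Submodule.Quotient.mk_eq_zero]
        rfl
      have hS := shortCx_shortExact φ.hom _ hex hinj (Submodule.mkQ_surjective _)
      refine ExtVan.left hS (hX i (by simpa using hi)) (hN _)
  | cons r rs ih =>
    intro M _ c hM hX
    rw [isRegular_cons_iff] at hM
    have hS := shortCx_shortExact (LinearMap.lsmul Λ M r) (r • (⊤ : Submodule Λ M)).mkQ (by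
      intro x
      rw [Submodule.mkQ_apply, Submodule.Quotient.mk_eq_zero,
        Submodule.mem_smul_pointwise_iff_exists]
      exact ⟨fun ⟨y, _, hy⟩ => ⟨y, hy⟩, fun ⟨y, hy⟩ => ⟨y, trivial, hy⟩⟩) hM.1
      (Submodule.mkQ_surjective _)
    rcases ih (ModuleCat.of Λ (QuotSMulTop r M)) (c + 1) hM.2 (fun i hi => by
      obtain ⟨i, rfl⟩ : ∃ j, i = j + 1 := ⟨i - 1, by lia⟩
      exact ExtVan.right hS (hX i (by lia)) (hX (i + 1) (by lia))) with ⟨r', hr', h⟩ | h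
    · exact Or.inl ⟨r', hr', (isRegular_cons_iff _ _ _).2 ⟨hM.1, h⟩⟩
    · exact Or.inr fun i hi => h i (by rw [List.length_cons] at hi; lia)

theorem exists_isRegular_of_hasInjectiveDimensionLT (n : ℕ)
    (hn : HasInjectiveDimensionLT (ModuleCat.of Λ Λ) n) :
    ∃ rs : List Λ, (∀ r ∈ rs, r ∈ maximalIdeal Λ) ∧ IsRegular Λ rs ∧
      (∀ Q : Ideal Λ, Q.IsPrime → (∀ r ∈ rs, r ∈ Q) → Q = maximalIdeal Λ) ∧
      HasInjectiveDimensionLT (ModuleCat.of Λ Λ) (rs.length + 1) := by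
  let X := ModuleCat.of Λ Λ
  let Van (i : ℕ) : Prop := ∀ (N : ModuleCat.{u} Λ) [Module.Finite Λ N], ExtVan N X i
  obtain ⟨s, hs, hs'⟩ : ∃ s, ¬ ExtVan (ModuleCat.of Λ (Λ ⧸ maximalIdeal Λ)) X s ∧
      ∀ i, s < i → Van i := by
    have hex : ∃ m, ∀ i, m ≤ i → Van i := ⟨n, fun i hi N _ e =>
      e.eq_zero_of_hasInjectiveDimensionLT n hi⟩
    classical
    have h1 := Nat.find_spec hex
    have h2 : Nat.find hex ≠ 0 := fun h0 => by
      have h3 := subsingleton_of_extVan_zero X (h1 0 (by lia) X)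
      exact not_subsingleton Λ h3
    obtain ⟨s, hs⟩ := Nat.exists_eq_succ_of_ne_zero h2
    refine ⟨s, fun h => ?_, fun i hi => h1 i (by lia)⟩
    refine Nat.find_min hex (m := s) (by lia) fun i hi => ?_
    rcases hi.eq_or_lt with rfl | hi
    · exact fun N _ => extVan_of_residue s (h1 (s + 1) (by lia)) h N
    · exact h1 i (by lia)
  have hbd : ∀ rs : List Λ, (∀ r ∈ rs, r ∈ maximalIdeal Λ) → IsRegular Λ rs → rs.length ≤ s := by
    intro rs hrs hreg
    by_contra! hlt
    have := ModuleCat.subsingleton_ext_of_exists_isRegular (maximalIdeal Λ)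
      (ModuleCat.of Λ (Λ ⧸ maximalIdeal Λ)) (support_quotient _).le X
      (maximalIdeal_smul_top_lt Λ _ le_rfl) rs hrs hreg s hlt
    exact hs fun e => this.elim _ _
  obtain ⟨rs, hrs, hreg, hmax⟩ : ∃ rs : List Λ, (∀ r ∈ rs, r ∈ maximalIdeal Λ) ∧ IsRegular Λ rs ∧
      ∀ rs' : List Λ, (∀ r ∈ rs', r ∈ maximalIdeal Λ) → IsRegular Λ rs' →
        rs'.length ≤ rs.length := by
    classical
    let T (h : ℕ) : Prop := ∃ rs : List Λ, (∀ r ∈ rs, r ∈ maximalIdeal Λ) ∧ IsRegular Λ rs ∧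
      rs.length = h
    have hT : T (Nat.findGreatest T s) := Nat.findGreatest_spec (m := 0) (Nat.zero_le _)
      ⟨[], by simp, IsRegular.nil Λ Λ, rfl⟩
    obtain ⟨rs, h1, h2, h3⟩ := hT
    exact ⟨rs, h1, h2, fun rs' h1' h2' => h3 ▸ Nat.le_findGreatest (hbd rs' h1' h2')
      ⟨rs', h1', h2', rfl⟩⟩
  have hsle : s ≤ rs.length := by
    by_contra! hlt
    rcases extVan_residue_of_isRegular (X := X) rs (ModuleCat.of Λ Λ) 0 hreg (fun i hi e => by
      obtain ⟨i, rfl⟩ : ∃ j, i = j + 1 := ⟨i - 1, by lia⟩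
      exact Ext.eq_zero_of_projective e) with ⟨r, hr, h⟩ | h
    · have := hmax (rs ++ [r]) (by
        intro r' hr'
        rcases List.mem_append.1 hr' with h | h
        · exact hrs r' h
        · rw [List.mem_singleton.1 h]; exact hr) h
      rw [List.length_append, List.length_singleton] at this
      lia
    · exact hs (h s (by lia) (hs' (s + 1) (by lia)))
  refine ⟨rs, hrs, hreg, fun Q hQ hrsQ => ?_, hasInjectiveDimensionLT_of_finite _ _
    fun I i hi => hs' i (by lia) _⟩
  by_contra hne
  have hle : Q ≤ maximalIdeal Λ := IsLocalRing.le_maximalIdeal hQ.ne_top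
  have hlt := maximalIdeal_smul_top_lt Λ Q hle
  obtain ⟨rs', h1, h2, h3⟩ := ModuleCat.exists_isRegular_of_exists_subsingleton_ext
    Q (rs.length + 1) X hlt (ModuleCat.of Λ (Λ ⧸ Q)) (support_quotient _) (fun i hi => by
      rcases (Nat.lt_succ_iff.1 hi).eq_or_lt with rfl | hi
      · have := extVan_quotient_prime (X := X) rs.length (hs' _ (by lia)) Q hne
        exact ⟨fun a b => (this a).trans (this b).symm⟩
      · exact ModuleCat.subsingleton_ext_of_exists_isRegular Q
          (ModuleCat.of Λ (Λ ⧸ Q)) (support_quotient _).le X hlt rs hrsQ hreg i hi)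
  have := hmax rs' (fun r hr => hle (h2 r hr)) h3
  lia

end Local

open RingTheory.Sequence
open scoped Pointwise

section Restrict

variable {A : Type u} [CommRing A] (S : Submonoid A)

theorem injective_restrictScalars (M : Type u) [AddCommGroup M] [Module A M]
    [Module (Localization S) M] [IsScalarTower A (Localization S) M]
    [hinj : Module.Injective (Localization S) M] : Module.Injective A M := by
  have hu : ∀ s : S, IsUnit (algebraMap A (Module.End A M) s) := fun s => by
    rw [Module.End.isUnit_iff]
    have h2 := (IsLocalization.map_units (Localization S) s)
    constructor
    · intro a b hab
      have hab' : (s : A) • a = (s : A) • b := hab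
      rw [← algebraMap_smul (Localization S), ← algebraMap_smul (Localization S) (s : A) b] at hab'
      exact h2.smul_left_cancel.1 hab'
    · intro b
      obtain ⟨v, hv⟩ := h2
      refine ⟨(v⁻¹ : (Localization S)ˣ) • b, ?_⟩
      change (s : A) • _ = b
      rw [← algebraMap_smul (Localization S), ← hv]
      exact smul_inv_smul v b
  refine ⟨fun X Y _ _ _ _ f hf g => ?_⟩
  let f' : LocalizedModule S X →ₗ[Localization S] LocalizedModule S Y :=
    IsLocalizedModule.mapExtendScalars S (LocalizedModule.mkLinearMap S X)
      (LocalizedModule.mkLinearMap S Y) (Localization S) f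
  have hf' : Function.Injective f' :=
    IsLocalizedModule.map_injective S (LocalizedModule.mkLinearMap S X)
      (LocalizedModule.mkLinearMap S Y) f hf
  let g' : LocalizedModule S X →ₗ[Localization S] M :=
    (LocalizedModule.lift S g hu).extendScalarsOfIsLocalization S (Localization S)
  have hg' (x : X) : g' (LocalizedModule.mkLinearMap S X x) = g x :=
    LocalizedModule.lift_mk_one S g hu x
  obtain ⟨h, hh⟩ := hinj.out f' hf' g'
  refine ⟨(h.restrictScalars A) ∘ₗ (LocalizedModule.mkLinearMap S Y), fun x => ?_⟩
  rw [← hg' x, ← hh]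
  exact congrArg h (IsLocalizedModule.map_apply S (LocalizedModule.mkLinearMap S X)
      (LocalizedModule.mkLinearMap S Y) f x).symm

theorem hasInjectiveDimensionLT_restrictScalars (n : ℕ) : ∀ (M : ModuleCat.{u} (Localization S)),
    HasInjectiveDimensionLT M (n + 1) →
    HasInjectiveDimensionLT
      ((ModuleCat.restrictScalars (algebraMap A (Localization S))).obj M) (n + 1) := by
  induction n with
  | zero =>
    intro M hM
    have hM' : Injective M := injective_iff_hasInjectiveDimensionLT_one.2 hM
    rw [← Module.injective_iff_injective_object] at hM'
    let N := (ModuleCat.restrictScalars (algebraMap A (Localization S))).obj M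
    let _ : Module (Localization S) N := inferInstanceAs (Module (Localization S) M)
    have : IsScalarTower A (Localization S) N := IsScalarTower.of_algebraMap_smul fun a m => rfl
    have : Module.Injective (Localization S) N := hM'
    have := injective_restrictScalars S N
    rw [Module.injective_iff_injective_object] at this
    exact (injective_iff_hasInjectiveDimensionLT_one (X := N)).1 this
  | succ n ih =>
    intro M hM
    obtain ⟨J, inj, f, monof⟩ := (inferInstance : EnoughInjectives (ModuleCat.{u} _)).1 M
    let T := ShortComplex.mk f (Limits.cokernel.π f) (Limits.cokernel.condition f)
    have hT : T.ShortExact := { exact := ShortComplex.exact_cokernel f }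
    have h3 := (hT.hasInjectiveDimensionLT_X₃_iff n inj).2 hM
    have hT' := hT.map_of_exact (ModuleCat.restrictScalars (algebraMap A (Localization S)))
    have hJ0 := injective_iff_hasInjectiveDimensionLT_one.1 inj
    have hJ := ih J (hasInjectiveDimensionLT_of_ge J 1 (n + 1) (by lia))
    have hJ' := @hasInjectiveDimensionLT_of_ge _ _ _ _ (n + 1) (n + 1 + 1) (by lia) hJ
    exact hT'.hasInjectiveDimensionLT_X₁ (n + 1) (ih _ h3) hJ'

end Restrict

theorem isWeaklyRegular_of_forall₂_associated {Λ : Type u} [CommRing Λ] (rs rs' : List Λ)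
    (h : List.Forall₂ Associated rs rs') : ∀ (M : Type u) [AddCommGroup M] [Module Λ M],
    IsWeaklyRegular M rs → IsWeaklyRegular M rs' := by
  induction h with
  | nil => exact fun M _ _ h => h
  | @cons r r' rs rs' hr _ ih =>
    intro M _ _ hM
    rw [isWeaklyRegular_cons_iff] at hM ⊢
    obtain ⟨v, rfl⟩ := hr
    refine ⟨(hM.1.mul ?_ : _), ?_⟩
    · exact v.isUnit.isSMulRegular M
    · have h1 : r • (⊤ : Submodule Λ M) = (r * v) • (⊤ : Submodule Λ M) := by
        ext x
        rw [Submodule.mem_smul_pointwise_iff_exists, Submodule.mem_smul_pointwise_iff_exists]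
        constructor
        · rintro ⟨y, -, rfl⟩
          refine ⟨((v⁻¹ : Λˣ) : Λ) • y, trivial, ?_⟩
          rw [smul_smul, mul_assoc, Units.mul_inv, mul_one]
        · rintro ⟨y, -, rfl⟩
          exact ⟨(v : Λ) • y, trivial, smul_smul _ _ _⟩
      exact ((Submodule.quotEquivOfEq _ _ h1).isWeaklyRegular_congr rs').1 (ih _ hM.2)

theorem forall_mem_iff_of_forall₂_associated {Λ : Type u} [CommRing Λ] {rs rs' : List Λ}
    (h : List.Forall₂ Associated rs rs') (I : Ideal Λ) :
    (∀ r ∈ rs, r ∈ I) ↔ ∀ r ∈ rs', r ∈ I := by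
  induction h with
  | nil => rfl
  | @cons r r' rs rs' hr _ ih =>
    rw [List.forall_mem_cons, List.forall_mem_cons, ih]
    obtain ⟨v, rfl⟩ := hr
    rw [Ideal.mul_unit_mem_iff_mem _ v.isUnit]

theorem exists_list_associated {A : Type u} [CommRing A] (S : Submonoid A)
    (rs : List (Localization S)) :
    ∃ rs' : List A, List.Forall₂ Associated rs (rs'.map (algebraMap A (Localization S))) := by
  induction rs with
  | nil => exact ⟨[], List.Forall₂.nil⟩
  | cons r rs ih =>
    obtain ⟨rs', h⟩ := ih
    obtain ⟨a, s, rfl⟩ := IsLocalization.exists_mk'_eq S r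
    refine ⟨a :: rs', List.Forall₂.cons ?_ h⟩
    obtain ⟨v, hv⟩ := IsLocalization.map_units (Localization S) s
    exact ⟨v, by rw [hv, IsLocalization.mk'_spec]⟩

/-- Regular elements of the localization at a prime of a ring of finite injective dimension. -/
theorem exists_isRegular_localizedModule {A : Type u} [CommRing A] [IsNoetherianRing A] (n : ℕ)
    (hn : HasInjectiveDimensionLT (ModuleCat.of A A) (n + 1)) (Q : Ideal A) [hQ : Q.IsPrime] :
    ∃ rs : List A, (∀ r ∈ rs, r ∈ Q) ∧ IsRegular (LocalizedModule Q.primeCompl A) rs ∧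
      (∀ Q' : Ideal A, Q'.IsPrime → Q' ≤ Q → (∀ r ∈ rs, r ∈ Q') → Q' = Q) ∧
      ∀ N i, rs.length < i → ExtVan N (ModuleCat.of A (LocalizedModule Q.primeCompl A)) i := by
  let S := Q.primeCompl
  let Λ := Localization S
  let T := LocalizedModule S A
  have : IsLocalRing Λ := inferInstanceAs (IsLocalRing (Localization.AtPrime Q))
  have : IsNoetherianRing Λ := IsLocalization.isNoetherianRing S Λ inferInstance
  let eT : T ≃ₗ[Λ] Λ := (IsLocalizedModule.iso S
    (Algebra.linearMap A Λ)).extendScalarsOfIsLocalization S Λ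
  have h1 : HasInjectiveDimensionLT (ModuleCat.of Λ T) (n + 1) := by
    have h2 := @ModuleCat.localizedModule_hasInjectiveDimensionLE A _ _ _ n S (ModuleCat.of A A) hn
    refine (ModuleCat.hasInjectiveDimensionLE_iff_of_linearEquiv
      (N := ModuleCat.of Λ T) ?_ n).1 h2
    exact Shrink.linearEquiv Λ _
  have h2 : HasInjectiveDimensionLT (ModuleCat.of Λ Λ) (n + 1) :=
    (ModuleCat.hasInjectiveDimensionLE_iff_of_linearEquiv
      (M := ModuleCat.of Λ T) (N := ModuleCat.of Λ Λ) eT n).1 h1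
  obtain ⟨rs, hrs, hreg, hmax, hinj⟩ := exists_isRegular_of_hasInjectiveDimensionLT _ h2
  obtain ⟨rs', hrs'⟩ := exists_list_associated S rs
  have hlen : rs'.length = rs.length := by rw [hrs'.length_eq, List.length_map]
  have hmem : ∀ I : Ideal Λ, (∀ r ∈ rs, r ∈ I) ↔ ∀ r ∈ rs', algebraMap A Λ r ∈ I := by
    intro I
    rw [forall_mem_iff_of_forall₂_associated hrs' I, List.forall_mem_map]
  have hrsQ : ∀ r ∈ rs', r ∈ Q := by
    intro r hr
    have := (hmem _).1 hrs r hr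
    exact (IsLocalization.AtPrime.to_map_mem_maximal_iff (Localization.AtPrime Q) Q r).1 this
  refine ⟨rs', hrsQ, ?_, ?_, ?_⟩
  · have hw : IsWeaklyRegular T rs' :=
      (isWeaklyRegular_map_algebraMap_iff Λ T rs').1
        ((eT.isWeaklyRegular_congr _).2
          (isWeaklyRegular_of_forall₂_associated _ _ hrs' Λ hreg.toIsWeaklyRegular))
    refine ⟨hw, fun htop => ?_⟩
    have hle : Ideal.ofList rs' • (⊤ : Submodule A T) ≤
        (Submodule.comap eT.toLinearMap (maximalIdeal Λ)).restrictScalars A := by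
      rw [Submodule.smul_le]
      intro r hr t _
      have hr' : r ∈ Q := (Ideal.span_le.2 fun r hr => hrsQ r hr) hr
      change eT (r • t) ∈ maximalIdeal Λ
      rw [← algebraMap_smul Λ, map_smul, smul_eq_mul]
      exact Ideal.mul_mem_right _ _
        ((IsLocalization.AtPrime.to_map_mem_maximal_iff (Localization.AtPrime Q) Q r).2 hr')
    have h1 : eT (eT.symm 1) ∈ maximalIdeal Λ := hle (htop ▸ Submodule.mem_top)
    rw [LinearEquiv.apply_symm_apply] at h1
    exact (Ideal.ne_top_iff_one _).1 (IsLocalRing.maximalIdeal.isMaximal Λ).ne_top h1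
  · intro Q' hQ' hle hr
    have hd : Disjoint (S : Set A) Q' := by
      rw [Set.disjoint_left]
      exact fun x hx hx' => hx (hle hx')
    have hp : (Q'.map (algebraMap A Λ)).IsPrime :=
      IsLocalization.isPrime_of_isPrime_disjoint S Λ Q' hQ' hd
    have := hmax _ hp ((hmem _).2 fun r hr' => Ideal.mem_map_of_mem _ (hr r hr'))
    have h3 := IsLocalization.under_map_of_isPrime_disjoint S Λ hQ' hd
    rw [← h3, this]
    exact IsLocalization.AtPrime.under_maximalIdeal (Localization.AtPrime Q) Q
  · intro N i hi e
    rw [hlen] at hi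
    have h3 : HasInjectiveDimensionLT (ModuleCat.of Λ T) (rs.length + 1) :=
      (ModuleCat.hasInjectiveDimensionLE_iff_of_linearEquiv
        (M := ModuleCat.of Λ T) (N := ModuleCat.of Λ Λ) eT _).2 hinj
    have h4 := hasInjectiveDimensionLT_restrictScalars S rs.length (ModuleCat.of Λ T) h3
    have h5 : HasInjectiveDimensionLT (ModuleCat.of A T) (rs.length + 1) := by
      let e : (ModuleCat.restrictScalars (algebraMap A Λ)).obj (ModuleCat.of Λ T) ≃ₗ[A] T :=
        { AddEquiv.refl T with
          map_smul' := fun a m => algebraMap_smul (M := T) Λ a m }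
      exact (ModuleCat.hasInjectiveDimensionLE_iff_of_linearEquiv
        (N := ModuleCat.of A T) e _).1 h4
    exact e.eq_zero_of_hasInjectiveDimensionLT (rs.length + 1) hi

open Abelian

section Injectivity

variable {A : Type u} [CommRing A] {ι : Type} (y : ι → A)

theorem extVan_locProd [Finite ι] (N : ModuleCat.{u} A) (t : ℕ)
    (ht : ∀ (a : ι) (n : N), y a ^ t • n = 0) (X : ModuleCat.{u} A) (i : ℕ) :
    ExtVan N (ModuleCat.of A (LocProd y X)) i := by
  classical
  cases nonempty_fintype ι
  intro e
  let L := ModuleCat.of A (LocProd y X)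
  let q (a : ι) : L ⟶ L := ModuleCat.ofHom
    (LinearMap.single A (fun a => LocalizedModule (pw y a) X) a ∘ₗ
      LocalizedModule.divBy (⟨y a ^ t, t, rfl⟩ : pw y a) ∘ₗ LinearMap.proj a)
  have hq : (𝟙 L : L ⟶ L) = ∑ a, y a ^ t • q a := by
    refine ModuleCat.hom_ext (LinearMap.ext fun x => ?_)
    rw [ModuleCat.hom_sum, LinearMap.sum_apply]
    change x = ∑ a, y a ^ t • Pi.single (M := fun a => LocalizedModule (pw y a) X) a
      (LocalizedModule.divBy (⟨y a ^ t, t, rfl⟩ : pw y a) (x a))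
    have h1 (a : ι) : y a ^ t • Pi.single (M := fun a => LocalizedModule (pw y a) X) a
      (LocalizedModule.divBy (⟨y a ^ t, t, rfl⟩ : pw y a) (x a)) =
        Pi.single (M := fun a => LocalizedModule (pw y a) X) a (x a) := by
      rw [← Pi.single_smul]
      exact congrArg _ (LocalizedModule.mul_by_divBy (⟨y a ^ t, t, rfl⟩ : pw y a) (x a))
    rw [Finset.sum_congr rfl fun a _ => h1 a]
    exact (Finset.univ_sum_single (x : LocProd y X)).symm
  have hN (a : ι) : y a ^ t • 𝟙 N = 0 := ModuleCat.hom_ext (LinearMap.ext fun n => ht a n)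
  have h2 (a : ι) (e' : Ext N L i) : y a ^ t • e' = 0 := by
    rw [← Ext.mk₀_id_comp e', ← Ext.smul_comp, ← Ext.mk₀_smul, hN, Ext.mk₀_zero, Ext.zero_comp]
  rw [← Ext.comp_mk₀_id e, hq, Ext.mk₀_sum, Ext.comp_sum]
  refine Finset.sum_eq_zero fun a _ => ?_
  rw [Ext.mk₀_smul, Ext.comp_smul]
  exact h2 a _

/-- The submodule of coboundaries of the Čech complex. -/
noncomputable def cechBoundaries (T : ModuleCat.{u} A) :
    ∀ i, Submodule A ((cechFunctor y i).obj T)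
  | 0 => ⊥
  | i + 1 => LinearMap.range ((cechD y i).app T).hom

theorem cechClass_eq_zero_iff (T : ModuleCat.{u} A) (i : ℕ)
    (z : LinearMap.ker ((cechD y i).app T).hom) :
    cechClass y T i z = 0 ↔ z.1 ∈ cechBoundaries y T i := by
  cases i with
  | zero =>
    rw [cechClass_zero_eq_zero_iff]
    exact ⟨fun h => h ▸ rfl, fun h => Subtype.ext h⟩
  | succ i => exact cechClass_succ_eq_zero_iff y T i z

theorem cechBoundaries_le (T : ModuleCat.{u} A) (i : ℕ) :
    cechBoundaries y T i ≤ LinearMap.ker ((cechD y i).app T).hom := by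
  cases i with
  | zero => exact bot_le
  | succ i =>
    rintro _ ⟨x, rfl⟩
    have := congrArg (fun f => f.app T) (cechD_comp y i)
    exact LinearMap.congr_fun (congrArg ModuleCat.Hom.hom this) x

theorem cech_shortExact (T : ModuleCat.{u} A) (i : ℕ) :
    ∃ (g : (cechFunctor y i).obj T →ₗ[A] cechBoundaries y T (i + 1))
      (h : Function.Exact (LinearMap.ker ((cechD y i).app T).hom).subtype g),
      (shortCx (LinearMap.ker ((cechD y i).app T).hom).subtype g h).ShortExact := by
  let g : (cechFunctor y i).obj T →ₗ[A] cechBoundaries y T (i + 1) :=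
    LinearMap.rangeRestrict ((cechD y i).app T).hom
  have h : Function.Exact (LinearMap.ker ((cechD y i).app T).hom).subtype g := by
    intro x
    constructor
    · intro hx
      exact ⟨⟨x, congrArg Subtype.val hx⟩, rfl⟩
    · rintro ⟨z, rfl⟩
      exact Subtype.ext z.2
  exact ⟨g, h, shortCx_shortExact _ _ h (Submodule.subtype_injective _)
    (LinearMap.surjective_rangeRestrict _)⟩

variable [Finite ι] (N : ModuleCat.{u} A) (t : ℕ) (ht : ∀ (a : ι) (n : N), y a ^ t • n = 0)
include ht

theorem extVan_cechFunctor_succ (T : ModuleCat.{u} A) (i j : ℕ) :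
    ExtVan N ((cechFunctor y (i + 1)).obj T) j :=
  extVan_locProd y N t ht ((cechFunctor y i).obj T) j

theorem extVan_cechH {T : ModuleCat.{u} A} {h : ℕ} (hT : ∀ j, h < j → ExtVan N T j)
    (h0 : ∀ i, i < h → ∀ x : (cechH y i).obj T, x = 0) : ExtVan N ((cechH y h).obj T) 1 := by
  have hC : ∀ i j, h < j → ExtVan N ((cechFunctor y i).obj T) j := by
    intro i j hj
    cases i with
    | zero => exact hT j hj
    | succ i => exact extVan_cechFunctor_succ y N t ht T i j
  have hB : ∀ i ≤ h, ∀ j, h + 2 ≤ j + i →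
      ExtVan N (ModuleCat.of A (cechBoundaries y T i)) j := by
    intro i
    induction i with
    | zero =>
      intro _ j _ e
      have : Subsingleton (cechBoundaries y T 0) := ⟨fun a b => by
        have h1 (a : cechBoundaries y T 0) : a = 0 := Subtype.ext a.2
        rw [h1 a, h1 b]⟩
      have : Limits.IsZero (ModuleCat.of A (cechBoundaries y T 0)) :=
        ModuleCat.isZero_of_subsingleton _
      rw [← Ext.comp_mk₀_id e, this.eq_of_src (𝟙 _) 0, Ext.mk₀_zero, Ext.comp_zero]
    | succ i ih =>
      intro hi j hj
      obtain ⟨g, hg, hS⟩ := cech_shortExact y T i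
      have hK : LinearMap.ker ((cechD y i).app T).hom = cechBoundaries y T i := by
        refine le_antisymm (fun z hz => ?_) (cechBoundaries_le y T i)
        exact (cechClass_eq_zero_iff y T i ⟨z, hz⟩).1 (h0 i (by lia) _)
      have h2 : ExtVan N (ModuleCat.of A (LinearMap.ker ((cechD y i).app T).hom)) (j + 1) := by
        rw [hK]
        exact ih (by lia) (j + 1) (by lia)
      refine ExtVan.covRight hS ?_ h2
      cases i with
      | zero => exact hT j (by lia)
      | succ i => exact extVan_cechFunctor_succ y N t ht T i j
  have hZ : ExtVan N (ModuleCat.of A (LinearMap.ker ((cechD y h).app T).hom)) 1 := by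
    obtain ⟨g, hg, hS⟩ := cech_shortExact y T h
    refine ExtVan.covLeft hS ?_ ?_
    · cases h with
      | zero => exact hT 1 one_pos
      | succ i => exact extVan_cechFunctor_succ y N t ht T i 1
    · intro e
      obtain ⟨φ, rfl⟩ := (Ext.mk₀_bijective _ _).2 e
      let j : ModuleCat.of A (cechBoundaries y T (h + 1)) ⟶ (cechFunctor y (h + 1)).obj T :=
        ModuleCat.ofHom (cechBoundaries y T (h + 1)).subtype
      have h1 := extVan_cechFunctor_succ y N t ht T h 0 (Ext.mk₀ (φ ≫ j))
      have h2 : φ ≫ j = 0 := (Ext.mk₀_bijective _ _).1 (h1.trans (Ext.mk₀_zero _ _).symm)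
      have h3 : φ = 0 := ModuleCat.hom_ext (LinearMap.ext fun x => Subtype.ext
        (LinearMap.congr_fun (congrArg ModuleCat.Hom.hom h2) x))
      rw [h3, Ext.mk₀_zero]
  let f : cechBoundaries y T h →ₗ[A] LinearMap.ker ((cechD y h).app T).hom :=
    Submodule.inclusion (cechBoundaries_le y T h)
  have hf : Function.Exact f (cechClass y T h) := by
    intro z
    rw [cechClass_eq_zero_iff]
    constructor
    · exact fun hz => ⟨⟨z, hz⟩, rfl⟩
    · rintro ⟨w, rfl⟩
      exact w.2
  have hS := shortCx_shortExact f (cechClass y T h) hf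
    (Submodule.inclusion_injective _) (cechClass_surjective y T h)
  exact ExtVan.covRight hS hZ (hB h le_rfl 2 (by lia))

end Injectivity

theorem exists_forall_pow_smul_eq_zero {A : Type u} [CommRing A] {ι : Type} [Finite ι] (y : ι → A)
    {E : Type u} [AddCommGroup E] [Module A E] (hE : ∀ (a : ι) (x : E), ∃ t : ℕ, y a ^ t • x = 0)
    (W : Submodule A E) (hW : W.FG) : ∃ t : ℕ, ∀ (a : ι), ∀ x ∈ W, y a ^ t • x = 0 := by
  cases nonempty_fintype ι
  obtain ⟨s, rfl⟩ := hW
  choose t ht using hE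
  refine ⟨∑ a, ∑ x ∈ s, t a x, fun a x hx => ?_⟩
  induction hx using Submodule.span_induction with
  | mem x hx =>
    have h1 : t a x ≤ ∑ a, ∑ x ∈ s, t a x :=
      (Finset.single_le_sum (f := t a) (fun _ _ => Nat.zero_le _) hx).trans
        (Finset.single_le_sum (f := fun a => ∑ x ∈ s, t a x) (fun _ _ => Nat.zero_le _)
          (Finset.mem_univ a))
    obtain ⟨k, hk⟩ := Nat.exists_eq_add_of_le h1
    rw [hk, add_comm, pow_add, mul_smul, ht, smul_zero]
  | zero => exact smul_zero _
  | add x x' _ _ h1 h2 => rw [smul_add, h1, h2, add_zero]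
  | smul r x _ h1 => rw [smul_comm, h1, smul_zero]

/-- A module supported on `V(y)` is injective once it has no extensions by cyclic modules supported
on `V(y)`. -/
theorem injective_of_extVan_torsion {A : Type u} [CommRing A] [IsNoetherianRing A] {ι : Type}
    [Finite ι] (y : ι → A) (E : ModuleCat.{u} A)
    (hE : ∀ (a : ι) (x : E), ∃ t : ℕ, y a ^ t • x = 0)
    (h : ∀ (I : Ideal A) (t : ℕ), (∀ a, y a ^ t ∈ I) → ExtVan (ModuleCat.of A (A ⧸ I)) E 1) :
    Module.Injective A E := by
  refine Module.Baer.injective fun I φ => ?_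
  obtain ⟨t, ht⟩ := exists_forall_pow_smul_eq_zero y hE (LinearMap.range φ)
    (by
      have : Module.Finite A I := Module.Finite.iff_fg.2 (IsNoetherian.noetherian I)
      rw [LinearMap.range_eq_map]
      exact Module.Finite.fg_top.map φ)
  let J : Ideal A := Ideal.span (Set.range fun a => y a ^ t)
  have hJ : ∀ r ∈ J, ∀ x : I, r • φ x = 0 := by
    intro r hr x
    induction hr using Submodule.span_induction with
    | mem r hr =>
      obtain ⟨a, rfl⟩ := hr
      exact ht a _ ⟨x, rfl⟩
    | zero => exact zero_smul _ _
    | add r r' _ _ h1 h2 => rw [add_smul, h1, h2, add_zero]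
    | smul c r _ h1 => rw [smul_assoc, h1, smul_zero]
  obtain ⟨k, hk⟩ := J.exists_pow_inf_eq_pow_smul I
  have hφ : ∀ (x : A) (hx : x ∈ I), x ∈ J ^ (k + 1) → φ ⟨x, hx⟩ = 0 := by
    intro x hx hxJ
    have h1 : x ∈ J • I := by
      have h2 : x ∈ (J ^ (k + 1) • ⊤ ⊓ I : Ideal A) := ⟨by simpa using hxJ, hx⟩
      rw [hk (k + 1) (by lia), Nat.add_sub_cancel_left, pow_one] at h2
      exact Submodule.smul_mono le_rfl inf_le_right h2
    have h3 : ∀ x ∈ J • I, ∀ hx : x ∈ I, φ ⟨x, hx⟩ = 0 := by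
      intro x hx
      induction hx using Submodule.smul_induction_on' with
      | smul r hr m hm =>
        intro h4
        exact (φ.map_smul r ⟨m, hm⟩).trans (hJ r hr _)
      | add x hx x' hx' h1 h2 =>
        intro h4
        have e1 : x ∈ I := Submodule.smul_le_right hx
        have e2 : x' ∈ I := Submodule.smul_le_right hx'
        have := φ.map_add ⟨x, e1⟩ ⟨x', e2⟩
        rw [h1 e1, h2 e2, add_zero] at this
        exact this
    exact h3 x h1 hx
  let f₁ : A →ₗ.[A] E := ⟨I, φ⟩
  let f₂ : A →ₗ.[A] E := ⟨J ^ (k + 1), 0⟩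
  have hag : ∀ (x : f₁.domain) (z : f₂.domain), (x : A) = z → f₁ x = f₂ z := by
    rintro ⟨x, hx⟩ ⟨z, hz⟩ (rfl : x = z)
    exact hφ x hx hz
  let f := f₁.sup f₂ hag
  obtain ⟨g, hg⟩ := exists_extend (X := E) f.domain (h f.domain (t * (k + 1)) fun a => by
    refine (le_sup_right : f₂.domain ≤ f₁.domain ⊔ f₂.domain) ?_
    rw [pow_mul]
    exact Ideal.pow_mem_pow (show y a ^ t ∈ J from Ideal.subset_span ⟨a, rfl⟩) _) f.toFun
  refine ⟨g, fun x hx => ?_⟩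
  have h1 := LinearPMap.left_le_sup f₁ f₂ hag
  rw [hg x (h1.1 hx)]
  exact (h1.2 (x := ⟨x, hx⟩) (y := ⟨x, h1.1 hx⟩) rfl).symm

theorem injective_cechH {A : Type u} [CommRing A] [IsNoetherianRing A] {ι : Type}
    [Finite ι] (y : ι → A) (T : ModuleCat.{u} A) (h : ℕ) (hT : ∀ N j, h < j → ExtVan N T j)
    (h0 : ∀ i, i < h → ∀ x : (cechH y i).obj T, x = 0) :
    Module.Injective A ((cechH y h).obj T) :=
  injective_of_extVan_torsion y _ (fun a x => exists_pow_smul_eq_zero y T h x a)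
    fun I t hI => extVan_cechH y _ t (fun a n => by
      obtain ⟨n, rfl⟩ := Ideal.Quotient.mk_surjective n
      change Ideal.Quotient.mk I (y a ^ t * n) = 0
      exact Ideal.Quotient.eq_zero_iff_mem.2 (Ideal.mul_mem_right _ _ (hI a))) (hT _) h0

section Loc

variable {A : Type u} [CommRing A] (S : Submonoid A)

/-- Localization of modules, as an endofunctor of the category of modules. -/
noncomputable def locF : ModuleCat.{u} A ⥤ ModuleCat.{u} A where
  obj M := ModuleCat.of A (LocalizedModule S M)
  map {M N} f := ModuleCat.ofHom (IsLocalizedModule.map S (LocalizedModule.mkLinearMap S M)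
    (LocalizedModule.mkLinearMap S N) f.hom)
  map_id _ := ModuleCat.hom_ext (IsLocalizedModule.map_id S _)
  map_comp {_ N _} f g := ModuleCat.hom_ext
    (IsLocalizedModule.map_comp' S _ (LocalizedModule.mkLinearMap S N) _ f.hom g.hom)

instance : (locF S).Additive where
  map_add {_ _ f g} := ModuleCat.hom_ext (map_add (IsLocalizedModule.map S _ _) f.hom g.hom)

theorem locF_map_smul {M N : ModuleCat.{u} A} (r : A) (f : M ⟶ N) :
    (locF S).map (r • f) = r • (locF S).map f :=
  ModuleCat.hom_ext (map_smul (IsLocalizedModule.map S _ _) r f.hom)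

theorem locF_map_injective {M N : ModuleCat.{u} A} (f : M ⟶ N)
    (h : Function.Injective f.hom) : Function.Injective ((locF S).map f).hom :=
  IsLocalizedModule.map_injective S (LocalizedModule.mkLinearMap S M)
    (LocalizedModule.mkLinearMap S N) f.hom h

theorem locF_shortExact {X : ShortComplex (ModuleCat.{u} A)} (hX : X.ShortExact) :
    (X.map (locF S)).ShortExact :=
  ModuleCat.shortComplex_shortExact _
    (IsLocalizedModule.map_exact S (LocalizedModule.mkLinearMap S X.X₁)
      (LocalizedModule.mkLinearMap S X.X₂) (LocalizedModule.mkLinearMap S X.X₃) _ _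
      ((ShortComplex.ShortExact.moduleCat_exact_iff_function_exact _).1 hX.exact))
    (IsLocalizedModule.map_injective S (LocalizedModule.mkLinearMap S X.X₁)
      (LocalizedModule.mkLinearMap S X.X₂) _ hX.moduleCat_injective_f)
    (IsLocalizedModule.map_surjective S (LocalizedModule.mkLinearMap S X.X₂)
      (LocalizedModule.mkLinearMap S X.X₃) _ hX.moduleCat_surjective_g)

theorem cechH_eq_zero_of_leftInverse {ι : Type} (y : ι → A) {X : ModuleCat.{u} A} (c : A)
    (f : X ⟶ X) (h : (c • 𝟙 X) ≫ f = 𝟙 X) (i : ℕ) (x : (cechH y i).obj X) (hx : c • x = 0) :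
    x = 0 := by
  have h1 : ((cechH y i).map ((c • 𝟙 X) ≫ f)).hom x = x := by
    rw [h, CategoryTheory.Functor.map_id]
    rfl
  rw [← h1, Functor.map_comp, ModuleCat.hom_comp, LinearMap.comp_apply, cechH_map_smul_id, hx,
    map_zero]

end Loc

theorem exists_pow_mul_le_of_mem_minimalPrimes {A : Type u} [CommRing A] [IsNoetherianRing A]
    {I Q : Ideal A} (hQ : Q ∈ I.minimalPrimes) : ∃ (n : ℕ) (c : A), c ∉ Q ∧
      ∀ r ∈ Q ^ n, c * r ∈ I := by
  classical
  have := hQ.isPrime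
  obtain ⟨n, hn⟩ := I.exists_radical_pow_le_of_fg I.radical.fg_of_isNoetherianRing
  have h := I.finite_minimalPrimes_of_isNoetherianRing A
  rw [← I.sInf_minimalPrimes, ← h.coe_toFinset, ← h.toFinset.inf_id_eq_sInf,
    ← Finset.insert_erase (h.mem_toFinset.mpr hQ), Finset.inf_insert, id_eq] at hn
  grw [← Ideal.mul_le_inf, mul_pow] at hn
  have h1 : ¬ ((h.toFinset.erase Q).inf id) ≤ Q := by
    rw [hQ.isPrime.inf_le']
    rintro ⟨K, hK, hKQ⟩
    rw [Finset.mem_erase, Set.Finite.mem_toFinset] at hK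
    exact hK.1 (le_antisymm hKQ (hQ.2 hK.2.1 hKQ))
  obtain ⟨c, hc, hcQ⟩ := Set.not_subset.1 h1
  refine ⟨n, c ^ n, fun h2 => hcQ (hQ.isPrime.mem_of_pow_mem n h2), fun r hr => ?_⟩
  rw [mul_comm]
  exact hn (Ideal.mul_mem_mul hr (Ideal.pow_mem_pow hc n))

/-- Elements of a prime ideal of `A` that form a maximal regular sequence in the localization,
together with the vanishing of `Ext` that holds over Gorenstein rings. -/
structure LocalDatum {A : Type u} [CommRing A] (Q : Ideal A) [Q.IsPrime] where
  rs : List A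
  mem : ∀ r ∈ rs, r ∈ Q
  regular : RingTheory.Sequence.IsRegular (LocalizedModule Q.primeCompl A) rs
  minimal : ∀ Q' : Ideal A, Q'.IsPrime → Q' ≤ Q → (∀ r ∈ rs, r ∈ Q') → Q' = Q
  extVan : ∀ N i, rs.length < i →
    ExtVan N (ModuleCat.of A (LocalizedModule Q.primeCompl A)) i

namespace LocalDatum

variable {A : Type u} [CommRing A] {Q : Ideal A} [Q.IsPrime] (D : LocalDatum Q)

/-- The length of the regular sequence. -/
def ht : ℕ := D.rs.length

/-- The regular sequence as a function. -/
def y : Fin D.ht → A := D.rs.get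

theorem y_mem (a : Fin D.ht) : D.y a ∈ Q := D.mem _ (List.get_mem _ _)

theorem exists_y_eq {r : A} (hr : r ∈ D.rs) : ∃ a, D.y a = r := List.mem_iff_get.1 hr

theorem mem_radical_range_y (r : A) (hr : r ∈ D.rs) :
    r ∈ (Ideal.span (Set.range D.y)).radical := by
  obtain ⟨a, rfl⟩ := D.exists_y_eq hr
  exact Ideal.le_radical (Ideal.subset_span ⟨a, rfl⟩)

theorem mem_minimalPrimes : Q ∈ (Ideal.span (Set.range D.y)).minimalPrimes := by
  refine ⟨⟨inferInstance, ?_⟩, fun Q' ⟨hQ', h1⟩ h2 => ?_⟩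
  · rw [Ideal.span_le]
    rintro _ ⟨a, rfl⟩
    exact D.y_mem a
  · refine (D.minimal Q' hQ' h2 fun r hr => ?_).ge
    obtain ⟨a, rfl⟩ := D.exists_y_eq hr
    exact h1 (Ideal.subset_span ⟨a, rfl⟩)

/-- Local cohomology at `Q` of the localization at `Q`. -/
noncomputable def G (i : ℕ) : ModuleCat.{u} A ⥤ ModuleCat.{u} A :=
  locF Q.primeCompl ⋙ cechH D.y i

instance (i : ℕ) : (D.G i).Additive := inferInstanceAs (locF _ ⋙ cechH D.y i).Additive

theorem G_map_smul {M N : ModuleCat.{u} A} (r : A) (f : M ⟶ N) (i : ℕ) (x : (D.G i).obj M) :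
    ((D.G i).map (r • f)).hom x = r • ((D.G i).map f).hom x := by
  change ((cechH D.y i).map ((locF _).map (r • f))).hom x = _
  rw [locF_map_smul]
  exact cechH_map_smul D.y r _ i x

theorem G_map_smul_id (M : ModuleCat.{u} A) (r : A) (i : ℕ) (x : (D.G i).obj M) :
    ((D.G i).map (r • 𝟙 M)).hom x = r • x := by
  rw [G_map_smul, CategoryTheory.Functor.map_id]
  rfl

theorem G_map_comp {M N P : ModuleCat.{u} A} (f : M ⟶ N) (g : N ⟶ P) (i : ℕ)
    (x : (D.G i).obj M) :
    ((D.G i).map (f ≫ g)).hom x = ((D.G i).map g).hom (((D.G i).map f).hom x) := by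
  rw [Functor.map_comp]
  rfl

theorem G_map_add {M N : ModuleCat.{u} A} (f g : M ⟶ N) (i : ℕ)
    (x : (D.G i).obj M) :
    ((D.G i).map (f + g)).hom x = ((D.G i).map f).hom x + ((D.G i).map g).hom x := by
  rw [Functor.map_add]
  rfl

theorem G_map_zero (M N : ModuleCat.{u} A) (i : ℕ) (x : (D.G i).obj M) :
    ((D.G i).map (0 : M ⟶ N)).hom x = 0 := by
  rw [Functor.map_zero]
  rfl

theorem G_zero_map_injective {M N : ModuleCat.{u} A} (f : M ⟶ N)
    (h : Function.Injective f.hom) : Function.Injective ((D.G 0).map f).hom :=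
  cechH_zero_map_injective D.y _ (locF_map_injective _ f h)

section LongExact

variable {X : ShortComplex (ModuleCat.{u} A)} (hX : X.ShortExact)

/-- The connecting homomorphism in local cohomology. -/
noncomputable def Gδ (i : ℕ) : (D.G i).obj X.X₃ ⟶ (D.G (i + 1)).obj X.X₁ :=
  cechδ D.y (locF_shortExact Q.primeCompl hX) i

theorem Gδ_eq_zero_iff (i : ℕ) (x : (D.G i).obj X.X₃) :
    (D.Gδ hX i).hom x = 0 ↔ ∃ w, ((D.G i).map X.g).hom w = x :=
  cechδ_eq_zero_iff D.y (locF_shortExact Q.primeCompl hX) i x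

theorem G_map_f_eq_zero_iff (i : ℕ) (x : (D.G (i + 1)).obj X.X₁) :
    ((D.G (i + 1)).map X.f).hom x = 0 ↔ ∃ w, (D.Gδ hX i).hom w = x :=
  cechH_map_f_eq_zero_iff D.y (locF_shortExact Q.primeCompl hX) i x

theorem Gδ_naturality {X' : ShortComplex (ModuleCat.{u} A)} (hX' : X'.ShortExact)
    (φ : X ⟶ X') (i : ℕ) (x : (D.G i).obj X.X₃) :
    ((D.G (i + 1)).map φ.τ₁).hom ((D.Gδ hX i).hom x) =
      (D.Gδ hX' i).hom (((D.G i).map φ.τ₃).hom x) :=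
  cechδ_naturality D.y (locF_shortExact Q.primeCompl hX) (locF_shortExact Q.primeCompl hX')
    ((locF _).mapShortComplex.map φ) i x

end LongExact

theorem eq_zero_of_smul_eq_zero (M : ModuleCat.{u} A) (i : ℕ) {c : A} (hc : c ∉ Q)
    (x : (D.G i).obj M) (hx : c • x = 0) : x = 0 := by
  let f : LocalizedModule Q.primeCompl M →ₗ[A] LocalizedModule Q.primeCompl M :=
    LocalizedModule.divBy ⟨c, hc⟩
  refine cechH_eq_zero_of_leftInverse D.y (X := (locF Q.primeCompl).obj M) c (ModuleCat.ofHom f)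
    (ModuleCat.hom_ext (LinearMap.ext fun z => ?_)) i x hx
  exact LocalizedModule.divBy_mul_by (⟨c, hc⟩ : Q.primeCompl) z

theorem exists_pow_smul_eq_zero [IsNoetherianRing A] (M : ModuleCat.{u} A) (i : ℕ)
    (x : (D.G i).obj M) : ∃ N : ℕ, ∀ r ∈ Q ^ N, r • x = 0 := by
  have h1 : (Ideal.span (Set.range D.y)) ≤ (Ideal.torsionOf A _ x).radical := by
    rw [Ideal.span_le]
    rintro _ ⟨a, rfl⟩
    obtain ⟨N, hN⟩ := PlusClosure.exists_pow_smul_eq_zero D.y _ i x a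
    exact ⟨N, hN⟩
  obtain ⟨k, hk⟩ := (Ideal.torsionOf A _ x).exists_radical_pow_le_of_fg
    (IsNoetherian.noetherian _)
  obtain ⟨n, c, hc, hn⟩ := exists_pow_mul_le_of_mem_minimalPrimes D.mem_minimalPrimes
  refine ⟨n * k, fun r hr => D.eq_zero_of_smul_eq_zero M i
    (fun h => hc (Ideal.IsPrime.mem_of_pow_mem inferInstance k h)) _ ?_⟩
  suffices h : Ideal.span {c ^ k} * Q ^ (n * k) ≤ Ideal.torsionOf A _ x by
    rw [smul_smul]
    exact h (Ideal.mul_mem_mul (Ideal.mem_span_singleton_self _) hr)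
  refine le_trans ?_ hk
  rw [← Ideal.span_singleton_pow, pow_mul, ← mul_pow]
  refine Ideal.pow_right_mono ?_ k
  refine le_trans ?_ h1
  rw [Ideal.span_singleton_mul_le_iff]
  exact hn

theorem G_eq_zero_of_ht_lt (M : ModuleCat.{u} A) (i : ℕ) (hi : D.ht < i) (x : (D.G i).obj M) :
    x = 0 := by
  refine cechH_eq_zero_of_length_lt D.y D.rs D.mem_radical_range_y ((locF Q.primeCompl).obj M)
    (fun a => Ideal.le_radical (Ideal.mem_sup_right (Ideal.subset_span ?_))) i hi x
  exact List.get_mem _ _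

/-- The injective hull of the residue field at `Q`, as top local cohomology. -/
noncomputable abbrev E : ModuleCat.{u} A := (D.G D.ht).obj (ModuleCat.of A A)

theorem injective_E [IsNoetherianRing A] : Module.Injective A D.E :=
  injective_cechH D.y _ D.ht D.extVan
    (cechH_eq_zero_of_isWeaklyRegular D.y D.rs D.mem_radical_range_y _ D.regular.1)

theorem exists_E_ne_zero : ∃ x : D.E, x ≠ 0 :=
  exists_cechH_ne_zero D.y D.rs D.mem_radical_range_y _ D.regular
    (fun _ => Ideal.le_radical (Ideal.mem_sup_right (Ideal.subset_span (List.get_mem _ _))))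

theorem exists_E_socle [IsNoetherianRing A] : ∃ x : D.E, x ≠ 0 ∧ ∀ r ∈ Q, r • x = 0 := by
  obtain ⟨x, hx⟩ := D.exists_E_ne_zero
  have h := D.exists_pow_smul_eq_zero _ _ x
  classical
  have h0 : Nat.find h ≠ 0 := by
    intro h0
    have := Nat.find_spec h 1
    rw [h0] at this
    exact hx (by simpa using this (by simp))
  have h1 := Nat.find_min h (Nat.sub_lt (Nat.pos_of_ne_zero h0) one_pos)
  push Not at h1
  obtain ⟨s, hs, hsx⟩ := h1
  refine ⟨s • x, hsx, fun r hr => ?_⟩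
  rw [smul_smul]
  refine Nat.find_spec h _ ?_
  obtain ⟨k, hk⟩ := Nat.exists_eq_succ_of_ne_zero h0
  rw [hk] at hs ⊢
  rw [Nat.succ_eq_add_one, pow_succ']
  exact Ideal.mul_mem_mul hr hs

theorem locNoeth_E [IsNoetherianRing A] (t : ℕ) (W : Submodule A D.E)
    (hW : ∀ x ∈ W, ∀ r ∈ Q ^ t, r • x = 0) : LocNoeth Q.primeCompl W :=
  LocNoeth.of_pow_smul_eq_zero Q (fun W hW => locNoeth_of_isWeaklyRegular D.y Q.primeCompl D.rs
    D.mem_radical_range_y _ LocNoeth.localizedModule D.regular.1 W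
    fun x hx r hr => hW x hx r (D.mem r hr)) t W hW

end LocalDatum

section Duality

variable {A : Type u} [CommRing A]

theorem exists_factor {E : Type u} [AddCommGroup E] [Module A E] (hE : Module.Injective A E)
    {X Y : Type u} [AddCommGroup X] [AddCommGroup Y] [Module A X] [Module A Y] (f : X →ₗ[A] Y)
    (g : X →ₗ[A] E) (h : ∀ x, f x = 0 → g x = 0) : ∃ g' : Y →ₗ[A] E, ∀ x, g' (f x) = g x := by
  obtain ⟨g', hg'⟩ := hE.out ((LinearMap.ker f).liftQ f le_rfl)
    (LinearMap.ker_eq_bot.1 (Submodule.ker_liftQ_eq_bot' _ _ rfl))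
    ((LinearMap.ker f).liftQ g h)
  exact ⟨g', fun x => hg' (Submodule.Quotient.mk x)⟩

namespace LocalDatum

variable {Q : Ideal A} [Q.IsPrime] (D : LocalDatum Q)

/-- The duality pairing between top local cohomology and the dual module. -/
noncomputable def pairing (M : ModuleCat.{u} A) :
    (D.G D.ht).obj M →ₗ[A] (M →ₗ[A] A) →ₗ[A] D.E :=
  LinearMap.mk₂ A (fun η φ => ((D.G D.ht).map (ModuleCat.ofHom φ : M ⟶ ModuleCat.of A A)).hom η)
    (fun _ _ _ => map_add _ _ _) (fun _ _ _ => map_smul _ _ _)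
    (fun η φ ψ => D.G_map_add (ModuleCat.ofHom φ : M ⟶ ModuleCat.of A A) (ModuleCat.ofHom ψ) _ η)
    (fun r η φ => D.G_map_smul r (ModuleCat.ofHom φ : M ⟶ ModuleCat.of A A) _ η)

theorem pairing_apply {M : ModuleCat.{u} A} (η : (D.G D.ht).obj M) (φ : M →ₗ[A] A) :
    D.pairing M η φ =
      ((D.G D.ht).map (ModuleCat.ofHom φ : M ⟶ ModuleCat.of A A)).hom η := rfl

theorem pairing_map {M N : ModuleCat.{u} A} (f : M ⟶ N) (η : (D.G D.ht).obj M) (φ : N →ₗ[A] A) :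
    D.pairing N (((D.G D.ht).map f).hom η) φ = D.pairing M η (φ ∘ₗ f.hom) :=
  (D.G_map_comp f (ModuleCat.ofHom φ : N ⟶ ModuleCat.of A A) _ η).symm

theorem G_sum_proj (n i : ℕ) (x : (D.G i).obj (ModuleCat.of A (Fin n → A))) :
    x = ∑ k, ((D.G i).map (ModuleCat.ofHom (LinearMap.single A (fun _ : Fin n => A) k) :
      ModuleCat.of A A ⟶ ModuleCat.of A (Fin n → A))).hom
      (((D.G i).map (ModuleCat.ofHom (LinearMap.proj k) :
        ModuleCat.of A (Fin n → A) ⟶ ModuleCat.of A A)).hom x) := by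
  have h1 : 𝟙 (ModuleCat.of A (Fin n → A)) = ∑ k, (ModuleCat.ofHom (LinearMap.proj k) :
      ModuleCat.of A (Fin n → A) ⟶ ModuleCat.of A A) ≫ (ModuleCat.ofHom
        (LinearMap.single A (fun _ : Fin n => A) k) :
      ModuleCat.of A A ⟶ ModuleCat.of A (Fin n → A)) := by
    refine ModuleCat.hom_ext (LinearMap.ext fun z => ?_)
    rw [ModuleCat.hom_sum, LinearMap.sum_apply]
    exact (LinearMap.sum_single_apply (fun _ : Fin n => A) z).symm
  have h2 : ((D.G i).map (𝟙 (ModuleCat.of A (Fin n → A)))).hom x = x := by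
    rw [CategoryTheory.Functor.map_id]
    rfl
  conv_lhs => rw [← h2, h1, Functor.map_sum, ModuleCat.hom_sum, LinearMap.sum_apply]
  exact Finset.sum_congr rfl fun k _ => D.G_map_comp _ _ _ _

theorem G_free_eq_zero (n i : ℕ) (hi : i < D.ht)
    (x : (D.G i).obj (ModuleCat.of A (Fin n → A))) : x = 0 := by
  rw [D.G_sum_proj n i x]
  refine Finset.sum_eq_zero fun k _ => ?_
  rw [cechH_eq_zero_of_isWeaklyRegular D.y D.rs D.mem_radical_range_y
    ((locF Q.primeCompl).obj (ModuleCat.of A A)) D.regular.1 i hi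
    (((D.G i).map (ModuleCat.ofHom (LinearMap.proj k) :
        ModuleCat.of A (Fin n → A) ⟶ ModuleCat.of A A)).hom x)]
  exact map_zero _

theorem pairing_free_injective (n : ℕ) (η : (D.G D.ht).obj (ModuleCat.of A (Fin n → A)))
    (h : D.pairing _ η = 0) : η = 0 := by
  rw [D.G_sum_proj n _ η]
  refine Finset.sum_eq_zero fun k _ => ?_
  have := LinearMap.congr_fun h (LinearMap.proj k)
  exact (congrArg _ this).trans (map_zero _)

theorem pairing_free_surjective (n : ℕ) : 
    Function.Surjective (D.pairing (ModuleCat.of A (Fin n → A))) := by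
  intro ψ
  refine ⟨∑ k, ((D.G D.ht).map (ModuleCat.ofHom (LinearMap.single A (fun _ : Fin n => A) k) :
      ModuleCat.of A A ⟶ ModuleCat.of A (Fin n → A))).hom (ψ (LinearMap.proj k)), ?_⟩
  refine LinearMap.ext fun φ => ?_
  rw [map_sum, LinearMap.sum_apply]
  have h1 : φ = ∑ k, φ (Pi.single k 1) • (LinearMap.proj k : (Fin n → A) →ₗ[A] A) := by
    refine LinearMap.ext fun z => ?_
    rw [LinearMap.sum_apply]
    conv_lhs => rw [← LinearMap.sum_single_apply (fun _ : Fin n => A) z, map_sum]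
    refine Finset.sum_congr rfl fun k _ => ?_
    rw [LinearMap.smul_apply, LinearMap.proj_apply, smul_eq_mul, mul_comm, ← smul_eq_mul,
      ← map_smul]
    congr 1
    rw [← Pi.single_smul, smul_eq_mul, mul_one]
  conv_rhs => rw [h1, map_sum]
  refine Finset.sum_congr rfl fun k _ => ?_
  rw [D.pairing_map, map_smul, D.pairing_apply, ← D.G_map_smul_id]
  congr 3
  refine ModuleCat.hom_ext (LinearMap.ext fun a => ?_)
  change φ (Pi.single k a) = φ (Pi.single k 1) * a
  rw [mul_comm, ← smul_eq_mul, ← map_smul, ← Pi.single_smul, smul_eq_mul, mul_one]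

theorem exists_free_cover (M : ModuleCat.{u} A) [Module.Finite A M] :
    ∃ (n : ℕ) (π : (Fin n → A) →ₗ[A] M), Function.Surjective π :=
  Module.Finite.exists_fin' A M

theorem G_ht_map_surjective {M N : ModuleCat.{u} A} (f : M ⟶ N) (hf : Function.Surjective f.hom) :
    Function.Surjective ((D.G D.ht).map f).hom := by
  intro x
  have hS := shortCx_shortExact (LinearMap.ker f.hom).subtype f.hom
    (LinearMap.exact_subtype_ker_map f.hom) (Submodule.subtype_injective _) hf
  exact (D.Gδ_eq_zero_iff hS D.ht x).1 (D.G_eq_zero_of_ht_lt _ _ (Nat.lt_succ_self _) _)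

variable [IsNoetherianRing A]

theorem pairing_surjective (M : ModuleCat.{u} A) [Module.Finite A M] :
    Function.Surjective (D.pairing M) := by
  intro ψ
  obtain ⟨n, π, hπ⟩ := exists_free_cover M
  obtain ⟨ψ', hψ'⟩ := D.injective_E.out (LinearMap.lcomp A A π : (M →ₗ[A] A) →ₗ[A] _)
    (fun φ φ' h => LinearMap.ext fun m => by
      obtain ⟨z, rfl⟩ := hπ m
      exact LinearMap.congr_fun h z) ψ
  obtain ⟨η, rfl⟩ := D.pairing_free_surjective n ψ'
  refine ⟨((D.G D.ht).map (ModuleCat.ofHom π : ModuleCat.of A (Fin n → A) ⟶ M)).hom η, ?_⟩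
  refine LinearMap.ext fun φ => ?_
  rw [D.pairing_map, ← hψ']
  rfl

theorem pairing_injective (M : ModuleCat.{u} A) [Module.Finite A M] (η : (D.G D.ht).obj M)
    (h : D.pairing M η = 0) : η = 0 := by
  obtain ⟨n, π, hπ⟩ := exists_free_cover M
  obtain ⟨m, κ, hκ⟩ := exists_free_cover (ModuleCat.of A (LinearMap.ker π))
  let πh : ModuleCat.of A (Fin n → A) ⟶ M := ModuleCat.ofHom π
  let f : (Fin m → A) →ₗ[A] (Fin n → A) := (LinearMap.ker π).subtype ∘ₗ κ
  let fh : ModuleCat.of A (Fin m → A) ⟶ ModuleCat.of A (Fin n → A) := ModuleCat.ofHom f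
  obtain ⟨η', rfl⟩ := D.G_ht_map_surjective πh hπ η
  obtain ⟨ψ, hψ⟩ := exists_factor D.injective_E
    (LinearMap.lcomp A A f : ((Fin n → A) →ₗ[A] A) →ₗ[A] _) (D.pairing _ η') fun φ hφ => by
      have h1 : ∀ z, π z = 0 → φ z = 0 := by
        intro z hz
        obtain ⟨w, hw⟩ := hκ ⟨z, hz⟩
        have := LinearMap.congr_fun hφ w
        have h2 : f w = z := congrArg Subtype.val hw
        rw [← h2]
        exact this
      obtain ⟨φ', hφ'⟩ : ∃ φ' : M →ₗ[A] A, φ = φ' ∘ₗ π := by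
        refine ⟨(LinearMap.ker π).liftQ φ h1 ∘ₗ (π.quotKerEquivOfSurjective hπ).symm, ?_⟩
        refine LinearMap.ext fun z => ?_
        rw [LinearMap.comp_apply, LinearMap.comp_apply, LinearEquiv.coe_coe,
          (LinearEquiv.symm_apply_eq _).2 (LinearMap.quotKerEquivOfSurjective_apply_mk π hπ z).symm]
        rfl
      have := LinearMap.congr_fun h φ'
      rw [D.pairing_map] at this
      rw [hφ']
      exact this
  obtain ⟨η₁, rfl⟩ := D.pairing_free_surjective m ψ
  have h2 : η' = ((D.G D.ht).map fh).hom η₁ := by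
    rw [← sub_eq_zero]
    refine D.pairing_free_injective n _ (LinearMap.ext fun φ => ?_)
    rw [map_sub, LinearMap.sub_apply, D.pairing_map, ← hψ]
    exact sub_self _
  rw [h2, ← D.G_map_comp]
  have h3 : fh ≫ πh = 0 := ModuleCat.hom_ext (LinearMap.ext fun z => (κ z).2)
  rw [h3, D.G_map_zero]

theorem exists_smul_eq_zero (N : ModuleCat.{u} A) [Module.Finite A N]
    (h : ∀ g : N →ₗ[A] D.E, g = 0) : ∃ c : A, c ∉ Q ∧ ∀ n : N, c • n = 0 := by
  have h1 : ∀ n : N, ∃ c : A, c ∉ Q ∧ c • n = 0 := by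
    intro n
    by_contra! hn
    obtain ⟨e, he, hQe⟩ := D.exists_E_socle
    obtain ⟨g, hg⟩ := exists_factor D.injective_E (LinearMap.toSpanSingleton A N n)
      (LinearMap.toSpanSingleton A D.E e) fun r hr => hQe r (by
        by_contra hrQ
        exact hn r hrQ hr)
    have := hg 1
    rw [h g] at this
    exact he (by simpa using this.symm)
  obtain ⟨s, hs⟩ := Module.Finite.fg_top (R := A) (M := N)
  choose c hc hcn using h1
  refine ⟨∏ n ∈ s, c n, fun hp => ?_, fun n => ?_⟩
  · obtain ⟨n, -, hn⟩ := (Ideal.IsPrime.prod_mem_iff (p := Q)).1 hp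
    exact hc n hn
  · have hn : n ∈ Submodule.span A (s : Set N) := hs ▸ Submodule.mem_top
    induction hn using Submodule.span_induction with
    | mem n hn =>
      obtain ⟨b, hb⟩ := Finset.dvd_prod_of_mem c hn
      rw [hb, mul_comm, mul_smul, hcn, smul_zero]
    | zero => exact smul_zero _
    | add a b _ _ ha hb => rw [smul_add, ha, hb, add_zero]
    | smul r a _ ha => rw [smul_comm, ha, smul_zero]

end LocalDatum

end Duality

section Dual

variable {A : Type u} [CommRing A]

/-- `N` represents, at every prime `Q`, the Matlis dual of the image of the map induced by `f` on
local cohomology at `Q` in codimension `j`. -/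
def IsDual (D : ∀ (Q : Ideal A) [Q.IsPrime], LocalDatum Q) {M' M'' : ModuleCat.{u} A}
    (f : M' ⟶ M'') (j : ℕ) (N : ModuleCat.{u} A) : Prop :=
  ∀ (Q : Ideal A) [Q.IsPrime],
    (∀ i, i + j = (D Q).ht → ∃ ρ : ((D Q).G i).obj M' →ₗ[A] (N →ₗ[A] (D Q).E),
      Function.Surjective ρ ∧ ∀ x, ρ x = 0 ↔ (((D Q).G i).map f).hom x = 0) ∧
    ((D Q).ht < j → ∀ g : N →ₗ[A] (D Q).E, g = 0)

/-- A family of functionals vanishing on a submodule, as a family of functionals on the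
quotient. -/
def liftFamily {G V E : Type u} [AddCommGroup G] [Module A G] [AddCommGroup V] [Module A V]
    [AddCommGroup E] [Module A E] (C : Submodule A V) (Ψ : G →ₗ[A] V →ₗ[A] E)
    (h : ∀ x, ∀ v ∈ C, Ψ x v = 0) : G →ₗ[A] ((V ⧸ C) →ₗ[A] E) where
  toFun x := C.liftQ (Ψ x) (h x)
  map_add' x x' := by
    ext v
    exact congrArg (fun t : V →ₗ[A] E => t v) (map_add Ψ x x')
  map_smul' r x := by
    ext v
    exact congrArg (fun t : V →ₗ[A] E => t v) (map_smul Ψ r x)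

theorem liftFamily_eq_zero_iff {G V E : Type u} [AddCommGroup G] [Module A G] [AddCommGroup V]
    [Module A V] [AddCommGroup E] [Module A E] (C : Submodule A V) (Ψ : G →ₗ[A] V →ₗ[A] E)
    (h : ∀ x, ∀ v ∈ C, Ψ x v = 0) (x : G) : liftFamily C Ψ h x = 0 ↔ Ψ x = 0 := by
  constructor
  · intro hx
    ext v
    exact LinearMap.congr_fun hx (Submodule.Quotient.mk v)
  · intro hx
    ext v
    exact LinearMap.congr_fun hx v

theorem LocalDatum.exists_connecting {Q : Ideal A} [Q.IsPrime] (D : LocalDatum Q)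
    {X X' : ShortComplex (ModuleCat.{u} A)} (hX : X.ShortExact) (hX' : X'.ShortExact) (φ : X ⟶ X')
    (i k : ℕ) (hk : i + 1 = k) (h0 : ∀ x : (D.G i).obj X'.X₂, x = 0) :
    ∃ δ : (D.G i).obj X.X₃ →ₗ[A] (D.G k).obj X.X₁,
      (∀ ζ, ((D.G k).map X.f).hom ζ = 0 ↔ ∃ x, δ x = ζ) ∧
      ∀ x, ((D.G k).map φ.τ₁).hom (δ x) = 0 ↔ ((D.G i).map φ.τ₃).hom x = 0 := by
  subst hk
  refine ⟨(D.Gδ hX i).hom, fun ζ => D.G_map_f_eq_zero_iff hX i ζ, fun x => ?_⟩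
  rw [D.Gδ_naturality hX hX', D.Gδ_eq_zero_iff]
  constructor
  · rintro ⟨w, hw⟩
    rw [← hw, h0 w, map_zero]
  · intro h
    exact ⟨0, by rw [h, map_zero]⟩

variable [IsNoetherianRing A]

theorem finite_quotient_dual {M : Type u} [AddCommGroup M] [Module A M] [Module.Finite A M]
    (C : Submodule A (M →ₗ[A] A)) : Module.Finite A ((M →ₗ[A] A) ⧸ C) := by
  have : IsNoetherian A (M →ₗ[A] A) := isNoetherian_linearMap A A M
  have : Module.Finite A (M →ₗ[A] A) := Module.IsNoetherian.finite A _
  exact Module.Finite.of_surjective C.mkQ C.mkQ_surjective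

theorem exists_presentation {M' M'' : ModuleCat.{u} A} [Module.Finite A M'] [Module.Finite A M'']
    (f : M' ⟶ M'') : ∃ (n m : ℕ) (Z' Z'' : ModuleCat.{u} A)
      (ι' : Z' ⟶ ModuleCat.of A (Fin n → A)) (π' : ModuleCat.of A (Fin n → A) ⟶ M')
      (w' : ι' ≫ π' = 0) (ι'' : Z'' ⟶ ModuleCat.of A (Fin m → A))
      (π'' : ModuleCat.of A (Fin m → A) ⟶ M'') (w'' : ι'' ≫ π'' = 0)
      (φ : ShortComplex.mk ι' π' w' ⟶ ShortComplex.mk ι'' π'' w''),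
      (ShortComplex.mk ι' π' w').ShortExact ∧ (ShortComplex.mk ι'' π'' w'').ShortExact ∧
      φ.τ₃ = f ∧ Module.Finite A Z' ∧ Module.Finite A Z'' := by
  obtain ⟨n, π', hπ'⟩ := LocalDatum.exists_free_cover M'
  obtain ⟨m, π'', hπ''⟩ := LocalDatum.exists_free_cover M''
  obtain ⟨g, hg⟩ := Module.projective_lifting_property π'' (f.hom ∘ₗ π') hπ''
  have h1 := shortCx_shortExact (LinearMap.ker π').subtype π' (LinearMap.exact_subtype_ker_map π')
    (Submodule.subtype_injective _) hπ'
  have h2 := shortCx_shortExact (LinearMap.ker π'').subtype π''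
    (LinearMap.exact_subtype_ker_map π'') (Submodule.subtype_injective _) hπ''
  have hgk : ∀ x ∈ LinearMap.ker π', g x ∈ LinearMap.ker π'' := by
    intro x hx
    have := LinearMap.congr_fun hg x
    rw [LinearMap.comp_apply, LinearMap.comp_apply, LinearMap.mem_ker.1 hx, map_zero] at this
    exact this
  refine ⟨n, m, _, _, _, _, _, _, _, _, ⟨ModuleCat.ofHom (g.restrict hgk), ModuleCat.ofHom g, f,
    rfl, ModuleCat.hom_ext hg⟩, h1, h2, rfl, ?_, ?_⟩
  · exact Module.Finite.iff_fg.2 (IsNoetherian.noetherian (LinearMap.ker π'))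
  · exact Module.Finite.iff_fg.2 (IsNoetherian.noetherian (LinearMap.ker π''))

variable (D : ∀ (Q : Ideal A) [Q.IsPrime], LocalDatum Q)

theorem exists_isDual_zero {M' M'' : ModuleCat.{u} A} [Module.Finite A M'] [Module.Finite A M'']
    (f : M' ⟶ M'') : ∃ N : ModuleCat.{u} A, Module.Finite A N ∧ IsDual D f 0 N := by
  let fd : (M'' →ₗ[A] A) →ₗ[A] (M' →ₗ[A] A) := LinearMap.lcomp A A f.hom
  refine ⟨ModuleCat.of A ((M'' →ₗ[A] A) ⧸ LinearMap.ker fd), ?_, fun Q _ => ⟨?_, ?_⟩⟩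
  · exact finite_quotient_dual (LinearMap.ker fd)
  · rintro i rfl
    let Ψ : ((D Q).G (D Q).ht).obj M' →ₗ[A] (M'' →ₗ[A] A) →ₗ[A] (D Q).E :=
      (LinearMap.lcomp A (D Q).E fd) ∘ₗ (D Q).pairing M'
    have hΨ : ∀ x, ∀ v ∈ LinearMap.ker fd, Ψ x v = 0 := fun x v hv =>
      (congrArg ((D Q).pairing M' x) hv).trans (map_zero _)
    refine ⟨liftFamily (LinearMap.ker fd) Ψ hΨ, ?_, ?_⟩
    · intro g
      obtain ⟨ψ, hψ⟩ := exists_factor (D Q).injective_E fd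
        ((g : ((M'' →ₗ[A] A) ⧸ LinearMap.ker fd) →ₗ[A] (D Q).E) ∘ₗ Submodule.mkQ _) fun v hv => by
          have : Submodule.mkQ (LinearMap.ker fd) v = 0 :=
            (Submodule.Quotient.mk_eq_zero _).2 hv
          rw [LinearMap.comp_apply, this, map_zero]
      obtain ⟨η, rfl⟩ := (D Q).pairing_surjective M' ψ
      refine ⟨η, Submodule.linearMap_qext _ (LinearMap.ext fun v => hψ v)⟩
    · intro x
      rw [liftFamily_eq_zero_iff]
      constructor
      · intro hx
        refine (D Q).pairing_injective M'' _ (LinearMap.ext fun φ => ?_)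
        rw [LocalDatum.pairing_map]
        exact LinearMap.congr_fun hx φ
      · intro hx
        refine LinearMap.ext fun φ => ?_
        refine ((D Q).pairing_map f x φ).symm.trans ?_
        rw [hx, map_zero]
  · intro h
    exact absurd h (Nat.not_lt_zero _)

theorem exists_isDual_one {M' M'' : ModuleCat.{u} A} [Module.Finite A M'] [Module.Finite A M'']
    (f : M' ⟶ M'') : ∃ N : ModuleCat.{u} A, Module.Finite A N ∧ IsDual D f 1 N := by
  obtain ⟨n, m, Z', Z'', ι', π', w', ι'', π'', w'', φ, h', h'', rfl, _, _⟩ := exists_presentation f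
  let fd : (Z'' →ₗ[A] A) →ₗ[A] (Z' →ₗ[A] A) := LinearMap.lcomp A A φ.τ₁.hom
  let rd : ((Fin n → A) →ₗ[A] A) →ₗ[A] (Z' →ₗ[A] A) := LinearMap.lcomp A A ι'.hom
  let fq : (Z'' →ₗ[A] A) →ₗ[A] ((Z' →ₗ[A] A) ⧸ LinearMap.range rd) := Submodule.mkQ _ ∘ₗ fd
  have key : ∀ (Q : Ideal A) [Q.IsPrime]
      (g : ((Z'' →ₗ[A] A) ⧸ LinearMap.ker fq) →ₗ[A] (D Q).E), ∃ ζ : ((D Q).G (D Q).ht).obj Z',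
      (((D Q).G (D Q).ht).map ι').hom ζ = 0 ∧
      ∀ v, (D Q).pairing Z' ζ (fd v) = g (Submodule.Quotient.mk v) := by
    intro Q _ g
    obtain ⟨ψ, hψ⟩ := exists_factor (D Q).injective_E fq (g ∘ₗ Submodule.mkQ _) fun v hv => by
      have : Submodule.mkQ (LinearMap.ker fq) v = 0 := (Submodule.Quotient.mk_eq_zero _).2 hv
      rw [LinearMap.comp_apply, this, map_zero]
    obtain ⟨ζ, hζ⟩ := (D Q).pairing_surjective Z' (ψ ∘ₗ Submodule.mkQ _)
    refine ⟨ζ, ?_, fun v => (LinearMap.congr_fun hζ (fd v)).trans (hψ v)⟩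
    refine (D Q).pairing_free_injective n _ (LinearMap.ext fun χ => ?_)
    rw [LocalDatum.pairing_map, hζ]
    have : Submodule.mkQ (LinearMap.range rd) (χ ∘ₗ ι'.hom) = 0 :=
      (Submodule.Quotient.mk_eq_zero _).2 ⟨χ, rfl⟩
    rw [LinearMap.comp_apply, this, map_zero]
    rfl
  refine ⟨ModuleCat.of A ((Z'' →ₗ[A] A) ⧸ LinearMap.ker fq), ?_, fun Q _ => ⟨?_, ?_⟩⟩
  · exact finite_quotient_dual (LinearMap.ker fq)
  · intro i hi
    have hlt : i < (D Q).ht := by lia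
    obtain ⟨δ, hδ1, hδ2⟩ := (D Q).exists_connecting h' h'' φ i _ hi
      ((D Q).G_free_eq_zero m i hlt)
    let Ψ : ((D Q).G i).obj M' →ₗ[A] (Z'' →ₗ[A] A) →ₗ[A] (D Q).E :=
      (LinearMap.lcomp A (D Q).E fd) ∘ₗ (D Q).pairing Z' ∘ₗ δ
    have hΨ : ∀ x, ∀ v ∈ LinearMap.ker fq, Ψ x v = 0 := by
      intro x v hv
      obtain ⟨χ, hχ⟩ : fd v ∈ LinearMap.range rd := (Submodule.Quotient.mk_eq_zero _).1 hv
      change (D Q).pairing Z' (δ x) (fd v) = 0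
      rw [← hχ]
      refine ((D Q).pairing_map ι' (δ x) χ).symm.trans ?_
      rw [(hδ1 (δ x)).2 ⟨x, rfl⟩, map_zero]
      rfl
    refine ⟨liftFamily (LinearMap.ker fq) Ψ hΨ, ?_, ?_⟩
    · intro g
      obtain ⟨ζ, hζ, hζg⟩ := key Q g
      obtain ⟨x, rfl⟩ := (hδ1 ζ).1 hζ
      exact ⟨x, Submodule.linearMap_qext _ (LinearMap.ext fun v => hζg v)⟩
    · intro x
      rw [liftFamily_eq_zero_iff, ← hδ2]
      constructor
      · intro hx
        refine (D Q).pairing_injective Z'' _ (LinearMap.ext fun χ => ?_)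
        rw [LocalDatum.pairing_map]
        exact LinearMap.congr_fun hx χ
      · intro hx
        refine LinearMap.ext fun χ => ?_
        refine ((D Q).pairing_map φ.τ₁ (δ x) χ).symm.trans ?_
        rw [hx, map_zero]
  · intro h g
    obtain ⟨ζ, hζ, hζg⟩ := key Q g
    have h0 : (D Q).ht = 0 := by lia
    have hζ0 : ζ = 0 := by
      have := (D Q).G_zero_map_injective ι' h'.moduleCat_injective_f
      rw [← h0] at this
      exact this (hζ.trans (map_zero _).symm)
    refine Submodule.linearMap_qext _ (LinearMap.ext fun v => ?_)
    refine (hζg v).symm.trans ?_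
    rw [hζ0, map_zero]
    rfl

theorem exists_isDual (j : ℕ) : ∀ {M' M'' : ModuleCat.{u} A} [Module.Finite A M']
    [Module.Finite A M''] (f : M' ⟶ M''), ∃ N : ModuleCat.{u} A, Module.Finite A N ∧
      IsDual D f j N := by
  match j with
  | 0 =>
    intro _ _ _ _ f
    exact exists_isDual_zero D f
  | 1 =>
    intro _ _ _ _ f
    exact exists_isDual_one D f
  | j + 2 =>
    intro M' M'' _ _ f
    obtain ⟨n, m, Z', Z'', ι', π', w', ι'', π'', w'', φ, h', h'', rfl, _, _⟩ :=
      exists_presentation f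
    obtain ⟨N, hN, hd⟩ := exists_isDual (j + 1) φ.τ₁
    refine ⟨N, hN, fun Q _ => ⟨fun i hi => ?_, fun hlt g => ?_⟩⟩
    · obtain ⟨ρ, hρ, hρ'⟩ := (hd Q).1 (i + 1) (by lia)
      obtain ⟨δ, hδ1, hδ2⟩ := (D Q).exists_connecting h' h'' φ i _ rfl
        ((D Q).G_free_eq_zero m i (by lia))
      refine ⟨ρ ∘ₗ δ, ?_, fun x => ?_⟩
      · intro g
        obtain ⟨ζ, rfl⟩ := hρ g
        obtain ⟨x, rfl⟩ := (hδ1 ζ).1 ((D Q).G_free_eq_zero n (i + 1) (by lia) _)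
        exact ⟨x, rfl⟩
      · rw [LinearMap.comp_apply, hρ', hδ2]
    · by_cases hlt' : (D Q).ht < j + 1
      · exact (hd Q).2 hlt' g
      · obtain ⟨ρ, hρ, -⟩ := (hd Q).1 0 (by lia)
        obtain ⟨ζ, rfl⟩ := hρ g
        have : ζ = 0 := by
          refine (D Q).G_zero_map_injective ι' h'.moduleCat_injective_f ?_
          rw [map_zero]
          exact (D Q).G_free_eq_zero n 0 (by lia) _
        rw [this, map_zero]

end Dual

section Heights

variable {A : Type u} [CommRing A]

namespace LocalDatum

variable {Q : Ideal A} [Q.IsPrime] (D : LocalDatum Q)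

theorem exists_G_zero_ne_zero (M : ModuleCat.{u} A) (m : M) (h1 : ∀ c, c ∉ Q → c • m ≠ 0)
    (h2 : ∀ r ∈ Q, r • m = 0) : ∃ x : (D.G 0).obj M, x ≠ 0 := by
  let m' : (locF Q.primeCompl).obj M := LocalizedModule.mk m 1
  have hm' : ∀ r ∈ Q, r • m' = 0 := fun r hr => by
    refine (LocalizedModule.smul'_mk r m (1 : Q.primeCompl)).trans ?_
    rw [h2 r hr]
    exact LocalizedModule.zero_mk 1
  have hd : ((cechD D.y 0).app ((locF Q.primeCompl).obj M)).hom m' = 0 := by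
    refine funext fun a => ?_
    change LocalizedModule.mk m' 1 = 0
    rw [← LocalizedModule.zero_mk 1, LocalizedModule.mk_eq]
    refine ⟨⟨D.y a, 1, pow_one _⟩, ?_⟩
    rw [one_smul, one_smul, smul_zero]
    exact hm' _ (D.y_mem a)
  refine ⟨cechClass D.y _ 0 ⟨m', hd⟩, fun h0 => ?_⟩
  have h3 : (LocalizedModule.mk m 1 : LocalizedModule Q.primeCompl M) = LocalizedModule.mk 0 1 :=
    (congrArg Subtype.val ((cechClass_zero_eq_zero_iff D.y _ _).1 h0)).trans
      (LocalizedModule.zero_mk 1).symm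
  obtain ⟨c, hc⟩ := LocalizedModule.mk_eq.1 h3
  rw [one_smul, one_smul, smul_zero] at hc
  exact h1 c c.2 hc

theorem G_zero_eq_zero [IsNoetherianRing A] (M : ModuleCat.{u} A) (r : A) (hr : r ∈ Q)
    (hM : IsSMulRegular M r) (x : (D.G 0).obj M) : x = 0 := by
  obtain ⟨N, hN⟩ := D.exists_pow_smul_eq_zero M 0 x
  have h1 : ∀ n : ℕ, r ^ n • x = 0 → x = 0 := by
    intro n
    induction n with
    | zero => intro h; rwa [pow_zero, one_smul] at h
    | succ n ih =>
      intro h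
      refine ih ?_
      have := D.G_zero_map_injective (r • 𝟙 M) hM
      refine this ?_
      rw [map_zero, G_map_smul_id, smul_smul, ← pow_succ', h]
  exact h1 N (hN _ (Ideal.pow_mem_pow hr N))

end LocalDatum

theorem annihilator_le_localizedModule (S : Submonoid A) (M : Type u) [AddCommGroup M]
    [Module A M] : Module.annihilator A M ≤ Module.annihilator A (LocalizedModule S M) := by
  intro r hr
  rw [Module.mem_annihilator] at hr ⊢
  intro w
  induction w using LocalizedModule.induction_on with
  | h m s => rw [LocalizedModule.smul'_mk, hr, LocalizedModule.zero_mk]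

theorem LocalDatum.G_eq_zero_of_length_lt [IsLocalRing A] (D : LocalDatum (maximalIdeal A))
    (M : ModuleCat.{u} A) (zs : List A)
    (h : maximalIdeal A ≤ (Module.annihilator A M ⊔ Ideal.ofList zs).radical)
    (hzs : ∀ z ∈ zs, z ∈ maximalIdeal A)
    (i : ℕ) (hi : zs.length < i) (x : (D.G i).obj M) : x = 0 := by
  have hrad : maximalIdeal A ≤ (Ideal.span (Set.range D.y)).radical := by
    rw [Ideal.radical_eq_sInf]
    refine le_sInf fun Q' ⟨hQ', hp⟩ => ?_
    exact D.mem_minimalPrimes.2 ⟨hp, hQ'⟩ (IsLocalRing.le_maximalIdeal hp.ne_top)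
  refine cechH_eq_zero_of_length_lt D.y zs (fun z hz => hrad (hzs z hz))
    ((locF (maximalIdeal A).primeCompl).obj M) (fun a => ?_) i hi x
  exact Ideal.radical_mono (sup_le_sup_right (annihilator_le_localizedModule _ M) _)
    (h (D.y_mem a))

variable [IsNoetherianRing A] (D : ∀ (Q : Ideal A) [Q.IsPrime], LocalDatum Q)

theorem ht_le_and_exists_ne_zero {Q₀ Q₁ : Ideal A} [Q₀.IsPrime] [Q₁.IsPrime] (h : Q₀ ≤ Q₁) :
    (D Q₀).ht ≤ (D Q₁).ht ∧
      ∃ x : ((D Q₁).G ((D Q₁).ht - (D Q₀).ht)).obj (ModuleCat.of A (A ⧸ Q₀)), x ≠ 0 := by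
  obtain ⟨N, _, hN⟩ := exists_isDual D (D Q₀).ht (𝟙 (ModuleCat.of A (A ⧸ Q₀)))
  have h0 : ∃ g : N →ₗ[A] (D Q₀).E, g ≠ 0 := by
    obtain ⟨ρ, -, hρ⟩ := (hN Q₀).1 0 (zero_add _)
    obtain ⟨x, hx⟩ := (D Q₀).exists_G_zero_ne_zero (ModuleCat.of A (A ⧸ Q₀))
      (Ideal.Quotient.mk Q₀ 1) (fun c hc h0 => hc (by
        change Ideal.Quotient.mk Q₀ (c * 1) = 0 at h0
        rwa [mul_one, Ideal.Quotient.eq_zero_iff_mem] at h0)) (fun r hr => by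
        change Ideal.Quotient.mk Q₀ (r * 1) = 0
        rwa [mul_one, Ideal.Quotient.eq_zero_iff_mem])
    refine ⟨ρ x, fun h0 => hx ?_⟩
    have := (hρ x).1 h0
    rwa [CategoryTheory.Functor.map_id] at this
  have h1 : ∃ g : N →ₗ[A] (D Q₁).E, g ≠ 0 := by
    by_contra! hcon
    obtain ⟨c, hc, hcN⟩ := (D Q₁).exists_smul_eq_zero N hcon
    obtain ⟨g, hg⟩ := h0
    refine hg (LinearMap.ext fun n => ?_)
    refine (D Q₀).eq_zero_of_smul_eq_zero _ _ (fun h' => hc (h h')) _ ?_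
    rw [← map_smul, hcN, map_zero]
  have hle : (D Q₀).ht ≤ (D Q₁).ht := by
    by_contra! hlt
    obtain ⟨g, hg⟩ := h1
    exact hg ((hN Q₁).2 hlt g)
  refine ⟨hle, ?_⟩
  obtain ⟨ρ, hρ, -⟩ := (hN Q₁).1 ((D Q₁).ht - (D Q₀).ht) (by lia)
  obtain ⟨g, hg⟩ := h1
  obtain ⟨x, rfl⟩ := hρ g
  exact ⟨x, fun h => hg (by rw [h, map_zero])⟩

theorem ht_lt_ht {Q₀ Q₁ : Ideal A} [Q₀.IsPrime] [Q₁.IsPrime] (h : Q₀ < Q₁) :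
    (D Q₀).ht < (D Q₁).ht := by
  obtain ⟨h1, x, hx⟩ := ht_le_and_exists_ne_zero D h.le
  refine lt_of_le_of_ne h1 fun he => hx ?_
  obtain ⟨r, hr, hr'⟩ := Set.exists_of_ssubset h
  have hz : (D Q₁).ht - (D Q₀).ht = 0 := by lia
  revert x
  rw [hz]
  intro x _
  refine (D Q₁).G_zero_eq_zero _ r hr ?_ x
  intro a b hab
  obtain ⟨a, rfl⟩ := Ideal.Quotient.mk_surjective a
  obtain ⟨b, rfl⟩ := Ideal.Quotient.mk_surjective b
  change Ideal.Quotient.mk Q₀ (r * a) = Ideal.Quotient.mk Q₀ (r * b) at hab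
  rw [Ideal.Quotient.eq, ← mul_sub] at hab
  exact Ideal.Quotient.eq.2 ((Ideal.IsPrime.mem_or_mem inferInstance hab).resolve_left hr')

theorem ht_maximalIdeal_le [IsLocalRing A] (Q : Ideal A) [Q.IsPrime] (zs : List A)
    (hzs : ∀ z ∈ zs, z ∈ maximalIdeal A)
    (h : maximalIdeal A ≤ (Q ⊔ Ideal.ofList zs).radical) :
    (D (maximalIdeal A)).ht ≤ (D Q).ht + zs.length := by
  obtain ⟨h1, x, hx⟩ := ht_le_and_exists_ne_zero D
    (IsLocalRing.le_maximalIdeal (Ideal.IsPrime.ne_top (I := Q) inferInstance))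
  by_contra! hlt
  refine hx ((D (maximalIdeal A)).G_eq_zero_of_length_lt _ zs ?_ hzs _ (by lia) x)
  exact h.trans (Ideal.radical_mono (sup_le_sup_right (Ideal.annihilator_quotient (I := Q)).ge _))

theorem ht_add_length_le (P : Ideal A) [P.IsPrime] {Q : Ideal A} [Q.IsPrime]
    (l : LTSeries (PrimeSpectrum A)) (h0 : P ≤ l.head.asIdeal) (h1 : l.last.asIdeal ≤ Q) :
    (D P).ht + l.length ≤ (D Q).ht := by
  have h2 : ∀ i : Fin (l.length + 1), (D P).ht + i ≤ (D (l i).asIdeal).ht := by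
    intro i
    induction i using Fin.induction with
    | zero => exact (ht_le_and_exists_ne_zero D h0).1
    | succ i ih =>
      have := ht_lt_ht D (PrimeSpectrum.asIdeal_lt_asIdeal _ _ |>.2 (l.step i))
      simp only [Fin.val_castSucc, Fin.val_succ] at ih ⊢
      lia
  exact (h2 (Fin.last _)).trans (ht_le_and_exists_ne_zero D h1).1

end Heights

section Frobenius

variable (A : Type u) [CommRing A] (p : ℕ)

/-- An additive endomorphism of a module that is semilinear for the `p`-th power map. -/
structure Frob (X : Type u) [AddCommGroup X] [Module A X] where
  f : X →+ X
  smul : ∀ (a : A) (x : X), f (a • x) = a ^ p • f x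

variable {A p}

namespace Frob

variable {X Y : Type u} [AddCommGroup X] [Module A X] [AddCommGroup Y] [Module A Y]

theorem iterate_smul (F : Frob A p X) (k : ℕ) (a : A) (x : X) :
    F.f^[k] (a • x) = a ^ p ^ k • F.f^[k] x := by
  induction k with
  | zero => rw [pow_zero, pow_one]; rfl
  | succ k ih =>
    rw [Function.iterate_succ_apply', ih, F.smul, Function.iterate_succ_apply', ← pow_mul,
      pow_succ]

theorem iterate_comm {F : Frob A p X} {F' : Frob A p Y} {g : X →ₗ[A] Y}
    (h : ∀ x, g (F.f x) = F'.f (g x)) (k : ℕ) (x : X) : g (F.f^[k] x) = F'.f^[k] (g x) :=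
  (Function.Semiconj.iterate_right h k) x

theorem iterate_sub (F : Frob A p X) (k : ℕ) (x y : X) :
    F.f^[k] (x - y) = F.f^[k] x - F.f^[k] y := iterate_map_sub F.f k x y

/-- The extension of a Frobenius action to a localization. -/
noncomputable def loc (F : Frob A p X) (S : Submonoid A) : Frob A p (LocalizedModule S X) where
  f :=
    { toFun := fun x => x.liftOn (fun m => LocalizedModule.mk (F.f m.1) (m.2 ^ p)) (by
        rintro ⟨m, s⟩ ⟨m', s'⟩ ⟨u, hu⟩
        refine LocalizedModule.mk_eq.2 ⟨u ^ p, ?_⟩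
        have := congrArg F.f hu
        simp only [Submonoid.smul_def, F.smul] at this
        exact this)
      map_zero' := by
        rw [← LocalizedModule.zero_mk 1, LocalizedModule.liftOn_mk, map_zero,
          LocalizedModule.zero_mk, LocalizedModule.zero_mk]
      map_add' := fun x x' => by
        induction x using LocalizedModule.induction_on with | h m s => ?_
        induction x' using LocalizedModule.induction_on with | h m' s' => ?_
        rw [LocalizedModule.mk_add_mk, LocalizedModule.liftOn_mk, LocalizedModule.liftOn_mk,
          LocalizedModule.liftOn_mk, LocalizedModule.mk_add_mk, map_add]
        simp only [Submonoid.smul_def, F.smul, mul_pow]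
        rfl }
  smul a x := by
    induction x using LocalizedModule.induction_on with | h m s => ?_
    rw [LocalizedModule.smul'_mk]
    change LocalizedModule.mk (F.f (a • m)) (s ^ p) = a ^ p • LocalizedModule.mk (F.f m) (s ^ p)
    rw [F.smul, LocalizedModule.smul'_mk]

theorem loc_mk (F : Frob A p X) (S : Submonoid A) (m : X) (s : S) :
    (F.loc S).f (LocalizedModule.mk m s) = LocalizedModule.mk (F.f m) (s ^ p) := rfl

theorem loc_iterate_mk (F : Frob A p X) (S : Submonoid A) (k : ℕ) (m : X) (s : S) :
    (F.loc S).f^[k] (LocalizedModule.mk m s) = LocalizedModule.mk (F.f^[k] m) (s ^ p ^ k) := by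
  induction k with
  | zero => rw [pow_zero, pow_one]; rfl
  | succ k ih =>
    rw [Function.iterate_succ_apply', ih, loc_mk, Function.iterate_succ_apply', ← pow_mul,
      pow_succ]

theorem loc_comm {F : Frob A p X} {F' : Frob A p Y} {g : X →ₗ[A] Y}
    (h : ∀ x, g (F.f x) = F'.f (g x)) (S : Submonoid A) (x : LocalizedModule S X) :
    IsLocalizedModule.map S (LocalizedModule.mkLinearMap S X) (LocalizedModule.mkLinearMap S Y) g
      ((F.loc S).f x) = (F'.loc S).f (IsLocalizedModule.map S (LocalizedModule.mkLinearMap S X)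
        (LocalizedModule.mkLinearMap S Y) g x) := by
  induction x using LocalizedModule.induction_on with | h m s => ?_
  rw [loc_mk, map_mk, map_mk, loc_mk, h]

/-- Artin–Schreier type equations are solvable. -/
def Solvable (F : Frob A p X) : Prop :=
  ∀ (e : ℕ) (c : ℕ → A) (w : X), 0 < e →
    ∃ x, F.f^[e] x = (∑ k ∈ Finset.range e, c k • F.f^[k] x) + w

/-- Solutions of Artin–Schreier type equations with denominator `t` are integral. -/
def Closed (F : Frob A p X) (t : A) : Prop :=
  ∀ (e : ℕ) (c : ℕ → A) (x : X),
    F.f^[e] x = ∑ k ∈ Finset.range e, (c k * t ^ (p ^ e - p ^ k)) • F.f^[k] x → ∃ u, x = t • u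

theorem pow_mul_pow_sub (hp : 0 < p) (s : A) {e k : ℕ} (hk : k < e) :
    s ^ (p ^ e - p ^ k) * s ^ p ^ k = s ^ p ^ e := by
  rw [← pow_add, Nat.sub_add_cancel (Nat.pow_le_pow_right hp hk.le)]

theorem sum_mk {S : Submonoid A} (F : Frob A p X) (hp : 0 < p) (e : ℕ) (c : ℕ → A)
    (x : X) (s : S) :
    ∑ k ∈ Finset.range e, c k • (F.loc S).f^[k] (LocalizedModule.mk x s) =
      LocalizedModule.mk (∑ k ∈ Finset.range e, (c k * (s : A) ^ (p ^ e - p ^ k)) • F.f^[k] x)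
        (s ^ p ^ e) := by
  have h : ∀ (t : S) (g : ℕ → X), LocalizedModule.mk (∑ k ∈ Finset.range e, g k) t =
      ∑ k ∈ Finset.range e, LocalizedModule.mk (g k) t := by
    intro t g
    induction e with
    | zero => exact LocalizedModule.zero_mk t
    | succ e ih =>
      rw [Finset.sum_range_succ, Finset.sum_range_succ, ← ih, IsLocalizedModule.mk_eq_mk',
        IsLocalizedModule.mk_eq_mk', IsLocalizedModule.mk_eq_mk', IsLocalizedModule.mk'_add]
  rw [h]
  refine Finset.sum_congr rfl fun k hk => ?_
  rw [loc_iterate_mk, LocalizedModule.smul'_mk, LocalizedModule.mk_eq]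
  refine ⟨1, ?_⟩
  simp only [Submonoid.smul_def, one_smul, smul_smul, SubmonoidClass.coe_pow]
  congr 1
  rw [← pow_mul_pow_sub hp (s : A) (Finset.mem_range.1 hk)]
  ring

theorem Solvable.loc {F : Frob A p X} (hF : F.Solvable) (hp : 0 < p) (S : Submonoid A) :
    (F.loc S).Solvable := by
  intro e c w he
  induction w using LocalizedModule.induction_on with | h m s => ?_
  obtain ⟨x, hx⟩ := hF e (fun k => c k * (s : A) ^ (p ^ e - p ^ k))
    ((s : A) ^ (p ^ e - 1) • m) he
  refine ⟨LocalizedModule.mk x s, ?_⟩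
  rw [loc_iterate_mk, sum_mk F hp, hx, LocalizedModule.mk_add_mk, LocalizedModule.mk_eq]
  refine ⟨1, ?_⟩
  have : (s : A) ^ p ^ e = (s : A) ^ (p ^ e - 1) * s := by
    rw [← pow_succ, Nat.sub_add_cancel (Nat.pow_pos hp)]
  simp only [Submonoid.smul_def, one_smul, smul_smul, SubmonoidClass.coe_pow, Submonoid.coe_mul,
    smul_add]
  congr 2
  rw [this]
  ring

theorem Closed.loc {F : Frob A p X} {t : A} (hF : F.Closed t) (hp : 0 < p) (S : Submonoid A) :
    (F.loc S).Closed t := by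
  intro e c x hx
  induction x using LocalizedModule.induction_on with | h m s => ?_
  rw [loc_iterate_mk, sum_mk F hp, LocalizedModule.mk_eq] at hx
  obtain ⟨v, hv⟩ := hx
  simp only [Submonoid.smul_def] at hv
  rw [smul_smul, smul_smul] at hv
  obtain ⟨u, hu⟩ := hF e (fun k => c k * (s : A) ^ (p ^ e - p ^ k) *
      ((v * s ^ p ^ e : S) : A) ^ (p ^ e - p ^ k)) (((v * s ^ p ^ e : S) : A) • m) (by
    have h2 : ∀ b : A, b ^ p ^ e = b ^ (p ^ e - 1) * b := fun b => by
      rw [← pow_succ, Nat.sub_add_cancel (Nat.pow_pos hp)]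
    rw [iterate_smul, h2, mul_smul, Submonoid.coe_mul, hv, smul_smul, SubmonoidClass.coe_pow,
      Finset.smul_sum]
    refine Finset.sum_congr rfl fun k hk => ?_
    have h1 : ((v : A) * (s : A) ^ p ^ e) ^ (p ^ e - 1) * ((v : A) * (s : A) ^ p ^ e) =
        ((v : A) * (s : A) ^ p ^ e) ^ (p ^ e - p ^ k) * ((v : A) * (s : A) ^ p ^ e) ^ p ^ k := by
      rw [pow_mul_pow_sub hp _ (Finset.mem_range.1 hk), ← pow_succ,
        Nat.sub_add_cancel (Nat.pow_pos hp)]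
    rw [iterate_smul, smul_smul, smul_smul, h1]
    congr 1
    ring)
  refine ⟨LocalizedModule.mk u (v * s ^ p ^ e * s), ?_⟩
  rw [LocalizedModule.smul'_mk, ← hu, LocalizedModule.mk_eq]
  refine ⟨1, ?_⟩
  simp only [Submonoid.smul_def, one_smul, smul_smul, Submonoid.coe_mul]
  congr 1
  ring

variable {ι : Type} (y : ι → A)

/-- The extension of a Frobenius action to a product of localizations. -/
noncomputable def locProd (F : Frob A p X) : Frob A p (LocProd y X) where
  f :=
    { toFun := fun x a => (F.loc (pw y a)).f (x a)
      map_zero' := funext fun a => map_zero (F.loc (pw y a)).f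
      map_add' := fun x x' => funext fun a => map_add (F.loc (pw y a)).f (x a) (x' a) }
  smul c x := funext fun a => (F.loc (pw y a)).smul c (x a)

theorem locProd_iterate (F : Frob A p X) (k : ℕ) (x : LocProd y X) (a : ι) :
    (F.locProd y).f^[k] x a = (F.loc (pw y a)).f^[k] (x a) := by
  induction k with
  | zero => rfl
  | succ k ih =>
    rw [Function.iterate_succ_apply', Function.iterate_succ_apply', ← ih]
    rfl

theorem locProd_comm {F : Frob A p X} {F' : Frob A p Y} {g : X →ₗ[A] Y}
    (h : ∀ x, g (F.f x) = F'.f (g x)) (x : LocProd y X) :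
    LocProd.map y g ((F.locProd y).f x) = (F'.locProd y).f (LocProd.map y g x) :=
  funext fun a => loc_comm h (pw y a) (x a)

theorem locProd_diag (F : Frob A p X) (x : X) :
    LocProd.diag y X (F.f x) = (F.locProd y).f (LocProd.diag y X x) := by
  refine funext fun a => ?_
  change LocalizedModule.mk (F.f x) 1 = (F.loc (pw y a)).f (LocalizedModule.mk x 1)
  rw [loc_mk, one_pow]

theorem Solvable.locProd {F : Frob A p X} (hF : F.Solvable) (hp : 0 < p) :
    (F.locProd y).Solvable := by
  intro e c w he
  choose x hx using fun a => hF.loc hp (pw y a) e c (w a) he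
  refine ⟨x, funext fun a => ?_⟩
  rw [locProd_iterate, hx]
  change _ = (∑ k ∈ Finset.range e, c k • (F.locProd y).f^[k] x) a + w a
  rw [Finset.sum_apply]
  congr 1
  refine Finset.sum_congr rfl fun k _ => ?_
  rw [Pi.smul_apply, locProd_iterate]

theorem apply_eq {F : Frob A p X} {e : ℕ} {c : ℕ → A} {x : LocProd y X}
    (hx : (F.locProd y).f^[e] x = ∑ k ∈ Finset.range e, c k • (F.locProd y).f^[k] x) (a : ι) :
    (F.loc (pw y a)).f^[e] (x a) =
      ∑ k ∈ Finset.range e, c k • (F.loc (pw y a)).f^[k] (x a) := by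
  rw [← locProd_iterate, hx, Finset.sum_apply]
  refine Finset.sum_congr rfl fun k _ => ?_
  rw [Pi.smul_apply, locProd_iterate]

theorem Closed.locProd {F : Frob A p X} {t : A} (hF : F.Closed t) (hp : 0 < p) :
    (F.locProd y).Closed t := by
  intro e c x hx
  choose u hu using fun a => hF.loc hp (pw y a) e c (x a) (apply_eq y hx a)
  exact ⟨u, funext hu⟩

/-- The Frobenius action on the terms of the Čech complex. -/
noncomputable def cech {M : ModuleCat.{u} A} (F : Frob A p M) :
    ∀ i, Frob A p ((cechFunctor y i).obj M)
  | 0 => F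
  | i + 1 => (cech F i).locProd y

theorem cech_map_comm {M N : ModuleCat.{u} A} {F : Frob A p M} {F' : Frob A p N} {g : M ⟶ N}
    (h : ∀ x, g.hom (F.f x) = F'.f (g.hom x)) : ∀ (i : ℕ) (x : (cechFunctor y i).obj M),
    ((cechFunctor y i).map g).hom ((F.cech y i).f x) =
      (F'.cech y i).f (((cechFunctor y i).map g).hom x)
  | 0, x => h x
  | i + 1, x => locProd_comm y (cech_map_comm h i) x

theorem cechD_comm {M : ModuleCat.{u} A} (F : Frob A p M) :
    ∀ (i : ℕ) (x : (cechFunctor y i).obj M),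
    ((cechD y i).app M).hom ((F.cech y i).f x) =
      (F.cech y (i + 1)).f (((cechD y i).app M).hom x)
  | 0, x => locProd_diag y F x
  | i + 1, x => by
    change LocProd.diag y _ ((F.cech y (i + 1)).f x) -
      LocProd.map y ((cechD y i).app M).hom ((F.cech y (i + 1)).f x) =
      (F.cech y (i + 2)).f (LocProd.diag y _ x - LocProd.map y ((cechD y i).app M).hom x)
    refine Eq.trans ?_ (map_sub (F.cech y (i + 2)).f (LocProd.diag y _ x)
      (LocProd.map y ((cechD y i).app M).hom x)).symm
    exact congrArg₂ (· - ·) (locProd_diag y (F.cech y (i + 1)) x)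
      (locProd_comm y (cechD_comm F i) x)

theorem Solvable.cech {M : ModuleCat.{u} A} {F : Frob A p M} (hF : F.Solvable) (hp : 0 < p) :
    ∀ i, (F.cech y i).Solvable
  | 0 => hF
  | i + 1 => (hF.cech hp i).locProd y hp

theorem Closed.cech {M : ModuleCat.{u} A} {F : Frob A p M} {t : A} (hF : F.Closed t)
    (hp : 0 < p) : ∀ i, (F.cech y i).Closed t
  | 0 => hF
  | i + 1 => (hF.cech hp i).locProd y hp

/-- A cocycle in positive degree that satisfies a monic Frobenius equation up to a coboundary is
itself a coboundary. -/
theorem exists_cechD_eq {M : ModuleCat.{u} A} {F : Frob A p M} (hp : 0 < p) (hF : F.Solvable)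
    (a : ι) (hC : ∀ n : ℕ, F.Closed (y a ^ n)) (hy : IsSMulRegular M (y a)) (i : ℕ)
    (z : (cechFunctor y (i + 1)).obj M) (hz : ((cechD y (i + 1)).app M).hom z = 0)
    (e : ℕ) (he : 0 < e) (c : ℕ → A) (w : (cechFunctor y i).obj M)
    (hw : (F.cech y (i + 1)).f^[e] z = (∑ k ∈ Finset.range e, c k • (F.cech y (i + 1)).f^[k] z) +
      ((cechD y i).app M).hom w) :
    ∃ v, ((cechD y i).app M).hom v = z := by
  have hreg : ∀ j, IsSMulRegular ((cechFunctor y j).obj M) (y a) := by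
    intro j
    have h1 := cechFunctor_map_injective y (y a • 𝟙 M) hy j
    have h2 : (cechFunctor y j).map (y a • 𝟙 M) = y a • 𝟙 _ := by
      rw [Functor.map_smul, CategoryTheory.Functor.map_id]
    rw [h2] at h1
    exact h1
  obtain ⟨t, ht⟩ := hF.cech y hp i e c w he
  obtain ⟨z', hz'⟩ : ∃ z', z' = z - ((cechD y i).app M).hom t := ⟨_, rfl⟩
  have hd : ((cechD y (i + 1)).app M).hom z' = 0 := by
    have h0 := LinearMap.congr_fun (congrArg ModuleCat.Hom.hom
      (congrArg (fun n => NatTrans.app n M) (cechD_comp y i))) t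
    rw [hz', map_sub, hz]
    exact (congrArg (0 - ·) h0).trans (sub_self 0)
  have hg : (F.cech y (i + 1)).f^[e] z' =
      ∑ k ∈ Finset.range e, c k • (F.cech y (i + 1)).f^[k] z' := by
    have h1 : ∀ k, (F.cech y (i + 1)).f^[k] z' = (F.cech y (i + 1)).f^[k] z -
        ((cechD y i).app M).hom ((F.cech y i).f^[k] t) := by
      intro k
      rw [hz', iterate_sub, iterate_comm (cechD_comm y F i)]
    rw [h1, hw, ht, map_add, map_sum]
    simp only [h1, smul_sub, Finset.sum_sub_distrib, map_smul]
    abel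
  obtain ⟨u, hu⟩ : ∃ u : (cechFunctor y i).obj M,
      (z' : LocProd y ((cechFunctor y i).obj M)) a = LocalizedModule.mk u 1 := by
    have h1 := apply_eq y hg a
    generalize (z' : LocProd y ((cechFunctor y i).obj M)) a = ζ at h1
    induction ζ using LocalizedModule.induction_on with | h m s => ?_
    obtain ⟨s, n, rfl⟩ := s
    rw [loc_iterate_mk, sum_mk _ hp, LocalizedModule.mk_eq] at h1
    obtain ⟨⟨_, n', rfl⟩, h2⟩ := h1
    simp only [Submonoid.smul_def, smul_smul, SubmonoidClass.coe_pow] at h2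
    obtain ⟨u, hu⟩ := (hC n).cech y hp i e c m (((((hreg i).pow n').mul
      (((hreg i).pow n).pow (p ^ e))) h2))
    refine ⟨u, ?_⟩
    rw [hu, LocalizedModule.mk_eq]
    exact ⟨1, by rw [one_smul, one_smul, one_smul]; rfl⟩
  have hfin : z' = ((cechD y i).app M).hom u := by
    have h1 : LocalizedModule.mk z' 1 - IsLocalizedModule.map (pw y a)
        (LocalizedModule.mkLinearMap (pw y a) _) (LocalizedModule.mkLinearMap (pw y a) _)
        ((cechD y i).app M).hom ((z' : LocProd y ((cechFunctor y i).obj M)) a) = 0 :=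
      congrFun hd a
    rw [hu, map_mk, sub_eq_zero, LocalizedModule.mk_eq] at h1
    obtain ⟨⟨_, n', rfl⟩, h2⟩ := h1
    rw [one_smul, one_smul] at h2
    exact (hreg (i + 1)).pow n' h2
  refine ⟨u + t, ?_⟩
  rw [map_add, ← hfin, hz', sub_add_cancel]

end Frob

end Frobenius

section Subalgebras

variable {A : Type u} [CommRing A] {B : Type u} [CommRing B] [Algebra A B]

/-- The Frobenius action on an algebra of characteristic `p`. -/
noncomputable def frobSelf (A : Type u) [CommRing A] (p : ℕ) [Fact p.Prime] (C : Type u)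
    [CommRing C] [CharP C p] [Algebra A C] : Frob A p C where
  f := (frobenius C p).toAddMonoidHom
  smul a x := by
    change (a • x) ^ p = a ^ p • x ^ p
    rw [smul_pow]

/-- A subalgebra, as an object of the category of modules. -/
abbrev subObj (C : Subalgebra A B) : ModuleCat.{u} A := ModuleCat.of A C

/-- The inclusion of subalgebras. -/
noncomputable def incl {C C' : Subalgebra A B} (h : C ≤ C') : subObj C ⟶ subObj C' :=
  ModuleCat.ofHom (Subalgebra.inclusion h).toLinearMap

/-- The inclusion of a subalgebra. -/
noncomputable def inclTop (C : Subalgebra A B) : subObj C ⟶ ModuleCat.of A B :=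
  ModuleCat.ofHom C.val.toLinearMap

theorem incl_inclTop {C C' : Subalgebra A B} (h : C ≤ C') : incl h ≫ inclTop C' = inclTop C := rfl

theorem incl_incl {C C' C'' : Subalgebra A B} (h : C ≤ C') (h' : C' ≤ C'') :
    incl h ≫ incl h' = incl (h.trans h') := rfl

theorem inclTop_injective (C : Subalgebra A B) : Function.Injective (inclTop C).hom :=
  Subtype.val_injective

variable (A B) in
/-- The elements of the value of a functor at `B` come from its values at finite subalgebras. -/
def Finitary (Φ : ModuleCat.{u} A ⥤ ModuleCat.{u} A) : Prop :=
  ∀ (C : Subalgebra A B), C.toSubmodule.FG → ∀ x : Φ.obj (ModuleCat.of A B),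
    ∃ C' : Subalgebra A B, C ≤ C' ∧ C'.toSubmodule.FG ∧
      ∃ x' : Φ.obj (subObj C'), (Φ.map (inclTop C')).hom x' = x

theorem fg_sup {C C' : Subalgebra A B} (h : C.toSubmodule.FG) (h' : C'.toSubmodule.FG) :
    (C ⊔ C').toSubmodule.FG := by
  rw [← Subalgebra.mul_toSubmodule]
  exact h.mul h'

theorem exists_subalgebra_ge_of_fintype {ι : Type} [Finite ι]
    (T : ι → Subalgebra A B → Prop)
    (hT : ∀ a C C', C ≤ C' → T a C → T a C')
    (h : ∀ a (C : Subalgebra A B), C.toSubmodule.FG → ∃ C' ≥ C, C'.toSubmodule.FG ∧ T a C')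
    (C : Subalgebra A B) (hC : C.toSubmodule.FG) :
    ∃ C' ≥ C, C'.toSubmodule.FG ∧ ∀ a, T a C' := by
  classical
  have := Fintype.ofFinite ι
  have key : ∀ s : Finset ι, ∃ C' ≥ C, C'.toSubmodule.FG ∧ ∀ a ∈ s, T a C' := by
    intro s
    induction s using Finset.induction_on with
    | empty => exact ⟨C, le_rfl, hC, by simp⟩
    | insert a s _ ih =>
      obtain ⟨C₁, h1, h2, h3⟩ := ih
      obtain ⟨C₂, h4, h5, h6⟩ := h a C₁ h2
      refine ⟨C₂, h1.trans h4, h5, fun b hb => ?_⟩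
      rcases Finset.mem_insert.1 hb with rfl | hb
      · exact h6
      · exact hT b C₁ C₂ h4 (h3 b hb)
  obtain ⟨C', h1, h2, h3⟩ := key Finset.univ
  exact ⟨C', h1, h2, fun a => h3 a (Finset.mem_univ a)⟩

variable {Φ : ModuleCat.{u} A ⥤ ModuleCat.{u} A}

theorem finitary_id [Algebra.IsIntegral A B] : Finitary A B (𝟭 (ModuleCat.{u} A)) := by
  intro C hC x
  have hx : IsIntegral A (show B from x) := Algebra.IsIntegral.isIntegral _
  exact ⟨C ⊔ Algebra.adjoin A {show B from x}, le_sup_left, fg_sup hC hx.fg_adjoin_singleton,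
    ⟨x, le_sup_right (a := C) (Algebra.subset_adjoin rfl)⟩, rfl⟩

theorem Finitary.comp_locF (hΦ : Finitary A B Φ) (S : Submonoid A) :
    Finitary A B (Φ ⋙ locF S) := by
  intro C hC x
  change LocalizedModule S (Φ.obj (ModuleCat.of A B)) at x
  induction x using LocalizedModule.induction_on with | h m s => ?_
  obtain ⟨C', h1, h2, m', rfl⟩ := hΦ C hC m
  exact ⟨C', h1, h2, LocalizedModule.mk m' s, map_mk S _ m' s⟩

theorem Finitary.comp_locProd (hΦ : Finitary A B Φ) {ι : Type} [Finite ι] (y : ι → A) :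
    Finitary A B (Φ ⋙ locProdFunctor y) := by
  intro C hC x
  obtain ⟨C', h1, h2, h3⟩ := exists_subalgebra_ge_of_fintype
    (fun (a : ι) C' => ∃ x' : (Φ ⋙ locF (pw y a)).obj (subObj C'),
      ((Φ ⋙ locF (pw y a)).map (inclTop C')).hom x' = x a)
    (fun a C₁ C₂ h ⟨x', hx'⟩ => ⟨((Φ ⋙ locF (pw y a)).map (incl h)).hom x', by
      rw [← hx', ← incl_inclTop h, CategoryTheory.Functor.map_comp]
      rfl⟩)
    (fun a C₁ hC₁ => (hΦ.comp_locF (pw y a)) C₁ hC₁ (x a)) C hC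
  choose x' hx' using h3
  exact ⟨C', h1, h2, x', funext hx'⟩

theorem Finitary.comp_cech (hΦ : Finitary A B Φ) {ι : Type} [Finite ι] (y : ι → A) :
    ∀ i, Finitary A B (Φ ⋙ cechFunctor y i)
  | 0 => hΦ
  | i + 1 => (hΦ.comp_cech y i).comp_locProd y

variable {Q : Ideal A} [Q.IsPrime] (D : LocalDatum Q)

theorem LocalDatum.exists_G_map_incl_eq_zero [Algebra.IsIntegral A B] (C : Subalgebra A B)
    (hC : C.toSubmodule.FG) (i : ℕ) (x : (D.G i).obj (subObj C))
    (hx : ((D.G i).map (inclTop C)).hom x = 0) :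
    ∃ (C' : Subalgebra A B) (h : C ≤ C'), C'.toSubmodule.FG ∧
      ((D.G i).map (incl h)).hom x = 0 := by
  obtain ⟨z, rfl⟩ := cechClass_surjective D.y _ i x
  have h0 := (cechH_map_cechClass D.y ((locF Q.primeCompl).map (inclTop C)) i z).symm.trans hx
  have hinj : ∀ (C' : Subalgebra A B) (j : ℕ), Function.Injective
      ((cechFunctor D.y j).map ((locF Q.primeCompl).map (inclTop C'))).hom := fun C' j =>
    cechFunctor_map_injective D.y _ (locF_map_injective _ _ (inclTop_injective C')) j
  cases i with
  | zero =>
    refine ⟨C, le_rfl, hC, ?_⟩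
    have h1 := congrArg Subtype.val ((cechClass_zero_eq_zero_iff D.y _ _).1 h0)
    have h2 : z = 0 := Subtype.ext (hinj C 0 (h1.trans (map_zero _).symm))
    rw [h2]
    exact (congrArg _ (map_zero _)).trans (map_zero _)
  | succ i =>
    obtain ⟨w, hw⟩ := (cechClass_succ_eq_zero_iff D.y _ i _).1 h0
    obtain ⟨C', h1, h2, w', rfl⟩ := ((finitary_id (A := A) (B := B)).comp_locF
      Q.primeCompl).comp_cech D.y i C hC w
    refine ⟨C', h1, h2, ?_⟩
    refine (cechH_map_cechClass D.y ((locF Q.primeCompl).map (incl h1)) (i + 1) z).trans ?_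
    refine (cechClass_succ_eq_zero_iff D.y _ i _).2 ⟨w', hinj C' (i + 1) ?_⟩
    have h3 := LinearMap.congr_fun (congrArg ModuleCat.Hom.hom
      ((cechD D.y i).naturality ((locF Q.primeCompl).map (inclTop C')))) w'
    have h4 : (cechFunctor D.y (i + 1)).map ((locF Q.primeCompl).map (inclTop C)) =
        (cechFunctor D.y (i + 1)).map ((locF Q.primeCompl).map (incl h1)) ≫
        (cechFunctor D.y (i + 1)).map ((locF Q.primeCompl).map (inclTop C')) := by
      rw [← CategoryTheory.Functor.map_comp, ← CategoryTheory.Functor.map_comp, incl_inclTop]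
    refine (h3.symm.trans hw).trans ?_
    exact LinearMap.congr_fun (congrArg ModuleCat.Hom.hom h4) z.1

theorem LocalDatum.exists_G_map_inclTop_eq [Algebra.IsIntegral A B] (i : ℕ)
    (x : (D.G i).obj (ModuleCat.of A B)) : ∃ C : Subalgebra A B, C.toSubmodule.FG ∧
      ∃ x' : (D.G i).obj (subObj C), ((D.G i).map (inclTop C)).hom x' = x := by
  obtain ⟨z, rfl⟩ := cechClass_surjective D.y _ i x
  obtain ⟨C, -, h2, z', hz'⟩ := ((finitary_id (A := A) (B := B)).comp_locF
    Q.primeCompl).comp_cech D.y i ⊥ Subalgebra.fg_bot_toSubmodule z.1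
  have h3 : ((cechD D.y i).app ((locF Q.primeCompl).obj (subObj C))).hom z' = 0 := by
    refine cechFunctor_map_injective D.y ((locF Q.primeCompl).map (inclTop C))
      (locF_map_injective _ _ (inclTop_injective C)) (i + 1) ?_
    have h3 := LinearMap.congr_fun (congrArg ModuleCat.Hom.hom
      ((cechD D.y i).naturality ((locF Q.primeCompl).map (inclTop C)))) z'
    refine h3.symm.trans (Eq.trans ?_ (map_zero _).symm)
    exact (congrArg _ hz').trans z.2
  exact ⟨C, h2, cechClass D.y _ i ⟨z', h3⟩,
    (cechH_map_cechClass D.y ((locF Q.primeCompl).map (inclTop C)) i ⟨z', h3⟩).trans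
      (congrArg (cechClass D.y _ i) (Subtype.ext hz'))⟩

theorem LocNoeth.exists_relation {S : Submonoid A} {X : Type u} [AddCommGroup X] [Module A X]
    (hX : LocNoeth S X) (ω : ℕ → X) : ∃ (e : ℕ) (c : A) (l : ℕ → A), 0 < e ∧ c ∈ S ∧
      c • ω e = ∑ k ∈ Finset.range e, l k • ω k := by
  classical
  obtain ⟨W', h1, ⟨s, hs⟩, h2⟩ := hX (Submodule.span A (Set.range ω))
  let U : ℕ → Submodule A X := fun n => Submodule.span A (ω '' (Finset.range n : Set ℕ))
  have hU : Monotone U := fun m n h => Submodule.span_mono (Set.image_mono fun k hk => by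
    rw [Finset.mem_coe, Finset.mem_range] at hk ⊢
    exact lt_of_lt_of_le hk h)
  have h3 : ∀ x ∈ W', ∃ n, x ∈ U n := by
    intro x hx
    rw [← Submodule.mem_iSup_of_directed _ hU.directed_le]
    refine Submodule.span_le.2 ?_ (h1 hx)
    rintro _ ⟨k, rfl⟩
    refine Submodule.mem_iSup_of_mem (k + 1) (Submodule.subset_span ⟨k, ?_, rfl⟩)
    rw [Finset.mem_coe, Finset.mem_range]
    exact Nat.lt_succ_self k
  have h4 : ∀ x ∈ s, x ∈ W' := fun x hx => hs ▸ Submodule.subset_span hx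
  choose! n hn using h3
  have h5 : W' ≤ U (s.sup n + 1) := by
    rw [← hs, Submodule.span_le]
    exact fun x hx => hU ((Finset.le_sup (f := n) hx).trans (Nat.le_succ _)) (hn x (h4 x hx))
  obtain ⟨c, hc, h6⟩ := h2 (ω (s.sup n + 1)) (Submodule.subset_span ⟨_, rfl⟩)
  obtain ⟨l, hl⟩ := (Submodule.mem_span_image_finset_iff_exists_fun' A).1 (h5 h6)
  exact ⟨_, c, l, Nat.succ_pos _, hc, hl.symm⟩

end Subalgebras

section Orbits

variable {A : Type u} [CommRing A]

theorem Frob.iterate_cech_mem_ker {ι : Type} (y : ι → A) {p : ℕ} {M : ModuleCat.{u} A}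
    (F : Frob A p M) (i : ℕ) (k : ℕ) (z : LinearMap.ker ((cechD y i).app M).hom) :
    (F.cech y i).f^[k] z.1 ∈ LinearMap.ker ((cechD y i).app M).hom := by
  rw [LinearMap.mem_ker, iterate_comm (F.cechD_comm y i), z.2, iterate_map_zero]

theorem Frob.cechH_map_comp_eq_zero {ι : Type} (y : ι → A) {p : ℕ} (hp : 1 < p) {S : Submonoid A}
    {M M₁ N : ModuleCat.{u} A} (φ : M ⟶ M₁) (ψ : M₁ ⟶ N) {F : Frob A p M} {F₁ : Frob A p M₁}
    {F' : Frob A p N} (hφ : ∀ x, φ.hom (F.f x) = F₁.f (φ.hom x))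
    (hψ : ∀ x, ψ.hom (F₁.f x) = F'.f (ψ.hom x)) (hF' : F'.Solvable) (a : ι)
    (hC : ∀ n : ℕ, F'.Closed (y a ^ n)) (hy : IsSMulRegular N (y a)) (i : ℕ)
    (hN : LocNoeth S (LinearMap.range ((cechH y (i + 1)).map φ).hom))
    (hinj : ∀ c ∈ S, ∀ x : (cechH y (i + 1)).obj N, c • x = 0 → x = 0)
    (x : (cechH y (i + 1)).obj M) :
    ((cechH y (i + 1)).map ψ).hom (((cechH y (i + 1)).map φ).hom x) = 0 := by
  obtain ⟨z, rfl⟩ := cechClass_surjective y _ (i + 1) x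
  obtain ⟨e, c, l, he, hc, hrel⟩ := hN.exists_relation (fun k =>
    ⟨((cechH y (i + 1)).map φ).hom (cechClass y M (i + 1)
      ⟨_, F.iterate_cech_mem_ker y (i + 1) k z⟩), ⟨_, rfl⟩⟩)
  let z₁ : LinearMap.ker ((cechD y (i + 1)).app M₁).hom :=
    ⟨((cechFunctor y (i + 1)).map φ).hom z.1, map_mem_ker y φ (i + 1) z⟩
  have h1 : ∀ k, ((cechH y (i + 1)).map φ).hom (cechClass y M (i + 1)
      ⟨_, F.iterate_cech_mem_ker y (i + 1) k z⟩) =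
      cechClass y M₁ (i + 1) ⟨_, F₁.iterate_cech_mem_ker y (i + 1) k z₁⟩ := fun k =>
    (cechH_map_cechClass y φ (i + 1) _).trans (congrArg (cechClass y M₁ (i + 1))
      (Subtype.ext (Frob.iterate_comm (Frob.cech_map_comm y hφ (i + 1)) k z.1)))
  have h2 : cechClass y M₁ (i + 1)
      (c • ⟨_, F₁.iterate_cech_mem_ker y (i + 1) e z₁⟩ -
        ∑ k ∈ Finset.range e, l k • ⟨_, F₁.iterate_cech_mem_ker y (i + 1) k z₁⟩) = 0 := by
    rw [map_sub, map_sum, map_smul, sub_eq_zero]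
    have h3 := congrArg Subtype.val hrel
    simp only [Submodule.coe_sum, Submodule.coe_smul, h1] at h3
    rw [h3]
    exact Finset.sum_congr rfl fun k _ => (map_smul _ _ _).symm
  obtain ⟨w, hw⟩ := (cechClass_succ_eq_zero_iff y M₁ i _).1 h2
  rw [Submodule.coe_sub, Submodule.coe_sum, Submodule.coe_smul] at hw
  simp only [Submodule.coe_smul] at hw
  let ζ := ((cechFunctor y (i + 1)).map ψ).hom z₁.1
  have hζ : ((cechD y (i + 1)).app N).hom ζ = 0 := map_mem_ker y ψ (i + 1) z₁
  have h4 : c • (F'.cech y (i + 1)).f^[e] ζ =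
      (∑ k ∈ Finset.range e, l k • (F'.cech y (i + 1)).f^[k] ζ) +
        ((cechD y i).app N).hom (((cechFunctor y i).map ψ).hom w) := by
    have h5 := congrArg ((cechFunctor y (i + 1)).map ψ).hom hw
    rw [map_sub, map_sum, map_smul, iterate_comm (Frob.cech_map_comm y hψ (i + 1))] at h5
    simp only [map_smul, iterate_comm (Frob.cech_map_comm y hψ (i + 1))] at h5
    rw [← sub_eq_iff_eq_add', ← h5]
    exact (LinearMap.congr_fun (congrArg ModuleCat.Hom.hom ((cechD y i).naturality ψ)) w).symm
  obtain ⟨v, hv⟩ := Frob.exists_cechD_eq y (zero_lt_one.trans hp) hF' a hC hy i (c • ζ)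
    (by rw [map_smul, hζ, smul_zero]) e he
    (fun k => l k * c ^ (p ^ e - 1 - p ^ k)) (c ^ (p ^ e - 1) • ((cechFunctor y i).map ψ).hom w) (by
      have h6 : c ^ p ^ e = c ^ (p ^ e - 1) * c := by
        rw [← pow_succ, Nat.sub_add_cancel (Nat.pow_pos (zero_lt_one.trans hp))]
      rw [iterate_smul, h6, mul_smul, h4, smul_add, map_smul, Finset.smul_sum]
      congr 1
      refine Finset.sum_congr rfl fun k hk => ?_
      have h7 : p ^ k ≤ p ^ e - 1 :=
        Nat.le_sub_one_of_lt (Nat.pow_lt_pow_right hp (Finset.mem_range.1 hk))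
      rw [iterate_smul, smul_smul, smul_smul, mul_assoc, ← pow_add, Nat.sub_add_cancel h7,
        mul_comm])
  have h7 : c • cechClass y N (i + 1) ⟨ζ, hζ⟩ = 0 := by
    rw [← map_smul]
    exact (cechClass_succ_eq_zero_iff y N i _).2 ⟨v, hv⟩
  have h8 := hinj c hc _ h7
  rw [cechH_map_cechClass, cechH_map_cechClass]
  exact h8

end Orbits

section Orbits

variable {A : Type u} [CommRing A] {B : Type u} [CommRing B] [IsDomain B] [Algebra A B]

theorem isSMulRegular_of_algebraMap_ne_zero {t : A} (ht : algebraMap A B t ≠ 0) :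
    IsSMulRegular B t := fun x y h => by
  simp only [Algebra.smul_def] at h
  exact mul_left_cancel₀ ht h

variable {Q : Ideal A} [Q.IsPrime] (D : LocalDatum Q)

theorem LocalDatum.exists_algebraMap_y_ne_zero {r : A} (hr : r ∈ Q) (hr' : algebraMap A B r ≠ 0)
    (hQ : RingHom.ker (algebraMap A B) ≤ Q) : ∃ a, algebraMap A B (D.y a) ≠ 0 := by
  by_contra! h
  have h1 := D.minimal (RingHom.ker (algebraMap A B)) (RingHom.ker_isPrime _) hQ fun s hs => by
    obtain ⟨a, rfl⟩ := D.exists_y_eq hs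
    exact h a
  exact hr' (h1.ge hr)

theorem LocalDatum.G_map_inclTop_eq_zero [IsNoetherianRing A] {p : ℕ} [Fact p.Prime] [CharP B p]
    (hS : (frobSelf A p B).Solvable)
    (hC : ∀ t, algebraMap A B t ≠ 0 → (frobSelf A p B).Closed t)
    (hQ : RingHom.ker (algebraMap A B) ≤ Q) {r : A} (hr : r ∈ Q) (hr' : algebraMap A B r ≠ 0)
    {C C₁ : Subalgebra A B} (h : C ≤ C₁) (i : ℕ)
    (hN : LocNoeth Q.primeCompl (LinearMap.range ((D.G i).map (incl h)).hom))
    (x : (D.G i).obj (subObj C)) : ((D.G i).map (inclTop C)).hom x = 0 := by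
  cases i with
  | zero =>
    exact D.G_zero_eq_zero (ModuleCat.of A B) r hr (isSMulRegular_of_algebraMap_ne_zero hr') _
  | succ i =>
    have hp : 1 < p := (Fact.out : p.Prime).one_lt
    have : CharP C p := RingHom.charP C.val.toRingHom Subtype.val_injective p
    have : CharP C₁ p := RingHom.charP C₁.val.toRingHom Subtype.val_injective p
    obtain ⟨a, ha⟩ := D.exists_algebraMap_y_ne_zero hr hr' hQ
    rw [← incl_inclTop h, D.G_map_comp]
    have hreg : IsSMulRegular ((locF Q.primeCompl).obj (ModuleCat.of A B)) (D.y a) := by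
      have h1 := locF_map_injective Q.primeCompl (D.y a • 𝟙 (ModuleCat.of A B))
        (isSMulRegular_of_algebraMap_ne_zero ha)
      rw [locF_map_smul, CategoryTheory.Functor.map_id] at h1
      exact h1
    exact Frob.cechH_map_comp_eq_zero D.y hp (S := Q.primeCompl)
      (M := (locF Q.primeCompl).obj (subObj C)) (M₁ := (locF Q.primeCompl).obj (subObj C₁))
      (N := (locF Q.primeCompl).obj (ModuleCat.of A B))
      ((locF Q.primeCompl).map (incl h)) ((locF Q.primeCompl).map (inclTop C₁))
      (F := (frobSelf A p C).loc Q.primeCompl) (F₁ := (frobSelf A p C₁).loc Q.primeCompl)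
      (F' := (frobSelf A p B).loc Q.primeCompl)
      (Frob.loc_comm (fun x => rfl) Q.primeCompl) (Frob.loc_comm (fun x => rfl) Q.primeCompl)
      (hS.loc (zero_lt_one.trans hp) _) a
      (fun n => (hC _ (by rw [map_pow]; exact pow_ne_zero n ha)).loc
        (zero_lt_one.trans hp) _) hreg i
      hN (fun c hc x hx => D.eq_zero_of_smul_eq_zero (ModuleCat.of A B) (i + 1) hc x hx) x

end Orbits

section Annihilation

variable {A : Type u} [CommRing A] {B : Type u} [CommRing B] [Algebra A B]
  (D : ∀ (Q : Ideal A) [Q.IsPrime], LocalDatum Q)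

/-- The ideal of elements that annihilate all the maps on local cohomology in codimension `j`
induced by an inclusion of subalgebras. -/
def annIdeal (j : ℕ) {C C' : Subalgebra A B} (h : C ≤ C') : Ideal A where
  carrier := {c | ∀ (Q : Ideal A) [Q.IsPrime] (i : ℕ), i + j = (D Q).ht →
    ∀ x : ((D Q).G i).obj (subObj C), c • (((D Q).G i).map (incl h)).hom x = 0}
  add_mem' {a b} ha hb Q _ i hi x := by rw [add_smul, ha Q i hi x, hb Q i hi x, add_zero]
  zero_mem' Q _ i _ x := zero_smul A _
  smul_mem' r c hc Q _ i hi x := by rw [smul_eq_mul, mul_smul, hc Q i hi x, smul_zero]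

theorem annIdeal_mono {j : ℕ} {C C₁ C₂ : Subalgebra A B} (h : C ≤ C₁) (h' : C₁ ≤ C₂) :
    annIdeal D j h ≤ annIdeal D j (h.trans h') := by
  intro c hc Q _ i hi x
  rw [← incl_incl h h', LocalDatum.G_map_comp, ← map_smul, hc Q i hi x, map_zero]

theorem ker_le_annIdeal (j : ℕ) {C C₁ : Subalgebra A B} (h : C ≤ C₁) :
    RingHom.ker (algebraMap A B) ≤ annIdeal D j h := by
  intro c hc Q _ i hi x
  rw [← map_smul, ← LocalDatum.G_map_smul_id]
  have h1 : c • 𝟙 (subObj C) = 0 := by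
    refine ModuleCat.hom_ext (LinearMap.ext fun z => Subtype.ext ?_)
    change c • (z : B) = 0
    rw [Algebra.smul_def, RingHom.mem_ker.1 hc, zero_mul]
  rw [h1, LocalDatum.G_map_zero, map_zero]

theorem IsDual.mem_annIdeal {j : ℕ} {C C₁ : Subalgebra A B} {h : C ≤ C₁} {N : ModuleCat.{u} A}
    (hN : IsDual D (incl h) j N) {c : A} (hc : ∀ n : N, c • n = 0) : c ∈ annIdeal D j h := by
  intro Q _ i hi x
  obtain ⟨ρ, -, h2⟩ := (hN Q).1 i hi
  rw [← map_smul, ← h2, map_smul]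
  refine LinearMap.ext fun n => ?_
  rw [LinearMap.smul_apply, ← map_smul, hc, map_zero, LinearMap.zero_apply]

theorem LocalDatum.exists_G_map_incl_eq_zero_forall [Algebra.IsIntegral A B] {Q : Ideal A}
    [Q.IsPrime] (D : LocalDatum Q) {C C₁ : Subalgebra A B} (h : C ≤ C₁) (hC₁ : C₁.toSubmodule.FG)
    (i : ℕ) (hN : LocNoeth Q.primeCompl (LinearMap.range ((D.G i).map (incl h)).hom))
    (hx : ∀ x : (D.G i).obj (subObj C), ((D.G i).map (inclTop C)).hom x = 0) :
    ∃ (C₂ : Subalgebra A B) (h' : C ≤ C₂), C₂.toSubmodule.FG ∧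
      ∀ x, ((D.G i).map (incl h')).hom x = 0 := by
  obtain ⟨W, -, hW, hW'⟩ := hN ⊤
  obtain ⟨n, v, rfl⟩ := Submodule.fg_iff_exists_fin_generating_family.1 hW
  obtain ⟨C₂, h1, h2, h3⟩ := exists_subalgebra_ge_of_fintype
    (fun a (C₂ : Subalgebra A B) => ∃ h' : C₁ ≤ C₂,
      ((D.G i).map (incl h')).hom (v a : (D.G i).obj (subObj C₁)) = 0)
    (fun a C₂ C₃ h ⟨h', h4⟩ => ⟨h'.trans h, by
      rw [← incl_incl h' h, D.G_map_comp, h4, map_zero]⟩)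
    (fun a C₂ h2 => by
      obtain ⟨x, hx'⟩ := (v a).2
      obtain ⟨C₃, h3, h4, h5⟩ := D.exists_G_map_incl_eq_zero C₁ hC₁ i (v a) (by
        rw [← hx', ← D.G_map_comp, incl_inclTop, hx])
      refine ⟨C₂ ⊔ C₃, le_sup_left, fg_sup h2 h4, h3.trans le_sup_right, ?_⟩
      rw [← incl_incl h3 le_sup_right, D.G_map_comp, h5, map_zero])
    C₁ hC₁
  refine ⟨C₂, h.trans h1, h2, fun x => ?_⟩
  obtain ⟨c, hc, h4⟩ := hW' ⟨((D.G i).map (incl h)).hom x, x, rfl⟩ trivial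
  refine D.eq_zero_of_smul_eq_zero _ i hc _ ?_
  rw [← incl_incl h h1, D.G_map_comp, ← map_smul]
  have h5 : Submodule.span A (Set.range v) ≤ LinearMap.ker
      (((D.G i).map (incl h1)).hom ∘ₗ Submodule.subtype _) := by
    rw [Submodule.span_le]
    rintro _ ⟨a, rfl⟩
    exact (h3 a).2
  exact h5 h4

variable [IsNoetherianRing A]

theorem exists_greatest_annIdeal (j : ℕ) (C : Subalgebra A B) (hC : C.toSubmodule.FG) :
    ∃ (C₁ : Subalgebra A B) (h : C ≤ C₁), C₁.toSubmodule.FG ∧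
      ∀ (C₂ : Subalgebra A B) (h' : C ≤ C₂), C₂.toSubmodule.FG →
        annIdeal D j h' ≤ annIdeal D j h := by
  obtain ⟨J, ⟨C₁, h, h1, rfl⟩, hJ⟩ := set_has_maximal_iff_noetherian.2
    (inferInstanceAs (IsNoetherian A A))
    {J : Ideal A | ∃ (C₁ : Subalgebra A B) (h : C ≤ C₁), C₁.toSubmodule.FG ∧ annIdeal D j h = J}
    ⟨_, C, le_rfl, hC, rfl⟩
  refine ⟨C₁, h, h1, fun C₂ h' h2 => ?_⟩
  have h3 := annIdeal_mono D (j := j) h (le_sup_left (b := C₂))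
  have h4 := annIdeal_mono D (j := j) h' (le_sup_right (a := C₁))
  have h5 := hJ _ ⟨C₁ ⊔ C₂, h.trans le_sup_left, fg_sup h1 h2, rfl⟩
  by_contra h6
  exact h5 (lt_of_le_not_ge h3 fun h7 => h6 (h4.trans h7))

theorem LocalDatum.locNoeth_dual {Q : Ideal A} [Q.IsPrime] (D : LocalDatum Q)
    (N : ModuleCat.{u} A) [Module.Finite A N] (t : ℕ)
    (h : ∀ r ∈ Q ^ t, ∀ g : N →ₗ[A] D.E, r • g = 0) : LocNoeth Q.primeCompl (N →ₗ[A] D.E) := by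
  let W : Submodule A D.E :=
    { carrier := {x | ∀ r ∈ Q ^ t, r • x = 0}
      add_mem' := fun {a b} ha hb r hr => by rw [smul_add, ha r hr, hb r hr, add_zero]
      zero_mem' := fun r _ => smul_zero r
      smul_mem' := fun a x hx r hr => by rw [smul_comm, hx r hr, smul_zero] }
  obtain ⟨n, v, hv⟩ := Submodule.fg_iff_exists_fin_generating_family.1
    (Module.finite_def.1 (inferInstance : Module.Finite A N))
  let Ψ : (N →ₗ[A] D.E) →ₗ[A] (Fin n → W) := LinearMap.pi fun a =>
    { toFun := fun g => ⟨g (v a), fun r hr => LinearMap.congr_fun (h r hr g) (v a)⟩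
      map_add' := fun _ _ => rfl
      map_smul' := fun _ _ => rfl }
  refine LocNoeth.of_injective Ψ ?_ ((D.locNoeth_E t W fun x hx => hx).pi n)
  intro g g' hg
  refine LinearMap.ext_on_range hv fun a => ?_
  exact congrArg Subtype.val (congrFun hg a)

theorem IsDual.locNoeth_range {j i : ℕ} {M M' : ModuleCat.{u} A} {f : M ⟶ M'}
    {N : ModuleCat.{u} A} [Module.Finite A N]
    (hN : IsDual D f j N) (Q : Ideal A) [Q.IsPrime] (hi : i + j = (D Q).ht) (t : ℕ)
    (h : ∀ r ∈ Q ^ t, ∀ x, r • (((D Q).G i).map f).hom x = 0) :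
    LocNoeth Q.primeCompl (LinearMap.range (((D Q).G i).map f).hom) := by
  obtain ⟨ρ, h1, h2⟩ := (hN Q).1 i hi
  have h3 : LocNoeth Q.primeCompl (N →ₗ[A] (D Q).E) := (D Q).locNoeth_dual N t fun r hr g => by
    obtain ⟨x, rfl⟩ := h1 g
    rw [← map_smul, h2, map_smul, h r hr x]
  have h4 : LinearMap.ker (((D Q).G i).map f).hom = LinearMap.ker ρ := by
    ext x
    rw [LinearMap.mem_ker, LinearMap.mem_ker, h2]
  let e := (LinearMap.quotKerEquivRange (((D Q).G i).map f).hom).symm ≪≫ₗ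
    Submodule.quotEquivOfEq _ _ h4 ≪≫ₗ ρ.quotKerEquivOfSurjective h1
  exact LocNoeth.of_injective e.toLinearMap e.injective h3

variable [IsDomain B] [Algebra.IsIntegral A B] {p : ℕ} [Fact p.Prime] [CharP B p]
  (hS : (frobSelf A p B).Solvable)
  (hC : ∀ t, algebraMap A B t ≠ 0 → (frobSelf A p B).Closed t)

/-- The prime `Q` obstructs the vanishing, along a sufficiently large extension of `C`, of local
cohomology in codimension `j`. -/
def Obstructs (j : ℕ) (Q : Ideal A) (C : Subalgebra A B) : Prop :=
  C.toSubmodule.FG ∧ ∀ (C₂ : Subalgebra A B) (h : C ≤ C₂), C₂.toSubmodule.FG →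
    annIdeal D j h ≤ Q

include hS hC in
theorem not_obstructs (P : Ideal A) [P.IsPrime] (hP : P = RingHom.ker (algebraMap A B)) (j : ℕ)
    (hj : (D P).ht < j) (Q : Ideal A) [hQ : Q.IsPrime] (C : Subalgebra A B) :
    ¬ Obstructs D j Q C := by
  induction hn : (D Q).ht using Nat.strong_induction_on generalizing Q with | _ n ih => ?_
  subst hn
  rintro ⟨hfg, hobs⟩
  obtain ⟨C₁, h, h1, h2⟩ := exists_greatest_annIdeal D j C hfg
  have hPQ : P ≤ Q := hP ▸ (ker_le_annIdeal D j h).trans (hobs C₁ h h1)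
  have hmin : Q ∈ (annIdeal D j h).minimalPrimes := by
    refine ⟨⟨hQ, hobs C₁ h h1⟩, fun Q' ⟨hQ', h3⟩ h4 => ?_⟩
    by_contra h5
    exact ih _ (ht_lt_ht D (lt_of_le_not_ge h4 h5)) Q' rfl
      ⟨hfg, fun C₂ h' h6 => (h2 C₂ h' h6).trans h3⟩
  have hfin : Module.Finite A C := Module.Finite.iff_fg.2 hfg
  have hdual : ∀ (C₂ : Subalgebra A B) (h' : C ≤ C₂), C₂.toSubmodule.FG →
      ∃ N : ModuleCat.{u} A, Module.Finite A N ∧ IsDual D (incl h') j N ∧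
        ∃ g : N →ₗ[A] (D Q).E, g ≠ 0 := by
    intro C₂ h' h3
    have : Module.Finite A C₂ := Module.Finite.iff_fg.2 h3
    obtain ⟨N, h4, h5⟩ := exists_isDual D j (incl h')
    refine ⟨N, h4, h5, ?_⟩
    by_contra! h6
    obtain ⟨c, hc, h7⟩ := (D Q).exists_smul_eq_zero N h6
    exact hc (hobs C₂ h' h3 (h5.mem_annIdeal D h7))
  obtain ⟨N, hNfin, hN, g, hg⟩ := hdual C₁ h h1
  have hle : j ≤ (D Q).ht := not_lt.1 fun h3 => hg ((hN Q).2 h3 g)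
  obtain ⟨i, hi⟩ : ∃ i, i + j = (D Q).ht := ⟨_, Nat.sub_add_cancel hle⟩
  obtain ⟨r, hr, hr'⟩ : ∃ r ∈ Q, algebraMap A B r ≠ 0 := by
    by_contra! h3
    have h4 : Q = P := le_antisymm (fun r hr => hP ▸ h3 r hr) hPQ
    subst h4
    exact absurd hj (not_lt.2 hle)
  obtain ⟨t, c, hc, hct⟩ := exists_pow_mul_le_of_mem_minimalPrimes hmin
  have hLN := hN.locNoeth_range D Q hi t fun r hr x =>
    (D Q).eq_zero_of_smul_eq_zero _ i hc _ (by
      rw [smul_smul]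
      exact hct r hr Q i hi x)
  obtain ⟨C₂, h3, h4, h5⟩ := (D Q).exists_G_map_incl_eq_zero_forall h h1 i hLN
    ((D Q).G_map_inclTop_eq_zero hS hC (hP ▸ hPQ) hr hr' h i hLN)
  obtain ⟨N₂, -, hN₂, g₂, hg₂⟩ := hdual C₂ h3 h4
  obtain ⟨ρ, h6, h7⟩ := (hN₂ Q).1 i hi
  obtain ⟨x, rfl⟩ := h6 g₂
  exact hg₂ ((h7 x).2 (h5 x))

include hS hC in
theorem G_eq_zero_of_add_lt (P : Ideal A) [P.IsPrime] (hP : P = RingHom.ker (algebraMap A B))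
    (Q : Ideal A) [Q.IsPrime] (i : ℕ) (hi : i + (D P).ht < (D Q).ht)
    (x : ((D Q).G i).obj (ModuleCat.of A B)) : x = 0 := by
  obtain ⟨C, hfg, x, rfl⟩ := (D Q).exists_G_map_inclTop_eq i x
  obtain ⟨j, hj⟩ : ∃ j, i + j = (D Q).ht := ⟨(D Q).ht - i, by omega⟩
  obtain ⟨C₁, h, h1, h2⟩ := exists_greatest_annIdeal D j C hfg
  have h3 : annIdeal D j h = ⊤ := by
    by_contra h3
    obtain ⟨m, hm, h4⟩ := Ideal.exists_le_maximal _ h3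
    have := hm.isPrime
    exact not_obstructs D hS hC P hP j (by omega) m C
      ⟨hfg, fun C₂ h' h5 => (h2 C₂ h' h5).trans h4⟩
  have h4 := ((Ideal.eq_top_iff_one _).1 h3) Q i hj x
  rw [one_smul] at h4
  rw [← incl_inclTop h, (D Q).G_map_comp, h4, map_zero]

end Annihilation

theorem nonempty_localDatum {A : Type u} [CommRing A] (hA : IsGorensteinLocalRing A) (Q : Ideal A)
    [Q.IsPrime] : Nonempty (LocalDatum Q) := by
  obtain ⟨_, -, n, hn⟩ := hA
  obtain ⟨rs, h1, h2, h3, h4⟩ := exists_isRegular_localizedModule n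
    (hasInjectiveDimensionLT_of_ext _ n fun N => hn (n + 1) n.lt_succ_self N) Q
  exact ⟨⟨rs, h1, h2, h3, h4⟩⟩

section AbsolutelyIntegrallyClosed

open Polynomial

variable {A B L : Type u} [CommRing A] [CommRing B] [Algebra A B] [Field L] [Algebra B L]
  (p : ℕ) [Fact p.Prime]

theorem exists_monic_aeval_eq (e : ℕ) (c : ℕ → B) (w : B) :
    ∃ q : B[X], q.Monic ∧ q.natDegree = p ^ e ∧ ∀ z : L, aeval z q =
      z ^ p ^ e - (∑ k ∈ Finset.range e, algebraMap B L (c k) * z ^ p ^ k + algebraMap B L w) := by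
  have : Nontrivial B := (algebraMap B L).domain_nontrivial
  have hp : 1 < p := (Fact.out : p.Prime).one_lt
  let r : B[X] := ∑ k ∈ Finset.range e, C (c k) * X ^ p ^ k + C w
  have hr : r.degree < (p ^ e : ℕ) := by
    refine (degree_add_le _ _).trans_lt (max_lt ?_ (degree_C_le.trans_lt (by
      exact_mod_cast pow_pos (zero_lt_one.trans hp) e)))
    refine (degree_sum_le _ _).trans_lt ((Finset.sup_lt_iff (WithBot.bot_lt_coe _)).2 ?_)
    intro k hk
    refine (degree_C_mul_X_pow_le _ _).trans_lt ?_
    exact_mod_cast Nat.pow_lt_pow_right hp (Finset.mem_range.1 hk)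
  refine ⟨X ^ p ^ e - r, monic_X_pow_sub hr, ?_, fun z => ?_⟩
  · refine natDegree_eq_of_degree_eq_some ?_
    rw [degree_sub_eq_left_of_degree_lt (by rwa [degree_X_pow]), degree_X_pow]
  · simp only [r, map_sub, map_add, map_sum, map_mul, map_pow, aeval_X, aeval_C]

variable [CharP B p]

theorem frobSelf_iterate (k : ℕ) (x : B) : (frobSelf A p B).f^[k] x = x ^ p ^ k :=
  iterate_frobenius p k x

variable (A L)

theorem frobSelf_solvable [IsAlgClosed L] [IsIntegrallyClosedIn B L] :
    (frobSelf A p B).Solvable := by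
  intro e c w he
  have hp : 0 < p := (Fact.out : p.Prime).pos
  have : Nontrivial B := (algebraMap B L).domain_nontrivial
  obtain ⟨q, h1, h2, h3⟩ := exists_monic_aeval_eq (L := L) p e (fun k => algebraMap A B (c k)) w
  obtain ⟨z, hz⟩ := IsAlgClosed.exists_aeval_eq_zero_of_injective L
    (IsIntegralClosure.algebraMap_injective B B L) q fun h => by
      rw [natDegree_eq_of_degree_eq_some h] at h2
      exact (pow_pos hp e).ne h2
  obtain ⟨x, rfl⟩ := IsIntegrallyClosedIn.isIntegral_iff.1 ⟨q, h1, hz⟩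
  refine ⟨x, IsIntegralClosure.algebraMap_injective B B L ?_⟩
  rw [h3, sub_eq_zero] at hz
  simp only [frobSelf_iterate, map_pow, map_add, map_sum, Algebra.smul_def, map_mul, hz]

theorem frobSelf_closed [IsIntegrallyClosedIn B L] (t : A) (ht : algebraMap A B t ≠ 0) :
    (frobSelf A p B).Closed t := by
  intro e c x hx
  have hp : 0 < p := (Fact.out : p.Prime).pos
  have hinj := IsIntegralClosure.algebraMap_injective B B L
  have hτ : algebraMap B L (algebraMap A B t) ≠ 0 := (map_ne_zero_iff _ hinj).2 ht
  obtain ⟨q, h1, -, h3⟩ := exists_monic_aeval_eq (L := L) p e (fun k => algebraMap A B (c k)) 0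
  have hq : aeval (algebraMap B L x / algebraMap B L (algebraMap A B t)) q = 0 := by
    have h4 := congrArg (algebraMap B L) hx
    simp only [frobSelf_iterate, Algebra.smul_def, map_sum, map_mul, map_pow] at h4
    rw [h3, map_zero, add_zero, sub_eq_zero, div_pow, h4, Finset.sum_div]
    refine Finset.sum_congr rfl fun k hk => ?_
    rw [← Frob.pow_mul_pow_sub hp _ (Finset.mem_range.1 hk), div_pow]
    field_simp
  obtain ⟨u, hu⟩ := IsIntegrallyClosedIn.isIntegral_iff.1 ⟨q, h1, hq⟩
  refine ⟨u, hinj ?_⟩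
  rw [Algebra.smul_def, map_mul, hu, mul_div_cancel₀ _ hτ]

end AbsolutelyIntegrallyClosed

section Regular

variable {A : Type u} [CommRing A] (D : ∀ (Q : Ideal A) [Q.IsPrime], LocalDatum Q)

open scoped Pointwise in
theorem G_quotSMulTop_eq_zero {M : Type u} [AddCommGroup M] [Module A M] {r : A}
    (hr : IsSMulRegular M r) (Q : Ideal A) [Q.IsPrime] (i : ℕ)
    (h0 : ∀ x : ((D Q).G i).obj (ModuleCat.of A M), x = 0)
    (h1 : ∀ x : ((D Q).G (i + 1)).obj (ModuleCat.of A M), x = 0)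
    (x : ((D Q).G i).obj (ModuleCat.of A (QuotSMulTop r M))) : x = 0 := by
  have hex : Function.Exact (LinearMap.lsmul A M r) (r • (⊤ : Submodule A M)).mkQ := by
    rw [LinearMap.exact_iff, Submodule.ker_mkQ]
    ext m
    simp only [Submodule.mem_smul_pointwise_iff_exists, LinearMap.mem_range, Submodule.mem_top,
      true_and, LinearMap.lsmul_apply]
  have hS := shortCx_shortExact _ _ hex hr (Submodule.mkQ_surjective _)
  obtain ⟨w, rfl⟩ := ((D Q).Gδ_eq_zero_iff hS i x).1 (h1 _)
  rw [h0 w, map_zero]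

variable [IsNoetherianRing A] [IsLocalRing A]

theorem isWeaklyRegular_of_G_eq_zero (h : ℕ) (l : List A) :
    ∀ (M : Type u) [AddCommGroup M] [Module A M] (k : ℕ) (J : Ideal A),
      (∀ c ∈ J, ∀ m : M, c • m = 0) → (∀ r ∈ l, r ∈ maximalIdeal A) →
      maximalIdeal A ≤ (J ⊔ Ideal.ofList l).radical →
      h + k + l.length ≤ (D (maximalIdeal A)).ht →
      (∀ (Q : Ideal A) [Q.IsPrime] (i : ℕ), i + (h + k) < (D Q).ht →
        ∀ x : ((D Q).G i).obj (ModuleCat.of A M), x = 0) →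
      RingTheory.Sequence.IsWeaklyRegular M l := by
  induction l with
  | nil => exact fun M _ _ _ _ _ _ _ _ _ => RingTheory.Sequence.IsWeaklyRegular.nil A M
  | cons r l ih =>
    intro M _ _ k J hJ hl hrad hk hG
    have hr : IsSMulRegular M r := by
      rw [isSMulRegular_iff_right_eq_zero_of_smul]
      intro m hm
      by_contra hm0
      obtain ⟨Q, hQ, hQr⟩ := exists_le_isAssociatedPrime_of_isNoetherianRing A m hm0
      obtain ⟨hQ, m', rfl⟩ := isAssociatedPrime_iff.1 hQ
      set Q := (⊥ : Submodule A M).colon {m'}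
      have hmem : ∀ c, c ∈ Q ↔ c • m' = 0 := fun c => Submodule.mem_colon_singleton
      have h1 : r ∈ Q := hQr (Submodule.mem_colon_singleton.2 hm)
      have h2 : J ≤ Q := fun c hc => (hmem c).2 (hJ c hc m')
      have h3 := ht_maximalIdeal_le D Q l (fun z hz => hl z (List.mem_cons_of_mem _ hz))
        (hrad.trans (Ideal.radical_mono (sup_le (h2.trans le_sup_left) (by
          rw [Ideal.ofList_cons]
          exact sup_le_sup_right ((Ideal.span_singleton_le_iff_mem _).2 h1) _))))
      obtain ⟨x, hx⟩ := (D Q).exists_G_zero_ne_zero (ModuleCat.of A M) m'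
        (fun c hc h => hc ((hmem c).2 h)) fun c hc => (hmem c).1 hc
      rw [List.length_cons] at hk
      exact hx (hG Q 0 (by omega) x)
    refine (RingTheory.Sequence.isWeaklyRegular_cons_iff M r l).2 ⟨hr, ?_⟩
    refine ih (QuotSMulTop r M) (k + 1) (J ⊔ Ideal.span {r}) ?_
      (fun z hz => hl z (List.mem_cons_of_mem _ hz)) ?_ ?_ ?_
    · intro c hc m
      obtain ⟨m, rfl⟩ := Submodule.mkQ_surjective _ m
      obtain ⟨a, ha, b, hb, rfl⟩ := Submodule.mem_sup.1 hc
      obtain ⟨b, rfl⟩ := Ideal.mem_span_singleton'.1 hb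
      rw [add_smul, ← map_smul, hJ a ha, map_zero, zero_add, ← map_smul, Submodule.mkQ_apply,
        Submodule.Quotient.mk_eq_zero, mul_comm, mul_smul]
      exact Submodule.smul_mem_pointwise_smul _ _ _ Submodule.mem_top
    · rwa [sup_assoc, ← Ideal.ofList_cons]
    · rw [List.length_cons] at hk
      omega
    · exact fun Q _ i hi => G_quotSMulTop_eq_zero D hr Q i (hG Q i (by omega))
        (hG Q (i + 1) (by omega))

end Regular

section Main

variable {A R B : Type u} [CommRing A] [CommRing R] [IsLocalRing R] [CommRing B]
  [Algebra A R] [Algebra A B] [Algebra R B] [IsScalarTower A R B]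
  [Algebra.IsIntegral R B] [FaithfulSMul R B]

theorem top_ne_ofList_smul_top (l : List R) (hl : ∀ r ∈ l, r ∈ maximalIdeal R) :
    (⊤ : Submodule R B) ≠ Ideal.ofList l • ⊤ := by
  intro h
  have h1 : (Ideal.ofList l).map (algebraMap R B) = ⊤ := by
    rw [Ideal.smul_top_eq_map] at h
    refine top_le_iff.1 fun b _ => ?_
    have hb : b ∈ (⊤ : Submodule R B) := Submodule.mem_top
    rwa [h] at hb
  rw [Ideal.map_eq_top_iff _ (FaithfulSMul.algebraMap_injective R B)
    (algebraMap_isIntegral_iff.2 inferInstance)] at h1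
  exact (maximalIdeal.isMaximal R).ne_top (top_le_iff.1 (h1.ge.trans (Ideal.span_le.2 hl)))

theorem isWeaklyRegular_of_surjective [IsDomain B] (hA : IsGorensteinLocalRing A)
    (hAR : Function.Surjective (algebraMap A R)) (p : ℕ) [Fact p.Prime] [CharP B p]
    (hS : (frobSelf A p B).Solvable)
    (hC : ∀ t, algebraMap A B t ≠ 0 → (frobSelf A p B).Closed t) (l : List R)
    (hd : ringKrullDim R = l.length) (hl : ∀ r ∈ l, r ∈ maximalIdeal R)
    (hrad : (Ideal.ofList l).radical = maximalIdeal R) :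
    RingTheory.Sequence.IsWeaklyRegular B l := by
  have _ : IsNoetherianRing A := hA.1
  have _ : IsLocalRing A := hA.2.1
  have D : ∀ (Q : Ideal A) [Q.IsPrime], LocalDatum Q := fun Q _ =>
    Classical.choice (nonempty_localDatum hA Q)
  have _ : Algebra.IsIntegral A R := ⟨fun r => by
    obtain ⟨a, rfl⟩ := hAR r
    exact isIntegral_algebraMap⟩
  have _ : Algebra.IsIntegral A B := Algebra.IsIntegral.trans R
  have hm : (maximalIdeal R).comap (algebraMap A R) = maximalIdeal A := by
    have := Ideal.comap_isMaximal_of_surjective (algebraMap A R) hAR (K := maximalIdeal R)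
    exact IsLocalRing.eq_maximalIdeal this
  obtain ⟨l, rfl⟩ := List.map_surjective_iff.2 hAR l
  rw [RingTheory.Sequence.isWeaklyRegular_map_algebraMap_iff]
  set P := RingHom.ker (algebraMap A B) with hP
  have hPR : P = RingHom.ker (algebraMap A R) := by
    ext a
    rw [hP, RingHom.mem_ker, RingHom.mem_ker, IsScalarTower.algebraMap_apply A R B,
      FaithfulSMul.algebraMap_eq_zero_iff]
  have hPp : P.IsPrime := RingHom.ker_isPrime _
  have hdim : (D P).ht + l.length ≤ (D (maximalIdeal A)).ht := by
    obtain ⟨s, hs⟩ := Order.le_krullDim_iff.1 hd.ge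
    rw [List.length_map] at hs
    let s' : LTSeries (PrimeSpectrum A) := s.map (PrimeSpectrum.comap (algebraMap A R))
      (Monotone.strictMono_of_injective (fun _ _ h => Ideal.comap_mono h)
        (PrimeSpectrum.comap_injective_of_surjective _ hAR))
    have := ht_add_length_le D P (Q := maximalIdeal A) s'
      (fun a ha => by
        rw [hPR] at ha
        change algebraMap A R a ∈ s.head.asIdeal
        rw [RingHom.mem_ker.1 ha]
        exact zero_mem _)
      (IsLocalRing.le_maximalIdeal s'.last.2.ne_top)
    exact hs ▸ this
  refine isWeaklyRegular_of_G_eq_zero D (D P).ht l B 0 P (fun c hc m => ?_)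
    (fun a ha => hm.le (hl _ (List.mem_map_of_mem ha))) ?_ hdim
    (fun Q _ i hi x => G_eq_zero_of_add_lt D hS hC P hP Q i hi x)
  · rw [Algebra.smul_def, RingHom.mem_ker.1 hc, zero_mul]
  · intro a ha
    have := hrad.ge (hm.ge ha)
    obtain ⟨n, hn⟩ := this
    refine ⟨n, ?_⟩
    rw [← map_pow, ← Ideal.map_ofList] at hn
    have := Ideal.comap_map_of_surjective (algebraMap A R) hAR (Ideal.ofList l)
    rw [sup_comm, hPR, RingHom.ker_eq_comap_bot, ← this]
    exact hn

end Main

end PlusClosure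

/-!
STATEMENT 3: `R` a commutative Noetherian local domain containing a field of
characteristic `p > 0`, a surjective image of a Gorenstein local ring, `R⁺` its
absolute integral closure.  Then every system of parameters `x_1, …, x_d` of `R`
(`d = dim R`, each `x_i ∈ 𝔪`, and `(x_1, …, x_d)` is `𝔪`-primary, i.e. its radical
is `𝔪`) is a regular sequence on `R⁺`.
-/
theorem statement3
    (R : Type u) [CommRing R] [IsDomain R] [IsNoetherianRing R] [IsLocalRing R]
    -- `R` contains a field `F` of characteristic `p > 0`:
    (p : ℕ) (hp : p ≠ 0) (F : Type u) [Field F] [Algebra F R] [CharP F p]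
    (hGor : IsImageOfGorensteinLocalRing R)
    -- a system of parameters `x : Fin d → R`, `d = dim R`:
    (d : ℕ) (hd : ringKrullDim R = d) (x : Fin d → R)
    (hx𝔪 : ∀ i, x i ∈ maximalIdeal R)
    (hx : (Ideal.span (Set.range x)).radical = maximalIdeal R) :
    RingTheory.Sequence.IsRegular
      (integralClosure R (AlgebraicClosure (FractionRing R))) (List.ofFn x) := by
  have : Fact p.Prime := ⟨(CharP.char_is_prime_or_zero F p).resolve_right hp⟩
  have : CharP R p := charP_of_injective_algebraMap (FaithfulSMul.algebraMap_injective F R) p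
  let L := AlgebraicClosure (FractionRing R)
  let B := integralClosure R L
  have : FaithfulSMul R L := FaithfulSMul.trans R (FractionRing R) L
  have hinj : Function.Injective (algebraMap R B) := by
    intro a b h
    exact FaithfulSMul.algebraMap_injective R L (congrArg (algebraMap B L) h)
  have : FaithfulSMul R B := (faithfulSMul_iff_algebraMap_injective R B).2 hinj
  have : CharP B p := charP_of_injective_algebraMap hinj p
  have hl : ∀ r ∈ List.ofFn x, r ∈ maximalIdeal R := List.forall_mem_ofFn_iff.2 hx𝔪
  obtain ⟨A, _, hA, f, hf⟩ := hGor
  let _ : Algebra A R := f.toAlgebra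
  let _ : Algebra A B := ((algebraMap R B).comp f).toAlgebra
  have : IsScalarTower A R B := IsScalarTower.of_algebraMap_eq fun _ => rfl
  refine ⟨PlusClosure.isWeaklyRegular_of_surjective hA hf p (PlusClosure.frobSelf_solvable A L p)
    (PlusClosure.frobSelf_closed A L p) _ (by rw [hd, List.length_ofFn]) hl ?_,
    PlusClosure.top_ne_ofList_smul_top _ hl⟩
  rw [← hx, Ideal.ofList]
  simp only [List.mem_ofFn]
  rfl
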